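/- If f(z) = ∑_{k≥1} a_{2k−1} z^{2k−1} is odd and univalent (injective) in the unit disk 𝔻 with a_1 = 1, then for every positive integer n the partial sum S_n = ∑_{k=1}^n |a_{2k−1}| satisfies S_n ≤ n. -/

import Mathlib

/-- Second Lebedev–Milin inequality (special case). -/
lemma lebedev_milin (n : ℕ) (β γ : ℕ → ℂ) (h0 : β 0 = 1)
    (hrec : ∀ k : ℕ, ((k : ℂ) + 1) * β (k + 1) =
      ∑ j ∈ Finset.range (k + 1), ((j : ℂ) + 1) * γ (j + 1) * β (k - j))
    (hM : ∑ k ∈ Finset.range n, ((n : ℝ) - k) *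
      (((k : ℝ) + 1) * ‖γ (k + 1)‖ ^ 2 - 1 / ((k : ℝ) + 1)) ≤ 0) :
    ∑ k ∈ Finset.range (n + 1), ‖β k‖ ^ 2 ≤ (n : ℝ) + 1 := by
  set A : ℕ → ℝ := fun k => ∑ j ∈ Finset.range k, (((j : ℝ) + 1) * ‖γ (j + 1)‖) ^ 2 with hA
  set B : ℕ → ℝ := fun k => ∑ j ∈ Finset.range (k + 1), ‖β j‖ ^ 2 with hB
  have hcs : ∀ k : ℕ, (((k : ℝ) + 1) * ‖β (k + 1)‖) ^ 2 ≤ A (k + 1) * B k := by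
    intro k
    have h1 : ((k : ℝ) + 1) * ‖β (k + 1)‖ ≤
        ∑ j ∈ Finset.range (k + 1), (((j : ℝ) + 1) * ‖γ (j + 1)‖) * ‖β (k - j)‖ := by
      have : ‖((k : ℂ) + 1) * β (k + 1)‖ = ((k : ℝ) + 1) * ‖β (k + 1)‖ := by
        rw [norm_mul]; congr 1
        exact_mod_cast Complex.norm_natCast (k + 1)
      rw [← this, hrec k]
      refine (norm_sum_le _ _).trans (Finset.sum_le_sum fun j _ => ?_)
      rw [norm_mul, norm_mul]
      have : ‖((j : ℂ) + 1)‖ = (j : ℝ) + 1 := by exact_mod_cast Complex.norm_natCast (j + 1)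
      rw [this]
    have h2 := Finset.sum_mul_sq_le_sq_mul_sq (Finset.range (k + 1))
      (fun j => (((j : ℝ) + 1) * ‖γ (j + 1)‖)) (fun j => ‖β (k - j)‖)
    have h3 : ∑ j ∈ Finset.range (k + 1), ‖β (k - j)‖ ^ 2 = B k := by
      have := Finset.sum_range_reflect (fun j => ‖β j‖ ^ 2) (k + 1)
      simpa [hB] using this
    rw [h3] at h2
    refine le_trans ?_ h2
    gcongr
  have hBpos : ∀ k, 0 ≤ B k := fun k => Finset.sum_nonneg fun _ _ => by positivity
  have hstep : ∀ k : ℕ, B k ≤ ((k : ℝ) + 1) *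
      Real.exp (∑ j ∈ Finset.range k, (A (j + 1) - (j + 1)) / (((j : ℝ) + 1) * (j + 2))) := by
    intro k
    induction k with
    | zero => simp [hB, h0]
    | succ k ih =>
      have e1 : B (k + 1) = B k + ‖β (k + 1)‖ ^ 2 := Finset.sum_range_succ _ _
      have h1 : ‖β (k + 1)‖ ^ 2 ≤ A (k + 1) / ((k : ℝ) + 1) ^ 2 * B k := by
        have := hcs k
        rw [mul_pow] at this
        rw [div_mul_eq_mul_div, le_div_iff₀ (by positivity)]
        linarith
      have h2 : 1 + A (k + 1) / ((k : ℝ) + 1) ^ 2 ≤ ((k : ℝ) + 2) / (k + 1) *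
          Real.exp ((A (k + 1) - (k + 1)) / (((k : ℝ) + 1) * (k + 2))) := by
        have := Real.add_one_le_exp ((A (k + 1) - (k + 1)) / (((k : ℝ) + 1) * (k + 2)))
        have h3 : 1 + A (k + 1) / ((k : ℝ) + 1) ^ 2 = ((k : ℝ) + 2) / (k + 1) *
           ((A (k + 1) - (k + 1)) / (((k : ℝ) + 1) * (k + 2)) + 1) := by
          field_simp; ring
        rw [h3]; gcongr
      rw [Finset.sum_range_succ, Real.exp_add]
      calc B (k + 1) ≤ (1 + A (k + 1) / ((k : ℝ) + 1) ^ 2) * B k := by rw [e1]; linarith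
        _ ≤ (((k : ℝ) + 2) / (k + 1) *
          Real.exp ((A (k + 1) - (k + 1)) / (((k : ℝ) + 1) * (k + 2)))) * (((k : ℝ) + 1) *
            Real.exp (∑ j ∈ Finset.range k, (A (j + 1) - (j + 1)) / (((j : ℝ) + 1) * (j + 2)))) := by
          gcongr
        _ = _ := by push_cast; field_simp; ring
  have hsum : ∀ n : ℕ, ((n : ℝ) + 1) * ∑ j ∈ Finset.range n,
      (A (j + 1) - (j + 1)) / (((j : ℝ) + 1) * (j + 2)) =
      ∑ k ∈ Finset.range n, ((n : ℝ) - k) *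
      (((k : ℝ) + 1) * ‖γ (k + 1)‖ ^ 2 - 1 / ((k : ℝ) + 1)) := by
    -- auxiliary: ∑_{k<n} (k+1)(x_k) = A n - n
    have haux : ∀ n : ℕ, ∑ k ∈ Finset.range n, ((k : ℝ) + 1) *
      (((k : ℝ) + 1) * ‖γ (k + 1)‖ ^ 2 - 1 / ((k : ℝ) + 1)) = A n - n := by
      intro n
      induction n with
      | zero => simp [hA]
      | succ n ih =>
        rw [Finset.sum_range_succ, ih]
        have : A (n + 1) = A n + (((n : ℝ) + 1) * ‖γ (n + 1)‖) ^ 2 := Finset.sum_range_succ _ _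
        rw [this]; push_cast; field_simp; ring
    intro n
    induction n with
    | zero => simp
    | succ n ih =>
      have h1 : ∑ k ∈ Finset.range (n + 1), (((n + 1 : ℕ) : ℝ) - k) *
          (((k : ℝ) + 1) * ‖γ (k + 1)‖ ^ 2 - 1 / ((k : ℝ) + 1)) =
          ((n : ℝ) + 2) / (n + 1) * ∑ k ∈ Finset.range (n + 1), ((n : ℝ) - k) *
          (((k : ℝ) + 1) * ‖γ (k + 1)‖ ^ 2 - 1 / ((k : ℝ) + 1)) +
          1 / (n + 1) * ∑ k ∈ Finset.range (n + 1), ((k : ℝ) + 1) *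
          (((k : ℝ) + 1) * ‖γ (k + 1)‖ ^ 2 - 1 / ((k : ℝ) + 1)) := by
        rw [Finset.mul_sum, Finset.mul_sum, ← Finset.sum_add_distrib]
        refine Finset.sum_congr rfl fun k _ => ?_
        push_cast; field_simp; ring
      rw [h1, haux]
      nth_rewrite 2 [Finset.sum_range_succ]
      rw [sub_self, zero_mul, add_zero, ← ih, Finset.sum_range_succ]
      push_cast; field_simp; ring
  refine (hstep n).trans ?_
  have : ∑ j ∈ Finset.range n, (A (j + 1) - (j + 1)) / (((j : ℝ) + 1) * (j + 2)) ≤ 0 := by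
    have h := hsum n
    have h2 : ((n : ℝ) + 1) * ∑ j ∈ Finset.range n,
      (A (j + 1) - (j + 1)) / (((j : ℝ) + 1) * (j + 2)) ≤ 0 := by rw [h]; exact hM
    by_contra hc
    push Not at hc
    have : 0 < ((n : ℝ) + 1) * ∑ j ∈ Finset.range n,
      (A (j + 1) - (j + 1)) / (((j : ℝ) + 1) * (j + 2)) := by positivity
    linarith
  calc _ ≤ ((n : ℝ) + 1) * 1 := by
        gcongr
        rwa [Real.exp_le_one_iff]
    _ = _ := mul_one _


namespace DB
open Polynomial

section Sym
variable {A : Type*} [CommRing A]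

/-- product of linear forms -/
noncomputable def lin (a b c d : A) (i m : ℕ) : A[X] := (C a * X + C b) ^ i * (C c * X + C d) ^ m

lemma lin_succ_left (a b c d : A) (i m : ℕ) :
    lin a b c d (i + 1) m = lin a b c d i m * (C a * X + C b) := by
  simp only [lin]; ring

lemma lin_succ_right (a b c d : A) (i m : ℕ) :
    lin a b c d i (m + 1) = lin a b c d i m * (C c * X + C d) := by
  simp only [lin]; ring

lemma natDegree_lin_le (a b c d : A) (i m : ℕ) : (lin a b c d i m).natDegree ≤ i + m := by
  refine natDegree_mul_le.trans (add_le_add ?_ ?_)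
  · refine (natDegree_pow_le).trans ?_
    have := natDegree_linear_le (a := a) (b := b)
    nlinarith
  · refine (natDegree_pow_le).trans ?_
    have := natDegree_linear_le (a := c) (b := d)
    nlinarith

lemma coeff_mul_lin_succ (p : A[X]) (a b : A) (j : ℕ) :
    (p * (C a * X + C b)).coeff (j + 1) = a * p.coeff j + b * p.coeff (j + 1) := by
  rw [mul_add, ← mul_assoc, coeff_add, coeff_mul_X, coeff_mul_C, coeff_mul_C]; ring

lemma coeff_mul_lin_zero (p : A[X]) (a b : A) :
    (p * (C a * X + C b)).coeff 0 = b * p.coeff 0 := by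
  rw [mul_add, ← mul_assoc, coeff_add, coeff_mul_C]; simp [mul_comm]

/-- homogenized evaluation -/
noncomputable def hom (p : A[X]) (N : ℕ) (u v : A) : A :=
  ∑ j ∈ Finset.range (N + 1), p.coeff j * u ^ j * v ^ (N - j)

lemma hom_mul (p : A[X]) (N : ℕ) (hp : p.natDegree ≤ N) (a b u v : A) :
    hom (p * (C a * X + C b)) (N + 1) u v = hom p N u v * (a * u + b * v) := by
  have h0 : p.coeff (N + 1) = 0 := coeff_eq_zero_of_natDegree_lt (by omega)
  have e1 : hom p N u v * (b * v) = ∑ j ∈ Finset.range (N + 2), b * p.coeff j * u ^ j * v ^ (N + 1 - j) := by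
    rw [Finset.sum_range_succ, h0, hom, Finset.sum_mul]
    simp only [mul_zero, zero_mul, add_zero]
    refine Finset.sum_congr rfl fun j hj => ?_
    have : N + 1 - j = (N - j) + 1 := by have := Finset.mem_range.1 hj; omega
    rw [this]; ring
  rw [show hom p N u v * (a * u + b * v) = hom p N u v * (a * u) + hom p N u v * (b * v) by ring, e1, hom,
    Finset.sum_range_succ', Finset.sum_range_succ' _ (N + 1), ← add_assoc, hom,
    Finset.sum_mul, ← Finset.sum_add_distrib]
  congr 1
  · refine Finset.sum_congr rfl fun j hj => ?_
    rw [coeff_mul_lin_succ]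
    have : N + 1 - (j + 1) = (N - j) := by omega
    rw [this]; ring
  · rw [coeff_mul_lin_zero]

lemma hom_lin (a b c d u v : A) (i m : ℕ) :
    hom (lin a b c d i m) (i + m) u v = (a * u + b * v) ^ i * (c * u + d * v) ^ m := by
  induction m with
  | zero =>
    induction i with
    | zero => simp [hom, lin]
    | succ i ih =>
      rw [lin_succ_left]
      have := hom_mul (lin a b c d i 0) (i + 0) (natDegree_lin_le ..) a b u v
      rw [show i + 1 + 0 = i + 0 + 1 by ring, this, ih]; ring
  | succ m ih =>
    rw [lin_succ_right]
    have := hom_mul (lin a b c d i m) (i + m) (natDegree_lin_le ..) c d u v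
    rw [show i + (m + 1) = i + m + 1 by ring, this, ih]; ring

/-- trace of the symmetric power -/
noncomputable def trS (a b c d : A) (n : ℕ) : A :=
  ∑ ij ∈ Finset.HasAntidiagonal.antidiagonal n, (lin a b c d ij.1 ij.2).coeff ij.1

noncomputable def epS (a b c d : A) (n : ℕ) : A :=
  ∑ ij ∈ Finset.HasAntidiagonal.antidiagonal n, (lin a b c d ij.1 ij.2).coeff (ij.1 + 1)

lemma epS_succ (a b c d : A) (n : ℕ) :
    epS a b c d (n + 1) = c * trS a b c d n + d * epS a b c d n := by
  rw [epS, Finset.Nat.sum_antidiagonal_succ', epS, trS, Finset.mul_sum, Finset.mul_sum,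
    ← Finset.sum_add_distrib]
  have : (lin a b c d (n + 1) 0).coeff (n + 1 + 1) = 0 :=
    coeff_eq_zero_of_natDegree_lt (by have := natDegree_lin_le a b c d (n + 1) 0; omega)
  simp only [this, zero_add]
  refine Finset.sum_congr rfl fun ij _ => ?_
  rw [lin_succ_right, coeff_mul_lin_succ]

lemma trS_succ (a b c d : A) (n : ℕ) :
    trS a b c d (n + 1) = d ^ (n + 1) + a * trS a b c d n + b * epS a b c d n := by
  rw [trS, Finset.Nat.sum_antidiagonal_succ, epS, trS, Finset.mul_sum, Finset.mul_sum,
    add_assoc, ← Finset.sum_add_distrib]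
  congr 1
  · simp only [lin, pow_zero, one_mul, coeff_zero_eq_eval_zero]; simp
  refine Finset.sum_congr rfl fun ij _ => ?_
  rw [lin_succ_left, coeff_mul_lin_succ]

lemma trS_rec (a b c d : A) (n : ℕ) :
    trS a b c d (n + 2) = (a + d) * trS a b c d (n + 1) - (a * d - b * c) * trS a b c d n := by
  rw [trS_succ a b c d (n + 1), epS_succ]
  have h := trS_succ a b c d n
  linear_combination (-d) * h

lemma trS_zero (a b c d : A) : trS a b c d 0 = 1 := by simp [trS, lin]

lemma trS_one (a b c d : A) : trS a b c d 1 = a + d := by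
  rw [trS_succ, trS_zero]; simp [epS, lin, coeff_one]; ring

lemma lin_mul_coeff (a b c d a' b' c' d' : A) (i m k : ℕ) :
    (lin (a * a' + b * c') (a * b' + b * d') (c * a' + d * c') (c * b' + d * d') i m).coeff k =
    ∑ j ∈ Finset.range (i + m + 1), (lin a b c d i m).coeff j *
      (lin a' b' c' d' j (i + m - j)).coeff k := by
  have h := hom_lin (C a : A[X]) (C b) (C c) (C d) (C a' * X + C b') (C c' * X + C d') i m
  have e : lin (a * a' + b * c') (a * b' + b * d') (c * a' + d * c') (c * b' + d * d') i m =
      hom (lin (C a : A[X]) (C b) (C c) (C d) i m) (i + m) (C a' * X + C b') (C c' * X + C d') := by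
    rw [h, lin]; congr 2 <;> simp only [C_add, C_mul] <;> ring
  have e2 : lin (C a : A[X]) (C b) (C c) (C d) i m = (lin a b c d i m).map C := by
    simp [lin, Polynomial.map_mul, Polynomial.map_pow]
  rw [e, hom, finsetSum_coeff, e2]
  refine Finset.sum_congr rfl fun j hj => ?_
  rw [coeff_map, mul_assoc, coeff_C_mul]; rfl

lemma lin_scale (a b c d t : A) (i m k : ℕ) :
    (lin (a * t) b (c * t) d i m).coeff k = (lin a b c d i m).coeff k * t ^ k := by
  have : lin (a * t) b (c * t) d i m = (lin a b c d i m).comp (C t * X) := by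
    simp only [lin, mul_comp, pow_comp, add_comp, C_comp, X_comp]
    congr 2 <;> simp only [C_mul] <;> ring
  rw [this, comp_C_mul_X_coeff]

lemma lin_map {B : Type*} [CommRing B] (φ : A →+* B) (a b c d : A) (i m k : ℕ) :
    (lin (φ a) (φ b) (φ c) (φ d) i m).coeff k = φ ((lin a b c d i m).coeff k) := by
  rw [← coeff_map]; simp [lin, Polynomial.map_mul, Polynomial.map_pow]

open Bivariate in
lemma coeff_coeff_swap' (p : A[X][Y]) (i j : ℕ) :
    ((Bivariate.swap p).coeff i).coeff j = (p.coeff j).coeff i := by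
  induction p using Polynomial.induction_on' with
  | add p q hp hq => simp [hp, hq]
  | monomial n f =>
    induction f using Polynomial.induction_on' with
    | add p q hp hq => simp only [map_add, coeff_add, hp, hq]
    | monomial m r =>
      rw [Bivariate.swap_monomial_monomial]
      simp only [coeff_monomial]
      split_ifs <;> simp_all [coeff_monomial]

open Bivariate in
lemma lin_transpose (a b c d : A) (i m j l : ℕ) (h : i + m = j + l) :
    ((i + m).choose i : A) * (lin a b c d i m).coeff j =
    ((i + m).choose j : A) * (lin a c b d j l).coeff i := by
  have key : ∀ (a b c d : A) (i m j : ℕ), (((C (C a * X + C b) * Y + C (C c * X + C d)) ^ (i + m) :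
      A[X][Y]).coeff i).coeff j = ((i + m).choose i : A) * (lin a b c d i m).coeff j := by
    intro a b c d i m j
    rw [add_pow, finsetSum_coeff, Finset.sum_eq_single i]
    · have : ((C (C a * X + C b) * Y) ^ i * C (C c * X + C d) ^ (i + m - i) * (((i + m).choose i : ℕ) : A[X][Y])) =
        C (((i + m).choose i : A[X]) * lin a b c d i m) * Y ^ i := by
        rw [Nat.add_sub_cancel_left]
        simp only [lin, C_mul, C_pow, map_natCast]; ring
      rw [this, coeff_C_mul, coeff_X_pow]
      simp only [if_true, mul_one]
      rw [show (((i + m).choose i : ℕ) : A[X]) = C (((i + m).choose i : ℕ) : A) by simp, coeff_C_mul]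
    · intro b' _ hb'
      have : ((C (C a * X + C b) * Y) ^ b' * C (C c * X + C d) ^ (i + m - b') * (((i + m).choose b' : ℕ) : A[X][Y])) =
        C (((i + m).choose b' : A[X]) * ((C a * X + C b) ^ b' * (C c * X + C d) ^ (i + m - b'))) * Y ^ b' := by
        simp only [C_mul, C_pow, map_natCast]; ring
      rw [this, coeff_C_mul, coeff_X_pow, if_neg hb'.symm, mul_zero]
    · intro h; exact absurd (Finset.mem_range.2 (by omega)) h
  rw [← key, h, ← key, ← coeff_coeff_swap']
  congr 2
  simp only [map_pow, map_add, map_mul, Bivariate.swap_X, Bivariate.swap_Y, Bivariate.swap_C_C]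
  ring

end Sym

/-- The functions `u_{n,k}(y)`: Laurent coefficients of `U_n(1-y+y cos φ)`. -/
noncomputable def U : ℕ → ℤ → ℝ → ℝ
  | 0, k, _ => if k = 0 then 1 else 0
  | 1, k, y => 2 * (1 - y) * (if k = 0 then 1 else 0) + y * ((if k - 1 = 0 then 1 else 0) +
      (if k + 1 = 0 then 1 else 0))
  | (n + 2), k, y => 2 * (1 - y) * U (n + 1) k y + y * (U (n + 1) (k - 1) y + U (n + 1) (k + 1) y)
      - U n k y

open LaurentPolynomial in
lemma coeff_T_mul (p : LaurentPolynomial ℝ) (m k : ℤ) : (T m * p).coeff k = p.coeff (k - m) := by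
  have := AddMonoidAlgebra.coeff_single_mul_eq_mul_coeff (R := ℝ) (x := p) (r := (1:ℝ)) (m := m) (m₁ := k) (m₂ := k - m)
    (fun m' _ => by constructor <;> intro h <;> omega)
  simpa using this

open LaurentPolynomial in
lemma coeff_C_mul' (p : LaurentPolynomial ℝ) (r : ℝ) (k : ℤ) :
    (LaurentPolynomial.C r * p).coeff k = r * p.coeff k := by
  have := AddMonoidAlgebra.coeff_single_mul_eq_mul_coeff (R := ℝ) (x := p) (r := r) (m := (0:ℤ)) (m₁ := k) (m₂ := k)
    (fun m' _ => by constructor <;> intro h <;> omega)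
  simpa using this

open LaurentPolynomial in
lemma U_eq (n : ℕ) (k : ℤ) (s c y : ℝ) (hs : s ^ 2 = y) (hc : c ^ 2 = 1 - y) :
    U n k y = (trS (A := LaurentPolynomial ℝ)
      ((LaurentPolynomial.C c * T 1) * (LaurentPolynomial.C c * T (-1)) + LaurentPolynomial.C (-s) * (LaurentPolynomial.C (-s) * T (-1)))
      ((LaurentPolynomial.C c * T 1) * LaurentPolynomial.C s + LaurentPolynomial.C (-s) * LaurentPolynomial.C c)
      ((LaurentPolynomial.C s * T 1) * (LaurentPolynomial.C c * T (-1)) + LaurentPolynomial.C c * (LaurentPolynomial.C (-s) * T (-1)))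
      ((LaurentPolynomial.C s * T 1) * LaurentPolynomial.C s + LaurentPolynomial.C c * LaurentPolynomial.C c) n).coeff k := by
  have hT : (T 1 * T (-1) : LaurentPolynomial ℝ) = 1 := by rw [← T_add]; simp
  have hcs : (LaurentPolynomial.C c * LaurentPolynomial.C c + LaurentPolynomial.C s * LaurentPolynomial.C s : LaurentPolynomial ℝ) = 1 := by
    rw [← map_mul, ← map_mul, ← map_add, show c * c + s * s = 1 by nlinarith, map_one]
  have h1 : (LaurentPolynomial.C c * LaurentPolynomial.C c : LaurentPolynomial ℝ) = LaurentPolynomial.C (1 - y) := by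
    rw [← map_mul, ← hc, sq]
  have h2 : (LaurentPolynomial.C s * LaurentPolynomial.C s : LaurentPolynomial ℝ) = LaurentPolynomial.C (y) := by
    rw [← map_mul, ← hs, sq]
  set a := ((LaurentPolynomial.C c * T 1) * (LaurentPolynomial.C c * T (-1)) + LaurentPolynomial.C (-s) * (LaurentPolynomial.C (-s) * T (-1))) with ha
  set b := ((LaurentPolynomial.C c * T 1) * LaurentPolynomial.C s + LaurentPolynomial.C (-s) * LaurentPolynomial.C c) with hb
  set c' := ((LaurentPolynomial.C s * T 1) * (LaurentPolynomial.C c * T (-1)) + LaurentPolynomial.C c * (LaurentPolynomial.C (-s) * T (-1))) with hc'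
  set d := ((LaurentPolynomial.C s * T 1) * LaurentPolynomial.C s + LaurentPolynomial.C c * LaurentPolynomial.C c) with hd
  have tr : a + d = LaurentPolynomial.C (2 * (1 - y)) + LaurentPolynomial.C y * (T 1 + T (-1)) := by
    rw [map_mul, ← h1, ← h2, ha, hd, map_neg]
    simp only [map_ofNat]
    linear_combination (LaurentPolynomial.C c * LaurentPolynomial.C c) * hT
  have det : a * d - b * c' = 1 := by
    have : a * d - b * c' = (LaurentPolynomial.C c * LaurentPolynomial.C c + LaurentPolynomial.C s * LaurentPolynomial.C s)^2 * (T 1 * T (-1)) := by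
      rw [ha, hb, hc', hd, map_neg]; ring
    rw [this, hcs, hT]; ring
  have key : ∀ n, (∀ k, U n k y = (trS a b c' d n).coeff k) ∧ (∀ k, U (n + 1) k y = (trS a b c' d (n + 1)).coeff k) := by
    intro n
    induction n with
    | zero =>
      constructor
      · intro k
        rw [trS_zero, U, AddMonoidAlgebra.one_def, AddMonoidAlgebra.coeff_single, Finsupp.single_apply]
        simp [eq_comm]
      · intro k
        have h1k : ∀ k, (1 : LaurentPolynomial ℝ).coeff k = if k = 0 then 1 else 0 := by
          intro k
          rw [AddMonoidAlgebra.one_def, AddMonoidAlgebra.coeff_single, Finsupp.single_apply]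
          simp [eq_comm]
        rw [trS_one, tr, U, mul_add, ← mul_one (LaurentPolynomial.C _), ← mul_one (T 1), ← mul_one (T (-1))]
        simp only [AddMonoidAlgebra.coeff_add, Finsupp.add_apply, coeff_C_mul', coeff_T_mul, h1k]
        simp only [sub_neg_eq_add]; ring
    | succ n ih =>
      refine ⟨ih.2, fun k => ?_⟩
      rw [trS_rec, tr, det, one_mul, U, ih.1, ih.2, ih.2, ih.2, add_mul, mul_assoc (LaurentPolynomial.C y), add_mul (T 1), mul_add (LaurentPolynomial.C y)]
      simp only [AddMonoidAlgebra.coeff_add, AddMonoidAlgebra.coeff_sub, Finsupp.add_apply, Finsupp.sub_apply, coeff_C_mul', coeff_T_mul, sub_neg_eq_add]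
      ring
  exact (key n).1 k

open LaurentPolynomial in
lemma U_nonneg (n : ℕ) (k : ℤ) (y : ℝ) (hy0 : 0 ≤ y) (hy1 : y ≤ 1) : 0 ≤ U n k y := by
  rw [U_eq n k (√y) (√(1 - y)) y (Real.sq_sqrt hy0) (Real.sq_sqrt (by linarith))]
  generalize √y = s
  generalize √(1 - y) = c
  rw [trS, AddMonoidAlgebra.coeff_sum, Finsupp.finsetSum_apply]
  refine Finset.sum_nonneg fun ij hij => ?_
  rw [lin_mul_coeff, AddMonoidAlgebra.coeff_sum, Finsupp.finsetSum_apply]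
  refine Finset.sum_nonneg fun j hj => ?_
  rw [lin_scale, lin_scale, lin_map, lin_map]
  obtain ⟨i, m⟩ := ij
  have hjle : j ≤ i + m := by have := Finset.mem_range.1 hj; omega
  have ht := lin_transpose c (-s) s c i m j (i + m - j) (by omega)
  dsimp only
  generalize (lin c (-s) s c i m).coeff j = x at *
  generalize (lin c s (-s) c j (i + m - j)).coeff i = x' at *
  rw [show (LaurentPolynomial.C x * T 1 ^ j * (LaurentPolynomial.C x' * T (-1) ^ i) : LaurentPolynomial ℝ)
    = LaurentPolynomial.C x * (LaurentPolynomial.C x' * (T 1 ^ j * T (-1) ^ i)) by ring, coeff_C_mul', coeff_C_mul', T_pow, T_pow,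
    ← mul_one (T _ * T _), mul_assoc, coeff_T_mul, coeff_T_mul, AddMonoidAlgebra.one_def, AddMonoidAlgebra.coeff_single, Finsupp.single_apply]
  have p1 : (0:ℝ) < ((i + m).choose i : ℝ) := by exact_mod_cast Nat.choose_pos (by omega)
  have p2 : (0:ℝ) < ((i + m).choose j : ℝ) := by exact_mod_cast Nat.choose_pos hjle
  have : 0 ≤ x * x' := by
    have : x = ((i + m).choose j : ℝ) / ((i + m).choose i : ℝ) * x' := by field_simp; linarith
    rw [this, mul_assoc]
    exact mul_nonneg (by positivity) (mul_self_nonneg _)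
  rw [← mul_assoc]
  refine mul_nonneg this ?_
  split_ifs <;> norm_num

end DB

namespace DB

lemma two_step {P : ℕ → Prop} (h0 : P 0) (h1 : P 1) (h : ∀ n, P n → P (n + 1) → P (n + 2)) (n : ℕ) : P n := by
  have : P n ∧ P (n + 1) := by
    induction n with
    | zero => exact ⟨h0, h1⟩
    | succ n ih => exact ⟨ih.2, h n ih.1 ih.2⟩
  exact this.1

lemma U_support (y : ℝ) (n : ℕ) : ∀ k : ℤ, (n : ℤ) < |k| → U n k y = 0 := by
  induction n using two_step with
  | h0 => intro k hk; rw [U, if_neg]; rintro rfl; simp at hk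
  | h1 =>
    intro k hk
    have : k < -1 ∨ 1 < k := by rcases lt_abs.1 hk with h | h <;> push_cast at h <;> omega
    rw [U, if_neg (by omega), if_neg (by omega), if_neg (by omega)]; ring
  | h n ih1 ih2 =>
    intro k hk
    have hk' : (n:ℤ) + 2 < k ∨ k < -((n:ℤ) + 2) := by rcases lt_abs.1 hk with h | h <;> push_cast at h <;> omega
    rw [U, ih1, ih2, ih2, ih2]
    · ring
    all_goals
      rw [lt_abs]; push_cast; omega

lemma U_one (n : ℕ) : ∀ k : ℤ, U n k 1 = if |k| ≤ n ∧ (k - n) % 2 = 0 then 1 else 0 := by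
  induction n using two_step with
  | h0 =>
    intro k; rw [U]; congr 1; ext; simp only [Nat.cast_zero, abs_nonpos_iff]; constructor
    · rintro rfl; simp
    · exact fun h => h.1
  | h1 =>
    intro k
    rw [U]
    simp only [abs_le, Nat.cast_one]
    by_cases h : k = 1
    · subst h; norm_num
    by_cases h : k = -1
    · subst h; norm_num
    rw [if_neg (show ¬ (k - 1 = 0) by omega), if_neg (show ¬ (k + 1 = 0) by omega),
      if_neg (show ¬ ((-1 ≤ k ∧ k ≤ 1) ∧ (k - 1) % 2 = 0) by omega)]
    ring
  | h n ih1 ih2 =>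
    intro k
    rw [U, ih1, ih2, ih2, ih2]
    simp only [abs_le]
    push_cast
    split_ifs <;> first | (exfalso; omega) | norm_num

lemma U_one_add (n k : ℕ) (hk : k ≤ n) : U n k 1 + U n (k + 1) 1 = 1 := by
  rw [U_one, U_one]
  simp only [abs_le]
  split_ifs <;> first | (exfalso; omega) | norm_num

lemma U_contDiff (n : ℕ) : ∀ k : ℤ, ContDiff ℝ 1 (U n k) := by
  induction n using two_step with
  | h0 => intro k; exact contDiff_const
  | h1 =>
    intro k
    have : U 1 k = fun y => 2 * (1 - y) * (if k = 0 then 1 else 0) + y * ((if k - 1 = 0 then 1 else 0) +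
      (if k + 1 = 0 then 1 else 0)) := by ext; rw [U]
    rw [this]; fun_prop
  | h n ih1 ih2 =>
    intro k
    have : U (n+2) k = fun y => 2 * (1 - y) * U (n + 1) k y + y * (U (n + 1) (k - 1) y + U (n + 1) (k + 1) y)
      - U n k y := by ext; rw [U]
    rw [this]
    have a1 := ih1 k
    have a2 := ih2 k
    have a3 := ih2 (k-1)
    have a4 := ih2 (k+1)
    fun_prop

lemma U_deriv (n : ℕ) (k : ℤ) (y : ℝ) : HasDerivAt (U n k) (deriv (U n k) y) y :=
  ((U_contDiff n k).differentiable (by norm_num)).differentiableAt.hasDerivAt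

lemma U_deriv_rel (y : ℝ) (n : ℕ) : ∀ k : ℤ, y * (deriv (U n k) y + deriv (U n (k+1)) y) =
    k * U n k y - (k + 1) * U n (k+1) y := by
  induction n using two_step with
  | h0 =>
    intro k
    have : ∀ k, deriv (U 0 k) y = 0 := by
      intro k
      have : U 0 k = fun y => if k = 0 then 1 else 0 := by ext; rw [U]
      rw [this]; simp
    rw [this, this, U, U]
    by_cases h : k = 0
    · subst h; simp
    by_cases h' : k = -1
    · subst h'; simp
    rw [if_neg h, if_neg (by omega)]; simp
  | h1 =>
    intro k
    have hd : ∀ k, deriv (U 1 k) y = -2 * (if k = 0 then 1 else 0) + ((if k - 1 = 0 then 1 else 0) +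
      (if k + 1 = 0 then 1 else 0)) := by
      intro k
      have : U 1 k = fun y => 2 * (1 - y) * (if k = 0 then 1 else 0) + y * ((if k - 1 = 0 then 1 else 0) +
        (if k + 1 = 0 then 1 else 0)) := by ext; rw [U]
      rw [this]
      refine HasDerivAt.deriv ?_
      have := ((((hasDerivAt_id y).const_sub 1).const_mul 2).mul_const (if k = 0 then (1:ℝ) else 0)).add
        ((hasDerivAt_id y).mul_const ((if k - 1 = 0 then (1:ℝ) else 0) + (if k + 1 = 0 then (1:ℝ) else 0)))
      exact this.congr_deriv (by ring)
    rw [hd, hd, U, U]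
    by_cases h : k = 0
    · subst h; norm_num <;> ring
    by_cases h : k = 1
    · subst h; norm_num
    by_cases h : k = -1
    · subst h; norm_num <;> ring
    by_cases h : k = -2
    · subst h; norm_num
    simp only [if_neg (show ¬ (k = 0) by omega), if_neg (show ¬ (k - 1 = 0) by omega),
      if_neg (show ¬ (k + 1 = 0) by omega), if_neg (show ¬ (k + 1 - 1 = 0) by omega), if_neg (show ¬ (k + 1 + 1 = 0) by omega)]
    ring
  | h n ih1 ih2 =>
    intro k
    have hd : ∀ k, deriv (U (n+2) k) y = -2 * U (n+1) k y + 2 * (1 - y) * deriv (U (n + 1) k) y +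
        (U (n + 1) (k - 1) y + U (n + 1) (k + 1) y) +
        y * (deriv (U (n + 1) (k - 1)) y + deriv (U (n + 1) (k + 1)) y) - deriv (U n k) y := by
      intro k
      have : U (n+2) k = fun y => 2 * (1 - y) * U (n + 1) k y + y * (U (n + 1) (k - 1) y + U (n + 1) (k + 1) y)
        - U n k y := by ext; rw [U]
      rw [this]
      refine HasDerivAt.deriv ?_
      have := (((((hasDerivAt_id y).const_sub 1).const_mul 2).mul (U_deriv (n+1) k y)).add
        ((hasDerivAt_id y).mul ((U_deriv (n+1) (k-1) y).add (U_deriv (n+1) (k+1) y)))).sub (U_deriv n k y)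
      exact this.congr_deriv (by simp only [id]; simp; ring)
    rw [hd, hd, U, U]
    have a1 := ih1 k
    have a2 := ih2 k
    have a3 := ih2 (k-1)
    have a4 := ih2 (k+1)
    simp only [sub_add_cancel, add_sub_cancel_right] at *
    push_cast at *
    linear_combination -a1 + 2 * (1 - y) * a2 + y * a3 + y * a4

/-- de Branges type weight functions -/
noncomputable def tau (n k : ℕ) (t : ℝ) : ℝ :=
  ∑ j ∈ Finset.Ico k (n + 1), (U n j (Real.exp (-t)) + U n (j + 1) (Real.exp (-t)))

/-- minus the derivative of tau over k -/
noncomputable def om (n k : ℕ) (t : ℝ) : ℝ := U n k (Real.exp (-t))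

lemma om_nonneg (n k : ℕ) {t : ℝ} (ht : 0 ≤ t) : 0 ≤ om n k t :=
  U_nonneg _ _ _ (Real.exp_pos _).le (by rw [Real.exp_le_one_iff]; linarith)

lemma om_top (n : ℕ) (t : ℝ) : om n (n + 1) t = 0 := by
  rw [om, U_support]; push_cast; rw [lt_abs]; left; omega

lemma tau_top (n : ℕ) (t : ℝ) : tau n (n + 1) t = 0 := by simp [tau]

lemma tau_step (n k : ℕ) (hk : k ≤ n) (t : ℝ) : tau n k t = tau n (k + 1) t + om n k t + om n (k + 1) t := by
  rw [tau, Finset.sum_eq_sum_Ico_succ_bot (by omega), ← tau, om, om]; push_cast; ring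

lemma tau_nonneg (n k : ℕ) {t : ℝ} (ht : 0 ≤ t) : 0 ≤ tau n k t := by
  refine Finset.sum_nonneg fun j _ => ?_
  have h1 := om_nonneg n j ht
  have h2 := om_nonneg n (j+1) ht
  simp only [om] at h1 h2; push_cast at h2; linarith

lemma tau_zero (n k : ℕ) (hk : k ≤ n) : tau n k 0 = (n:ℝ) + 1 - k := by
  rw [tau, Finset.sum_congr rfl (g := fun _ => (1:ℝ))]
  · simp; rw [Nat.cast_sub (by omega)]; push_cast; ring
  · intro j hj
    rw [neg_zero, Real.exp_zero, U_one_add n j (by have := Finset.mem_Ico.1 hj; omega)]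

lemma tau_deriv (n k : ℕ) (hk : k ≤ n) (t : ℝ) : HasDerivAt (tau n k) (-(k * om n k t)) t := by
  have hy : HasDerivAt (fun t : ℝ => Real.exp (-t)) (-Real.exp (-t)) t := by
    simpa using (hasDerivAt_neg t).exp
  have h : HasDerivAt (tau n k) (∑ j ∈ Finset.Ico k (n + 1),
      (deriv (U n j) (Real.exp (-t)) * (-Real.exp (-t)) + deriv (U n (j + 1)) (Real.exp (-t)) * (-Real.exp (-t)))) t := by
    have := HasDerivAt.fun_sum (u := Finset.Ico k (n + 1)) (x := t) (A := fun j t => U n j (Real.exp (-t)) + U n (j + 1) (Real.exp (-t)))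
      (A' := fun j => deriv (U n j) (Real.exp (-t)) * (-Real.exp (-t)) + deriv (U n (j + 1)) (Real.exp (-t)) * (-Real.exp (-t)))
      (fun j _ => ((U_deriv n j _).comp t hy).add ((U_deriv n (j+1) _).comp t hy))
    exact this
  convert h using 1
  have h2 : ∀ j ∈ Finset.Ico k (n+1), deriv (U n j) (Real.exp (-t)) * (-Real.exp (-t)) + deriv (U n (j + 1)) (Real.exp (-t)) * (-Real.exp (-t))
     = (fun j : ℕ => (j:ℝ) * om n j t) (j + 1) - (fun j : ℕ => (j:ℝ) * om n j t) j := by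
    intro j _
    have := U_deriv_rel (Real.exp (-t)) n j
    simp only [om]; push_cast at *
    linarith
  rw [Finset.sum_congr rfl h2, Finset.sum_Ico_sub (fun j : ℕ => (j:ℝ) * om n j t) (show k ≤ n + 1 by omega), om_top]; ring

lemma om_bound (n k : ℕ) : ∃ K : ℝ, 0 ≤ K ∧ ∀ t, 0 ≤ t → om n k t ≤ K := by
  obtain ⟨K, hK⟩ := (isCompact_Icc (a := (0:ℝ)) (b := 1)).exists_bound_of_continuousOn
    (U_contDiff n k).continuous.continuousOn
  have hm : ∀ t : ℝ, 0 ≤ t → Real.exp (-t) ∈ Set.Icc (0:ℝ) 1 := fun t ht =>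
    ⟨(Real.exp_pos _).le, by rw [Real.exp_le_one_iff]; linarith⟩
  exact ⟨K, (norm_nonneg _).trans (hK _ (hm 0 le_rfl)), fun t ht => (le_abs_self _).trans (hK _ (hm t ht))⟩

lemma om_lip (n k : ℕ) : ∃ K : ℝ, 0 ≤ K ∧ ∀ t s, 0 ≤ t → t ≤ s → |om n k s - om n k t| ≤ K * (s - t) := by
  obtain ⟨K, hK⟩ := (isCompact_Icc (a := (0:ℝ)) (b := 1)).exists_bound_of_continuousOn
    ((U_contDiff n k).continuous_deriv le_rfl).continuousOn
  have hm : ∀ t : ℝ, 0 ≤ t → Real.exp (-t) ∈ Set.Icc (0:ℝ) 1 := fun t ht =>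
    ⟨(Real.exp_pos _).le, by rw [Real.exp_le_one_iff]; linarith⟩
  refine ⟨K, (norm_nonneg _).trans (hK _ (hm 0 le_rfl)), fun t s ht hts => ?_⟩
  have hy : ∀ t, HasDerivAt (fun t : ℝ => Real.exp (-t)) (-Real.exp (-t)) t := by
    intro t; simpa using (hasDerivAt_neg t).exp
  have hd : ∀ t, HasDerivAt (om n k) (deriv (U n k) (Real.exp (-t)) * (-Real.exp (-t))) t :=
    fun t => (U_deriv n k _).comp t (hy t)
  have := Convex.norm_image_sub_le_of_norm_hasDerivWithin_le (f := om n k)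
    (f' := fun t => deriv (U n k) (Real.exp (-t)) * (-Real.exp (-t))) (s := Set.Ici 0) (C := K)
    (fun x _ => (hd x).hasDerivWithinAt) (fun x hx => ?_) (convex_Ici 0) (x := t) (y := s) ht (ht.trans hts)
  · rwa [Real.norm_eq_abs, Real.norm_eq_abs, abs_of_nonneg (sub_nonneg.2 hts)] at this
  · have h1 := hK _ (hm x hx)
    have h2 := hm x hx
    rw [norm_mul, norm_neg, Real.norm_of_nonneg h2.1]
    calc _ ≤ K * 1 := mul_le_mul h1 h2.2 h2.1 ((norm_nonneg _).trans h1)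
      _ = K := mul_one K

lemma tau_taylor (n k : ℕ) (hk : k ≤ n) : ∃ K : ℝ, 0 ≤ K ∧ ∀ t h, 0 ≤ t → 0 ≤ h →
    |tau n k (t + h) - tau n k t + h * (k * om n k t)| ≤ K * h ^ 2 := by
  obtain ⟨K, hK0, hK⟩ := om_lip n k
  refine ⟨k * K, by positivity, fun t h ht hh => ?_⟩
  rcases hh.eq_or_lt with rfl | hh'
  · simp
  obtain ⟨c, hc, hc'⟩ := exists_hasDerivAt_eq_slope (tau n k) (fun t => -(k * om n k t)) (a := t) (b := t + h) (by linarith)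
    (HasDerivAt.continuousOn fun x _ => tau_deriv n k hk x) (fun x _ => tau_deriv n k hk x)
  have e : tau n k (t + h) - tau n k t = -(k * om n k c) * h := by
    rw [hc', add_sub_cancel_left, div_mul_cancel₀ _ hh'.ne']
  rw [e, show -(k * om n k c) * h + h * (k * om n k t) = -(k * h * (om n k c - om n k t)) by ring, abs_neg, abs_mul,
    abs_of_nonneg (by positivity)]
  have := hK t c ht hc.1.le
  calc _ ≤ k * h * (K * h) := by gcongr; exact this.trans (by have := hc.2; gcongr; linarith)
    _ = _ := by ring

lemma tau_le (n k : ℕ) (hk : k ≤ n) {t : ℝ} (ht : 0 ≤ t) : tau n k t ≤ n + 1 := by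
  have : AntitoneOn (tau n k) (Set.Ici 0) := by
    refine antitoneOn_of_deriv_nonpos (convex_Ici 0) (HasDerivAt.continuousOn fun x _ => tau_deriv n k hk x)
      (fun x _ => (tau_deriv n k hk x).differentiableAt.differentiableWithinAt) ?_
    intro x hx
    rw [interior_Ici] at hx
    rw [(tau_deriv n k hk x).deriv]
    have := om_nonneg n k (le_of_lt hx)
    have : 0 ≤ (k:ℝ) * om n k x := by positivity
    linarith
  have h := this (Set.mem_Ici.2 le_rfl) (Set.mem_Ici.2 ht) ht
  rw [tau_zero n k hk] at h
  have : (0:ℝ) ≤ k := by positivity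
  linarith

end DB

namespace DB
open Finset ComplexConjugate

noncomputable def vv (c q : ℕ → ℂ) (k : ℕ) : ℂ :=
  ∑ j ∈ range k, ((j:ℂ) + 1) * c (j + 1) * q (k - (j + 1)) + q k

noncomputable def W (n : ℕ) (t : ℝ) (c q : ℕ → ℂ) : ℝ :=
  ∑ i ∈ range n, (-(((i + 1 : ℕ) : ℝ) * om n (i + 1) t) * (((i:ℝ) + 1) * ‖c (i + 1)‖ ^ 2 - 4 / ((i:ℝ) + 1)) * (q 0).re
    + tau n (i + 1) t * (2 * ((i:ℝ) + 1) * (conj (c (i + 1)) * vv c q (i + 1)).re))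

noncomputable def pk (κ : ℂ) (m : ℕ) : ℂ := if m = 0 then 1 else 2 * κ ^ m

lemma abel_aux (n : ℕ) (t : ℝ) (g : ℕ → ℝ) (g0 : g 0 = 0) :
    ∑ i ∈ range n, tau n (i + 1) t * (g (i + 1) - g i) = ∑ i ∈ range n, om n (i + 1) t * (g (i + 1) + g i) := by
  have h : ∀ m, m ≤ n → ∑ i ∈ range m, tau n (i + 1) t * (g (i + 1) - g i) =
      ∑ i ∈ range m, om n (i + 1) t * (g (i + 1) + g i) + (tau n (m + 1) t + om n (m + 1) t) * g m := by
    intro m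
    induction m with
    | zero => simp [g0]
    | succ m ih =>
      intro hm
      rw [sum_range_succ, ih (by omega), sum_range_succ]
      have := tau_step n (m + 1) hm t
      rw [this]; ring
  rw [h n le_rfl, tau_top, om_top]; ring

lemma static (n : ℕ) (t : ℝ) (ht : 0 ≤ t) (c : ℕ → ℂ) (κ : ℂ) (hκ : ‖κ‖ = 1) : 0 ≤ W n t c (pk κ) := by
  set x : ℕ → ℂ := fun j => ((j:ℂ) + 1) * c (j + 1) * conj κ ^ (j + 1) with hx
  set b : ℕ → ℂ := fun k => ∑ j ∈ range k, x j with hb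
  have hκκ : κ * conj κ = 1 := by rw [Complex.mul_conj, Complex.normSq_eq_norm_sq, hκ]; simp
  have hκκn : ∀ m, κ ^ m * conj κ ^ m = 1 := fun m => by rw [← mul_pow, hκκ, one_pow]
  have hbs : ∀ k, b (k + 1) = b k + x k := fun k => sum_range_succ _ _
  have hv : ∀ k, vv c (pk κ) (k + 1) = κ ^ (k + 1) * (b (k + 1) + b k + 2) := by
    intro k
    rw [hbs, vv, sum_range_succ, Nat.sub_self, show pk κ 0 = 1 from if_pos rfl,
      show pk κ (k + 1) = 2 * κ ^ (k + 1) from if_neg (by omega)]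
    have : ∑ j ∈ range k, ((j:ℂ) + 1) * c (j + 1) * pk κ (k + 1 - (j + 1)) = κ ^ (k + 1) * (2 * b k) := by
      rw [hb, mul_sum, mul_sum]
      refine sum_congr rfl fun j hj => ?_
      have hj := mem_range.1 hj
      rw [pk, if_neg (by omega), hx]
      have e : κ ^ (k + 1) = κ ^ (k + 1 - (j + 1)) * κ ^ (j + 1) := by rw [← pow_add]; congr 1; omega
      rw [e]
      linear_combination (-(2 * ((j:ℂ) + 1) * c (j + 1) * κ ^ (k + 1 - (j + 1)))) * hκκn (j + 1)
    rw [this, hx]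
    linear_combination (-((k:ℂ) + 1) * c (k + 1)) * hκκn (k + 1)
  set g : ℕ → ℝ := fun k => 2 * ‖b k‖ ^ 2 + 4 * (b k).re with hg
  have hnx : ∀ k, ‖b (k+1) - b k‖ ^ 2 = (((k:ℝ) + 1) * ‖c (k + 1)‖) ^ 2 := by
    intro k
    rw [hbs, add_sub_cancel_left, hx]
    simp only [norm_mul, norm_pow, Complex.norm_conj, hκ, one_pow, mul_one]
    congr 2
    have : ((k:ℂ) + 1) = ((k + 1 : ℕ) : ℂ) := by push_cast; rfl
    rw [this, Complex.norm_natCast]; push_cast; rfl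
  have hre : ∀ k : ℕ, 2 * ((k:ℝ) + 1) * (conj (c (k + 1)) * vv c (pk κ) (k + 1)).re = g (k + 1) - g k := by
    intro k
    have e1 : ((2 * ((k:ℝ) + 1) : ℝ) : ℂ) * (conj (c (k + 1)) * vv c (pk κ) (k + 1)) =
        2 * (conj (b (k + 1) - b k) * (b (k + 1) + b k + 2)) := by
      rw [hv, show b (k+1) - b k = x k by rw [hbs]; ring, hx]
      simp only [map_mul, map_add, map_natCast, map_one, map_pow, Complex.conj_conj]
      push_cast; ring
    have e2 := congrArg Complex.re e1
    rw [Complex.re_ofReal_mul] at e2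
    rw [e2, hg]
    simp only [← Complex.normSq_eq_norm_sq, Complex.normSq_apply]
    simp
    ring
  have : W n t c (pk κ) = ∑ i ∈ range n, om n (i + 1) t * ‖b (i + 1) + b i + 2‖ ^ 2 := by
    rw [W, sum_add_distrib]
    simp_rw [hre]
    rw [abel_aux n t g (by simp [hg, hb]), ← sum_add_distrib]
    refine sum_congr rfl fun i _ => ?_
    have h1 : ‖b (i + 1) + b i + 2‖ ^ 2 = g (i + 1) + g i + 4 - ‖b (i+1) - b i‖ ^ 2 := by
      rw [hg]
      simp only [← Complex.normSq_eq_norm_sq, Complex.normSq_apply]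
      simp
      ring
    rw [h1, hnx]
    have hi : (i:ℝ) + 1 ≠ 0 := by positivity
    simp only [pk, if_pos, Complex.one_re]
    push_cast
    field_simp
    ring
  rw [this]
  exact sum_nonneg fun i _ => mul_nonneg (om_nonneg n _ ht) (by positivity)

/-- representable functionals -/
def Rep (n : ℕ) (F : (ℕ → ℂ) → ℝ) : Prop := ∃ l : ℕ → ℂ, ∀ q, F q = (∑ k ∈ range (n + 1), l k * q k).re

lemma Rep.add {n : ℕ} {F G : (ℕ → ℂ) → ℝ} (hF : Rep n F) (hG : Rep n G) : Rep n (fun q => F q + G q) := by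
  obtain ⟨l, hl⟩ := hF
  obtain ⟨m, hm⟩ := hG
  refine ⟨fun k => l k + m k, fun q => ?_⟩
  simp only [hl, hm, ← Complex.add_re, ← sum_add_distrib, add_mul]

lemma Rep.smul {n : ℕ} {F : (ℕ → ℂ) → ℝ} (hF : Rep n F) (r : ℝ) : Rep n (fun q => r * F q) := by
  obtain ⟨l, hl⟩ := hF
  refine ⟨fun k => r * l k, fun q => ?_⟩
  simp only [hl, mul_assoc, ← mul_sum, Complex.re_ofReal_mul]

lemma Rep.basic {n : ℕ} (μ : ℂ) (j : ℕ) (hj : j ≤ n) : Rep n (fun q => (μ * q j).re) := by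
  refine ⟨fun k => if k = j then μ else 0, fun q => ?_⟩
  simp only [ite_mul, zero_mul, sum_ite_eq', mem_range, if_pos (show j < n + 1 by omega)]

lemma Rep.sum {n : ℕ} {ι : Type*} (s : Finset ι) (F : ι → (ℕ → ℂ) → ℝ) (hF : ∀ i ∈ s, Rep n (F i)) :
    Rep n (fun q => ∑ i ∈ s, F i q) := by
  classical
  induction s using Finset.induction_on with
  | empty => exact ⟨fun _ => 0, fun q => by simp⟩
  | insert a s ha ih =>
    simp only [sum_insert ha]
    exact (hF a (mem_insert_self _ _)).add (ih fun i hi => hF i (mem_insert_of_mem hi))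

lemma W_rep (n : ℕ) (t : ℝ) (c : ℕ → ℂ) : Rep n (W n t c) := by
  unfold W
  refine Rep.sum _ _ fun i hi => ?_
  have hi := mem_range.1 hi
  refine Rep.add ?_ (Rep.smul (Rep.smul ?_ _) _)
  · have := (Rep.basic (n := n) 1 0 (by omega)).smul
    simp only [one_mul] at this
    exact this _
  · simp only [vv, mul_add, mul_sum, Complex.add_re, Complex.re_sum]
    refine Rep.add (Rep.sum _ _ fun j hj => ?_) (Rep.basic _ _ (by omega))
    simp only [← mul_assoc]
    exact Rep.basic _ _ (by omega)

end DB

namespace DB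
open Finset ComplexConjugate Metric Real

/-- Taylor coefficients -/
noncomputable def cf (g : ℂ → ℂ) (k : ℕ) : ℂ := circleAverage (fun z => g z / z ^ k) 0 (1/2)

abbrev Hol (g : ℂ → ℂ) : Prop := DifferentiableOn ℂ g (ball 0 1)

lemma sph_sub {ρ : ℝ} (h1 : ρ < 1) : sphere (0:ℂ) ρ ⊆ ball 0 1 :=
  fun z hz => by rw [mem_sphere_zero_iff_norm] at hz; rw [mem_ball_zero_iff, hz]; exact h1

lemma ne_of_sph {ρ : ℝ} (h0 : 0 < ρ) {z : ℂ} (hz : z ∈ sphere (0:ℂ) ρ) : z ≠ 0 := by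
  rintro rfl; simp at hz; linarith

lemma cint {g : ℂ → ℂ} {ρ : ℝ} (h0 : 0 < ρ) (hg : ContinuousOn g (sphere 0 ρ)) (k : ℕ) :
    CircleIntegrable (fun z => g z / z ^ k) 0 ρ := by
  refine ContinuousOn.circleIntegrable h0.le (hg.div (by fun_prop) fun z hz => pow_ne_zero _ (ne_of_sph h0 hz))

abbrev CS (g : ℂ → ℂ) : Prop := ContinuousOn g (sphere 0 (1/2))

lemma Hol.cs {g : ℂ → ℂ} (hg : Hol g) : CS g := hg.continuousOn.mono (sph_sub (by norm_num))

lemma cf_congr {f g : ℂ → ℂ} (h : ∀ z ∈ sphere (0:ℂ) (1/2), f z = g z) (k : ℕ) : cf f k = cf g k := by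
  refine circleAverage_congr_sphere fun z hz => ?_
  rw [abs_of_pos (by norm_num)] at hz
  simp only [h z hz]

lemma cf_add {f g : ℂ → ℂ} (hf : CS f) (hg : CS g) (k : ℕ) : cf (fun z => f z + g z) k = cf f k + cf g k := by
  simp only [cf, add_div]
  exact circleAverage_fun_add (cint (by norm_num) hf k) (cint (by norm_num) hg k)

lemma cf_sub {f g : ℂ → ℂ} (hf : CS f) (hg : CS g) (k : ℕ) : cf (fun z => f z - g z) k = cf f k - cf g k := by
  simp only [cf, sub_div]
  exact circleAverage_fun_sub (cint (by norm_num) hf k) (cint (by norm_num) hg k)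

lemma cf_mul_left (f : ℂ → ℂ) (a : ℂ) (k : ℕ) : cf (fun z => a * f z) k = a * cf f k := by
  simp only [cf, mul_div_assoc]
  exact circleAverage_fun_smul (a := a)

lemma cf_sum {ι : Type*} (s : Finset ι) (f : ι → ℂ → ℂ) (hf : ∀ i ∈ s, CS (f i)) (k : ℕ) :
    cf (fun z => ∑ i ∈ s, f i z) k = ∑ i ∈ s, cf (f i) k := by
  simp only [cf, sum_div]
  exact circleAverage_fun_sum fun i hi => (cint (by norm_num) (hf i hi) k)

lemma cf_bound {g : ℂ → ℂ} {M : ℝ} (hM : ∀ z ∈ sphere (0:ℂ) (1/2), ‖g z‖ ≤ M) (k : ℕ) :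
    ‖cf g k‖ ≤ 2 ^ k * M := by
  rw [cf, circleAverage, norm_smul]
  have : ‖∫ θ in (0)..2 * π, (fun z => g z / z ^ k) (circleMap 0 (1/2) θ)‖ ≤ (2 ^ k * M) * |2 * π - 0| := by
    refine intervalIntegral.norm_integral_le_of_norm_le_const fun θ _ => ?_
    have h1 : circleMap 0 (1/2) θ ∈ sphere (0:ℂ) (1/2) := circleMap_mem_sphere 0 (by norm_num) θ
    have h2 := hM _ h1
    have h3 : ‖circleMap 0 (1/2) θ‖ = 1/2 := by rw [mem_sphere_zero_iff_norm] at h1; exact h1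
    rw [norm_div, norm_pow, h3, one_div, inv_pow, div_inv_eq_mul, mul_comm]
    rw [one_div] at h2
    exact mul_le_mul_of_nonneg_left h2 (by positivity)
  rw [norm_of_nonneg (by positivity), sub_zero, abs_of_pos (by positivity)] at *
  calc _ ≤ (2 * π)⁻¹ * (2 ^ k * M * (2 * π)) := by gcongr
    _ = _ := by field_simp

lemma avg_hol {g : ℂ → ℂ} (hg : Hol g) {ρ : ℝ} (h0 : 0 < ρ) (h1 : ρ < 1) : circleAverage g 0 ρ = g 0 := by
  refine DiffContOnCl.circleAverage ?_
  rw [abs_of_pos h0]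
  refine (hg.mono ?_).diffContOnCl
  exact closure_ball_subset_closedBall.trans (closedBall_subset_ball h1)

lemma cf_zero {g : ℂ → ℂ} (hg : Hol g) : cf g 0 = g 0 := by
  simp only [cf, pow_zero, div_one]; exact avg_hol hg (by norm_num) (by norm_num)

lemma cf_shift (g : ℂ → ℂ) (j k : ℕ) (h : j ≤ k) : cf (fun z => z ^ j * g z) k = cf g (k - j) := by
  refine circleAverage_congr_sphere fun z hz => ?_
  rw [abs_of_pos (by norm_num)] at hz
  have := ne_of_sph (by norm_num) hz
  have e : z ^ k = z ^ j * z ^ (k - j) := by rw [← pow_add]; congr 1; omega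
  simp only [e]; field_simp

lemma cf_shift_zero {g : ℂ → ℂ} (hg : Hol g) (j k : ℕ) (h : k < j) : cf (fun z => z ^ j * g z) k = 0 := by
  have : cf (fun z => z ^ j * g z) k = circleAverage (fun z => z ^ (j - k) * g z) 0 (1/2) := by
    refine circleAverage_congr_sphere fun z hz => ?_
    rw [abs_of_pos (by norm_num)] at hz
    have := ne_of_sph (by norm_num) hz
    have e : z ^ j = z ^ k * z ^ (j - k) := by rw [← pow_add]; congr 1; omega
    simp only [e]; field_simp
  rw [this, avg_hol (g := fun z => z ^ (j - k) * g z) (by unfold Hol; fun_prop) (by norm_num) (by norm_num), zero_pow (by omega), zero_mul]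

lemma cf_one (k : ℕ) : cf (fun _ => 1) k = if k = 0 then 1 else 0 := by
  split_ifs with h
  · subst h; rw [cf_zero (by unfold Hol; fun_prop)]
  · rw [cf, circleAverage_eq_circleIntegral (by norm_num)]
    have := circleIntegral.integral_sub_zpow_of_ne (n := -(k:ℤ) - 1) (by omega) 0 0 (1/2)
    rw [show (∮ z in C(0, 1/2), (z - 0)⁻¹ • ((1:ℂ) / z ^ k)) = ∮ z in C(0, 1/2), (z - 0) ^ (-(k:ℤ) - 1) from ?_, this, smul_zero]
    refine circleIntegral.integral_congr (by norm_num) fun z hz => ?_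
    have := ne_of_sph (by norm_num) hz
    simp only [sub_zero, smul_eq_mul]
    rw [zpow_sub₀ this, zpow_neg, zpow_natCast, zpow_one]; field_simp

lemma cf_const (a : ℂ) (k : ℕ) : cf (fun _ => a) k = if k = 0 then a else 0 := by
  have := cf_mul_left (fun _ => 1) a k
  simp only [mul_one] at this
  rw [this, cf_one]; split_ifs <;> simp

lemma cf_pow (j k : ℕ) : cf (fun z => z ^ j) k = if k = j then 1 else 0 := by
  have e : (fun z : ℂ => z ^ j) = fun z => z ^ j * (fun _ => (1:ℂ)) z := by simp
  rw [e]
  rcases lt_or_ge k j with h | h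
  · rw [cf_shift_zero (by unfold Hol; fun_prop) j k h, if_neg (by omega)]
  · rw [cf_shift _ _ _ h, cf_one]
    by_cases hk : k = j
    · rw [if_pos (by omega), if_pos hk]
    · rw [if_neg (by omega), if_neg hk]

lemma trunc {g : ℂ → ℂ} (hg : Hol g) (N : ℕ) : ∃ R : ℂ → ℂ, Hol R ∧
    ∀ z, g z = ∑ j ∈ range N, cf g j * z ^ j + z ^ N * R z := by
  induction N with
  | zero => exact ⟨g, hg, fun z => by simp⟩
  | succ N ih =>
    obtain ⟨R, hR, h⟩ := ih
    refine ⟨dslope R 0, (Complex.differentiableOn_dslope (ball_mem_nhds _ one_pos)).2 hR, fun z => ?_⟩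
    have hN : cf g N = R 0 := by
      rw [show g = fun z => ∑ j ∈ range N, cf g j * z ^ j + z ^ N * R z from funext h]
      have hc := hR.cs
      rw [cf_add (f := fun z => ∑ j ∈ range N, cf g j * z ^ j) (g := fun z => z ^ N * R z) (by unfold CS; fun_prop) (by unfold CS; fun_prop),
        cf_sum _ _ (fun i _ => by unfold CS; fun_prop), cf_shift _ _ _ le_rfl, Nat.sub_self, cf_zero hR, sum_eq_zero, zero_add]
      intro j hj
      have := mem_range.1 hj
      rw [cf_mul_left, cf_pow, if_neg (by omega), mul_zero]
    rw [h z, sum_range_succ, hN]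
    have := sub_smul_dslope R 0 z
    rw [sub_zero, smul_eq_mul] at this
    rw [pow_succ]
    linear_combination (-z ^ N) * this

lemma cf_mul {f g : ℂ → ℂ} (hf : Hol f) (hg : Hol g) (k : ℕ) :
    cf (fun z => f z * g z) k = ∑ j ∈ range (k + 1), cf f j * cf g (k - j) := by
  obtain ⟨R, hR, h⟩ := trunc hf (k + 1)
  have e : (fun z => f z * g z) = fun z => ∑ j ∈ range (k + 1), cf f j * (z ^ j * g z) + z ^ (k + 1) * (R z * g z) := by
    ext z; rw [h z, add_mul, sum_mul]; congr 1
    · exact sum_congr rfl fun j _ => by ring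
    · ring
  have h1 := hR.cs
  have h2 := hg.cs
  rw [e, cf_add (f := fun z => ∑ j ∈ range (k + 1), cf f j * (z ^ j * g z)) (g := fun z => z ^ (k + 1) * (R z * g z)) (by unfold CS; fun_prop) (by unfold CS; fun_prop), cf_sum _ _ (fun i _ => by unfold CS; fun_prop),
    cf_shift_zero (g := fun z => R z * g z) (hR.mul hg) _ _ (by omega), add_zero]
  refine sum_congr rfl fun j hj => ?_
  have := mem_range.1 hj
  rw [cf_mul_left, cf_shift _ _ _ (by omega)]

lemma cf_deriv {g : ℂ → ℂ} (hg : Hol g) (k : ℕ) : cf (fun z => z * deriv g z) k = k * cf g k := by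
  have hd : Hol (deriv g) := hg.deriv isOpen_ball
  have h1 := hd.cs
  have h2 := hg.cs
  have h3 : cf (fun z => z * deriv g z) k - k * cf g k = 0 := by
    rw [← cf_mul_left, ← cf_sub (by unfold CS; fun_prop) (by unfold CS; fun_prop), cf, circleAverage_eq_circleIntegral (by norm_num)]
    rw [circleIntegral.integral_eq_zero_of_hasDerivWithinAt (f := fun z => g z / z ^ k) (by norm_num), smul_zero]
    intro z hz
    have hz0 := ne_of_sph (by norm_num) hz
    have hzb : z ∈ ball (0:ℂ) 1 := sph_sub (by norm_num) hz
    have := (hg.differentiableAt (isOpen_ball.mem_nhds hzb)).hasDerivAt.div (hasDerivAt_pow k z) (pow_ne_zero k hz0)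
    refine (this.hasDerivWithinAt).congr_deriv ?_
    rcases k with _ | k
    · simp; field_simp
    · simp only [sub_zero, smul_eq_mul, Nat.add_sub_cancel]; push_cast; field_simp; ring
  linear_combination h3

lemma cf_radius {g : ℂ → ℂ} (hg : Hol g) (k : ℕ) {ρ : ℝ} (h0 : 0 < ρ) (h1 : ρ < 1) :
    circleAverage (fun z => g z / z ^ k) 0 ρ = cf g k := by
  obtain ⟨R, hR, h⟩ := trunc hg (k + 1)
  have key : ∀ j, j < k → circleAverage (fun z : ℂ => z ^ j / z ^ k) 0 ρ = 0 := by
    intro j hj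
    rw [circleAverage_eq_circleIntegral h0.ne']
    have := circleIntegral.integral_sub_zpow_of_ne (n := (j:ℤ) - k - 1) (by omega) 0 0 ρ
    rw [show (∮ z in C(0, ρ), (z - 0)⁻¹ • ((z:ℂ) ^ j / z ^ k)) = ∮ z in C(0, ρ), (z - 0) ^ ((j:ℤ) - k - 1) from ?_, this, smul_zero]
    refine circleIntegral.integral_congr h0.le fun z hz => ?_
    have := ne_of_sph h0 hz
    simp only [sub_zero, smul_eq_mul]
    rw [zpow_sub₀ this, zpow_sub₀ this, zpow_natCast, zpow_natCast, zpow_one]; field_simp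
  have e : circleAverage (fun z => g z / z ^ k) 0 ρ = circleAverage (fun z => ∑ j ∈ range k, cf g j • (z ^ j / z ^ k) + (cf g k + z * R z)) 0 ρ := by
    refine circleAverage_congr_sphere fun z hz => ?_
    rw [abs_of_pos h0] at hz
    have := ne_of_sph h0 hz
    simp only [smul_eq_mul]
    rw [h z, sum_range_succ, add_div, add_div, sum_div, add_assoc]
    congr 1
    · exact sum_congr rfl fun j _ => by ring
    · field_simp; ring
  have hRc : ContinuousOn R (sphere 0 ρ) := hR.continuousOn.mono (sph_sub h1)
  have i1 : ∀ j, CircleIntegrable (fun z : ℂ => cf g j • (z ^ j / z ^ k)) 0 ρ := by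
    intro j
    have := cint h0 (g := fun z => cf g j * z ^ j) (by fun_prop) k
    simpa only [mul_div_assoc, smul_eq_mul] using this
  rw [e, circleAverage_fun_add, circleAverage_fun_sum, avg_hol (g := fun z => cf g k + z * R z) (by unfold Hol; fun_prop) h0 h1, sum_eq_zero, zero_add, zero_mul, add_zero]
  · intro j hj
    rw [circleAverage_fun_smul, key j (mem_range.1 hj), smul_zero]
  · intro i _; exact i1 i
  · exact CircleIntegrable.fun_sum _ fun i _ => i1 i
  · exact ContinuousOn.circleIntegrable h0.le (by fun_prop)

end DB

namespace DB
open Finset ComplexConjugate Metric Real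

lemma cara_id {q : ℂ → ℂ} (hq : Hol q) (hi : (q 0).im = 0) {ρ : ℝ} (h0 : 0 < ρ) (h1 : ρ < 1) (k : ℕ) :
    cf q k * (ρ:ℂ) ^ k = circleAverage (fun z => ((q z).re : ℂ) * pk (conj z / ρ) k) 0 ρ := by
  have hρ : (ρ:ℂ) ≠ 0 := by exact_mod_cast h0.ne'
  have hqc : ContinuousOn q (sphere 0 ρ) := hq.continuousOn.mono (sph_sub h1)
  have hcz : ∀ z ∈ sphere (0:ℂ) ρ, z ≠ 0 ∧ conj z / ρ = ρ / z := by
    intro z hz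
    have h := ne_of_sph h0 hz
    refine ⟨h, ?_⟩
    rw [div_eq_div_iff hρ h, mul_comm, Complex.mul_conj, Complex.normSq_eq_norm_sq, mem_sphere_zero_iff_norm.1 hz]
    push_cast; ring
  -- average of the conjugate term
  have hcj : ∀ g : ℂ → ℂ, ContinuousOn g (sphere 0 ρ) → circleAverage (fun z => conj (g z)) 0 ρ = conj (circleAverage g 0 ρ) := by
    intro g hg
    exact ContinuousLinearMap.circleAverage_comp_comm (Complex.conjCLE : ℂ →L[ℝ] ℂ) (ContinuousOn.circleIntegrable h0.le hg)
  rcases Nat.eq_zero_or_pos k with rfl | hk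
  · simp only [pk, if_pos, mul_one, pow_zero]
    have e : circleAverage (fun z => ((q z).re : ℂ)) 0 ρ = circleAverage (fun z => (1/2 : ℂ) • (q z + conj (q z))) 0 ρ := by
      refine circleAverage_congr_sphere fun z _ => ?_
      simp only [Complex.add_conj, smul_eq_mul]; push_cast; ring
    rw [e, circleAverage_fun_smul, circleAverage_fun_add, hcj _ hqc, avg_hol hq h0 h1, cf_zero hq, Complex.add_conj]
    · apply Complex.ext <;> simp [hi]
    · exact ContinuousOn.circleIntegrable h0.le hqc
    · exact ContinuousOn.circleIntegrable h0.le (Complex.continuous_conj.comp_continuousOn hqc)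
  · have e : circleAverage (fun z => ((q z).re : ℂ) * pk (conj z / ρ) k) 0 ρ =
      circleAverage (fun z => ((ρ:ℂ) ^ k) • (q z / z ^ k) + conj (((ρ:ℂ) ^ k)⁻¹ • (z ^ k * q z))) 0 ρ := by
      refine circleAverage_congr_sphere fun z hz => ?_
      rw [abs_of_pos h0] at hz
      obtain ⟨hz0, hz1⟩ := hcz z hz
      have e1 : conj (((ρ:ℂ) ^ k)⁻¹ • (z ^ k * q z)) = (ρ / z) ^ k * conj (q z) := by
        rw [← hz1, smul_eq_mul, map_mul, map_mul, map_inv₀, map_pow, map_pow, Complex.conj_ofReal, div_pow]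
        field_simp
      rw [e1, pk, if_neg (by omega), hz1]
      have : ((q z).re : ℂ) = (q z + conj (q z)) / 2 := by rw [Complex.add_conj]; push_cast; ring
      rw [this, smul_eq_mul, div_pow]; field_simp
    have hc2 : ContinuousOn (fun z => ((ρ:ℂ) ^ k)⁻¹ • (z ^ k * q z)) (sphere 0 ρ) := by fun_prop
    rw [e, circleAverage_fun_add, hcj _ hc2, circleAverage_fun_smul, circleAverage_fun_smul, cf_radius hq k h0 h1,
      avg_hol (g := fun z => z ^ k * q z) (by unfold Hol; fun_prop) h0 h1, zero_pow (by omega)]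
    · simp [mul_comm]
    · have := cint h0 (g := fun z => (ρ:ℂ) ^ k * q z) (by fun_prop) k
      simpa only [mul_div_assoc, smul_eq_mul] using this
    · exact ContinuousOn.circleIntegrable h0.le (Complex.continuous_conj.comp_continuousOn hc2)

lemma caratheodory {n : ℕ} {F : (ℕ → ℂ) → ℝ} (hF : Rep n F) (hpos : ∀ κ : ℂ, ‖κ‖ = 1 → 0 ≤ F (pk κ))
    {q : ℂ → ℂ} (hq : Hol q) (hi : (q 0).im = 0) (hre : ∀ z ∈ ball (0:ℂ) 1, 0 ≤ (q z).re) : 0 ≤ F (cf q) := by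
  obtain ⟨l, hl⟩ := hF
  have key : ∀ ρ : ℝ, 0 < ρ → ρ < 1 → 0 ≤ (∑ k ∈ range (n + 1), l k * (cf q k * (ρ:ℂ) ^ k)).re := by
    intro ρ h0 h1
    have hqc : ContinuousOn q (sphere 0 ρ) := hq.continuousOn.mono (sph_sub h1)
    have hint : ∀ k, ContinuousOn (fun z => l k • (((q z).re : ℂ) * pk (conj z / ρ) k)) (sphere 0 ρ) := by
      intro k
      have h1 : Continuous (fun z : ℂ => pk (conj z / ρ) k) := by
        unfold pk; split_ifs
        · fun_prop
        · have := Complex.continuous_conj; fun_prop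
      have h2 : ContinuousOn (fun z => ((q z).re : ℂ)) (sphere 0 ρ) :=
        (Complex.continuous_ofReal.comp Complex.continuous_re).comp_continuousOn hqc
      have h3 := h1.continuousOn (s := sphere 0 ρ)
      fun_prop
    have e : (∑ k ∈ range (n + 1), l k * (cf q k * (ρ:ℂ) ^ k)).re =
        circleAverage (fun z => (q z).re * F (pk (conj z / ρ))) 0 ρ := by
      have e1 : ∑ k ∈ range (n + 1), l k * (cf q k * (ρ:ℂ) ^ k) =
        circleAverage (fun z => ∑ k ∈ range (n + 1), l k • (((q z).re : ℂ) * pk (conj z / ρ) k)) 0 ρ := by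
        rw [circleAverage_fun_sum fun k _ => ContinuousOn.circleIntegrable h0.le (hint k)]
        refine sum_congr rfl fun k _ => ?_
        rw [circleAverage_fun_smul, cara_id hq hi h0 h1, smul_eq_mul]
      rw [e1]
      have := ContinuousLinearMap.circleAverage_comp_comm Complex.reCLM (c := 0) (R := ρ)
        (f := (fun z => ∑ k ∈ range (n + 1), l k • (((q z).re : ℂ) * pk (conj z / ρ) k)))
        (ContinuousOn.circleIntegrable h0.le (continuousOn_finsetSum _ fun k _ => hint k))
      rw [Complex.reCLM_apply] at this
      rw [← this]
      congr 1
      ext z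
      simp only [Function.comp, Complex.reCLM_apply, hl, ← Complex.re_ofReal_mul, mul_sum, smul_eq_mul]
      congr 1
      exact sum_congr rfl fun k _ => by ring
    rw [e]
    refine circleAverage_nonneg_of_nonneg fun z hz => ?_
    rw [abs_of_pos h0] at hz
    refine mul_nonneg (hre z (sph_sub h1 hz)) (hpos _ ?_)
    rw [norm_div, Complex.norm_conj, mem_sphere_zero_iff_norm.1 hz, Complex.norm_real, norm_of_nonneg h0.le, div_self h0.ne']
  rw [hl]
  have hc : Continuous (fun ρ : ℝ => (∑ k ∈ range (n + 1), l k * (cf q k * (ρ:ℂ) ^ k)).re) := by fun_prop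
  have ht := (hc.tendsto 1).mono_left (nhdsWithin_le_nhds (s := Set.Iio 1))
  simp only [Complex.ofReal_one, one_pow, mul_one] at ht
  refine ge_of_tendsto ht ?_
  filter_upwards [Ioo_mem_nhdsLT (show (0:ℝ) < 1 by norm_num)] with ρ hρ using key ρ hρ.1 hρ.2

lemma cf_le_of_re {q : ℂ → ℂ} (hq : Hol q) (hi : (q 0).im = 0) (hre : ∀ z ∈ ball (0:ℂ) 1, 0 ≤ (q z).re) (k : ℕ) :
    ‖cf q k‖ ≤ 2 * (q 0).re := by
  have h0re : 0 ≤ (q 0).re := hre 0 (by simp)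
  rcases Nat.eq_zero_or_pos k with rfl | hk
  · rw [cf_zero hq]
    have : q 0 = ((q 0).re : ℂ) := Complex.ext rfl hi
    rw [this, Complex.norm_real, norm_of_nonneg h0re, Complex.ofReal_re]; linarith
  by_cases hz : cf q k = 0
  · rw [hz, norm_zero]; linarith
  set μ : ℂ := -(conj (cf q k)) / ‖cf q k‖ with hμ
  have hn : (‖cf q k‖ : ℂ) ≠ 0 := by exact_mod_cast (norm_ne_zero_iff.2 hz)
  have hμ1 : ‖μ‖ = 1 := by
    rw [hμ, norm_div, norm_neg, Complex.norm_conj, Complex.norm_real, norm_norm, div_self (norm_ne_zero_iff.2 hz)]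
  have hr : Rep k (fun p => 2 * (1 * p 0).re + (μ * p k).re) :=
    ((Rep.basic 1 0 (by omega)).smul 2).add (Rep.basic μ k le_rfl)
  have := caratheodory hr ?_ hq hi hre
  · simp only [one_mul, cf_zero hq] at this
    have e : μ * cf q k = ((-‖cf q k‖ : ℝ) : ℂ) := by
      have : conj (cf q k) * cf q k = (‖cf q k‖:ℂ) ^ 2 := by
        rw [mul_comm, Complex.mul_conj, Complex.normSq_eq_norm_sq]; push_cast; ring
      rw [hμ]; push_cast; field_simp; linear_combination -this
    rw [e, Complex.ofReal_re] at this
    linarith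
  · intro κ hκ
    simp only [pk, if_pos, if_neg (show ¬ (k = 0) by omega)]
    have : |(μ * (2 * κ ^ k)).re| ≤ 2 := by
      refine (Complex.abs_re_le_norm _).trans ?_
      rw [norm_mul, norm_mul, norm_pow, hκ, hμ1]; norm_num
    have := neg_le_of_abs_le this
    simp only [one_mul, Complex.one_re]; linarith

noncomputable def Psi (n : ℕ) (c : ℕ → ℂ) (t : ℝ) : ℝ :=
  ∑ i ∈ range n, tau n (i + 1) t * (((i:ℝ) + 1) * ‖c (i + 1)‖ ^ 2 - 4 / ((i:ℝ) + 1))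

lemma vv_bound (n : ℕ) (B h : ℝ) (c q : ℕ → ℂ) (hB : 0 ≤ B) (hh : 0 ≤ h) (hc : ∀ k, ‖c k‖ ≤ 2 * B) (hq : ∀ k, ‖q k‖ ≤ 2 * h)
    (k : ℕ) (hk : k ≤ n) : ‖vv c q k‖ ≤ (n * (n * (2 * B) * 2) + 2) * h := by
  rw [vv]
  have : ‖∑ j ∈ range k, ((j:ℂ) + 1) * c (j + 1) * q (k - (j + 1))‖ ≤ ∑ j ∈ range k, (n:ℝ) * (2 * B) * (2 * h) := by
    refine norm_sum_le_of_le _ fun j hj => ?_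
    have hj := mem_range.1 hj
    rw [norm_mul, norm_mul]
    have e : ‖(j:ℂ) + 1‖ ≤ n := by
      have : (j:ℂ) + 1 = ((j + 1 : ℕ) : ℂ) := by push_cast; rfl
      rw [this, Complex.norm_natCast]; exact_mod_cast (by omega)
    have := hc (j + 1)
    have := hq (k - (j+1))
    gcongr
  rw [sum_const, card_range, nsmul_eq_mul] at this
  have hkn : (k:ℝ) ≤ n := by exact_mod_cast hk
  have h2 : (k:ℝ) * (n * (2 * B) * (2 * h)) ≤ n * (n * (2 * B) * (2 * h)) := by gcongr
  calc _ ≤ _ := norm_add_le _ _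
    _ ≤ (n:ℝ) * (n * (2 * B) * (2 * h)) + 2 * h := add_le_add (this.trans h2) (hq k)
    _ = _ := by ring

lemma step_alg (n : ℕ) (B K1 : ℝ) (hB : 0 ≤ B) (hK1 : 0 ≤ K1) : ∃ K : ℝ, 0 ≤ K ∧ ∀ (t h : ℝ) (c d q : ℕ → ℂ), 0 ≤ t → 0 ≤ h → h ≤ 1 →
    (q 0).re = h → 0 ≤ W n t c q → (∀ k, ‖c k‖ ≤ 2 * B) → (∀ k, ‖q k‖ ≤ 2 * h) →
    (∀ k, 1 ≤ k → k ≤ n → ‖d k - (c k - vv c q k)‖ ≤ K1 * h ^ 2) → Psi n d t ≤ Psi n c (t + h) + K * h ^ 2 := by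
  have hK : ∀ i : ℕ, ∃ K : ℝ, 0 ≤ K ∧ (i < n → ∀ t h, 0 ≤ t → 0 ≤ h →
    |tau n (i+1) (t + h) - tau n (i+1) t + h * ((i+1:ℕ) * om n (i+1) t)| ≤ K * h ^ 2) := by
    intro i
    by_cases hi : i < n
    · obtain ⟨K, h1, h2⟩ := tau_taylor n (i+1) hi
      exact ⟨K, h1, fun _ => h2⟩
    · exact ⟨0, le_rfl, fun h => absurd h hi⟩
  choose Kt hKt0 hKt using hK
  set V : ℝ := (n * (n * (2 * B) * 2) + 2) with hV
  have hV0 : 0 ≤ V := by positivity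
  set K2 := 2 * (2 * B) * K1 + (K1 + V) ^ 2 with hK2
  refine ⟨∑ i ∈ range n, (Kt i * (((i:ℝ) + 1) * (2 * B) ^ 2 + 4) + (n + 1) * (((i:ℝ) + 1) * K2)), ?_, ?_⟩
  · refine sum_nonneg fun i _ => ?_
    have := hKt0 i
    positivity
  intro t h c d q ht hh hh1 hq0 hW hc hq hd
  rw [W] at hW
  have main : ∀ i ∈ range n, tau n (i + 1) t * (((i:ℝ) + 1) * ‖d (i + 1)‖ ^ 2 - 4 / ((i:ℝ) + 1)) ≤
      tau n (i + 1) (t + h) * (((i:ℝ) + 1) * ‖c (i + 1)‖ ^ 2 - 4 / ((i:ℝ) + 1))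
      + (Kt i * (((i:ℝ) + 1) * (2 * B) ^ 2 + 4) + (n + 1) * (((i:ℝ) + 1) * K2)) * h ^ 2
      - (-(((i + 1 : ℕ) : ℝ) * om n (i + 1) t) * (((i:ℝ) + 1) * ‖c (i + 1)‖ ^ 2 - 4 / ((i:ℝ) + 1)) * (q 0).re
    + tau n (i + 1) t * (2 * ((i:ℝ) + 1) * (conj (c (i + 1)) * vv c q (i + 1)).re)) := by
    intro i hi
    have hi := mem_range.1 hi
    rw [hq0]
    have hv := vv_bound n B h c q hB hh hc hq (i + 1) hi
    rw [← hV] at hv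
    have hE := hd (i + 1) (by omega) hi
    have hcc := hc (i + 1)
    have hτ := tau_nonneg n (i+1) ht
    have hτ2 := tau_le n (i+1) hi ht
    have hT := hKt i hi t h ht hh
    set v := vv c q (i + 1)
    set x := c (i + 1)
    set E := d (i + 1) - (x - v) with hEdef
    have hdd : d (i + 1) = x - v + E := by rw [hEdef]; ring
    have hn : ‖d (i + 1)‖ ^ 2 ≤ ‖x‖ ^ 2 - 2 * (conj x * v).re + K2 * h ^ 2 := by
      have e : ‖d (i + 1)‖ ^ 2 = ‖x‖ ^ 2 - 2 * (conj x * v).re + 2 * (conj x * E).re + ‖E - v‖ ^ 2 := by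
        rw [hdd]; simp only [← Complex.normSq_eq_norm_sq, Complex.normSq_apply]; simp; ring
      have e1 : (conj x * E).re ≤ (2 * B) * (K1 * h ^ 2) := by
        refine (Complex.re_le_norm _).trans ?_
        rw [norm_mul, Complex.norm_conj]; gcongr
      have e2 : ‖E - v‖ ≤ (K1 + V) * h := by
        refine (norm_sub_le _ _).trans ?_
        have : K1 * h ^ 2 ≤ K1 * h := by gcongr; nlinarith
        linarith
      have e3 : ‖E - v‖ ^ 2 ≤ ((K1 + V) * h) ^ 2 := by gcongr
      rw [e, hK2]; nlinarith
    set y := ((i:ℝ) + 1) * ‖x‖ ^ 2 - 4 / ((i:ℝ) + 1) with hy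
    have hyb : |y| ≤ ((i:ℝ) + 1) * (2 * B) ^ 2 + 4 := by
      have a1 : ((i:ℝ) + 1) * ‖x‖ ^ 2 ≤ ((i:ℝ) + 1) * (2 * B) ^ 2 := by gcongr
      have a2 : 4 / ((i:ℝ) + 1) ≤ 4 := div_le_self (by norm_num) (by linarith [Nat.cast_nonneg (α := ℝ) i])
      have a3 : 0 ≤ 4 / ((i:ℝ) + 1) := by positivity
      have a4 : 0 ≤ ((i:ℝ) + 1) * ‖x‖ ^ 2 := by positivity
      rw [abs_le]; constructor <;> linarith
    have hTy : -(tau n (i+1) (t + h) - tau n (i+1) t + h * ((i+1:ℕ) * om n (i+1) t)) * y ≤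
        Kt i * h ^ 2 * (((i:ℝ) + 1) * (2 * B) ^ 2 + 4) := by
      refine (le_abs_self _).trans ?_
      rw [abs_mul, abs_neg]
      exact mul_le_mul hT hyb (abs_nonneg _) (by have := hKt0 i; positivity)
    have h5 : tau n (i + 1) t * (((i:ℝ) + 1) * ‖d (i + 1)‖ ^ 2 - 4 / ((i:ℝ) + 1)) ≤
        tau n (i + 1) t * (y - 2 * ((i:ℝ) + 1) * (conj x * v).re) + (n + 1) * (((i:ℝ) + 1) * K2) * h ^ 2 := by
      have b1 : ((i:ℝ) + 1) * ‖d (i + 1)‖ ^ 2 - 4 / ((i:ℝ) + 1) ≤ (y - 2 * ((i:ℝ) + 1) * (conj x * v).re) + ((i:ℝ) + 1) * K2 * h ^ 2 := by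
        have := mul_le_mul_of_nonneg_left hn (show (0:ℝ) ≤ (i:ℝ) + 1 by positivity)
        rw [hy]; linarith
      have b2 := mul_le_mul_of_nonneg_left b1 hτ
      have b3 : tau n (i+1) t * (((i:ℝ) + 1) * K2 * h ^ 2) ≤ (n + 1) * (((i:ℝ) + 1) * K2 * h ^ 2) := by
        gcongr
      linarith
    linarith
  rw [Psi, Psi, sum_mul, ← sum_add_distrib]
  have := sum_le_sum main
  rw [sum_sub_distrib] at this
  linarith

end DB

namespace DB
open Finset ComplexConjugate Metric Real

lemma exp_maps {q : ℂ → ℂ} (hre : ∀ z ∈ ball (0:ℂ) 1, 0 ≤ (q z).re) {z : ℂ} (hz : z ∈ ball (0:ℂ) 1) :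
    z * Complex.exp (-q z) ∈ ball (0:ℂ) 1 := by
  rw [mem_ball_zero_iff] at *
  rw [norm_mul, Complex.norm_exp]
  have : Real.exp ((-q z).re) ≤ 1 := by
    rw [Real.exp_le_one_iff, Complex.neg_re]
    have := hre z (by simpa using hz)
    linarith
  calc ‖z‖ * _ ≤ ‖z‖ * 1 := by gcongr
    _ < 1 := by linarith

lemma q_half {q : ℂ → ℂ} (hq : Hol q) (hre : ∀ z ∈ ball (0:ℂ) 1, 0 ≤ (q z).re) {h : ℝ} (hh : 0 ≤ h) (h0 : q 0 = h)
    {z : ℂ} (hz : z ∈ sphere (0:ℂ) (1/2)) : ‖q z‖ ≤ 3 * h := by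
  have hz' := mem_sphere_zero_iff_norm.1 hz
  refine le_of_forall_pos_le_add fun ε hε => ?_
  have := Complex.borelCaratheodory (M := ε / 2) (f := fun z => - q z) (R := 1) (z := z) (by positivity) hq.neg ?_ one_pos
    (sph_sub (by norm_num) hz)
  · rw [hz', norm_neg, norm_neg, h0, Complex.norm_real, norm_of_nonneg hh] at this
    refine this.trans (le_of_eq ?_); ring
  · intro w hw
    have := hre w hw
    simp only [Set.mem_ofPred_eq, Complex.neg_re]; linarith

lemma step_coef (n : ℕ) (B : ℝ) (hB : 0 ≤ B) {C D q : ℂ → ℂ} {h : ℝ} (hC : Hol C) (hq : Hol q)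
    (hC0 : C 0 = 0) (hre : ∀ z ∈ ball (0:ℂ) 1, 0 ≤ (q z).re) (hq0 : q 0 = h) (hh : 0 ≤ h) (hh1 : 3 * n * h ≤ 1)
    (hD : ∀ z ∈ ball (0:ℂ) 1, D z = C (z * Complex.exp (-q z)) + h - q z)
    (hcb : ∀ k, ‖cf C k‖ ≤ 2 * B) (k : ℕ) (hk1 : 1 ≤ k) (hkn : k ≤ n) :
    ‖cf D k - (cf C k - vv (cf C) (cf q) k)‖ ≤ ((n + 1) * (2 * B * (2 ^ n * (9 * n ^ 2)))) * h ^ 2 := by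
  obtain ⟨R, hR, hRt⟩ := trunc hC (k + 1)
  set e : ℕ → ℂ → ℂ := fun j z => Complex.exp (-(j * q z)) with he
  have hee : ∀ j z, Complex.exp (-q z) ^ j = e j z := by
    intro j z; rw [he, ← Complex.exp_nat_mul]; congr 1; ring
  have heh : ∀ j, Hol (e j) := fun j => by unfold Hol; simp only [he]; fun_prop
  have hRc : Hol (fun z => R (z * Complex.exp (-q z))) := by
    refine hR.comp (t := ball 0 1) (by fun_prop) fun z hz => exp_maps hre hz
  have hD' : ∀ z ∈ sphere (0:ℂ) (1/2), D z = (∑ j ∈ range (k + 1), cf C j * (z ^ j * e j z) +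
      z ^ (k + 1) * (e (k + 1) z * R (z * Complex.exp (-q z)))) + (h - q z) := by
    intro z hz
    rw [hD z (sph_sub (by norm_num) hz), hRt, add_sub_assoc]
    simp only [mul_pow, hee]; congr 2; ring
  have c1 : ∀ j, CS (e j) := fun j => (heh j).cs
  have c2 := hRc.cs
  have c3 := hq.cs
  have hcfD : cf D k = ∑ j ∈ range (k + 1), cf C j * cf (e j) (k - j) - cf q k := by
    have c1' := c1 (k + 1)
    have a1 : CS (fun z => ∑ j ∈ range (k + 1), cf C j * (z ^ j * e j z)) := by
      refine continuousOn_finsetSum _ fun i _ => ?_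
      have := c1 i
      fun_prop
    have a2 : CS (fun z => z ^ (k + 1) * (e (k + 1) z * R (z * Complex.exp (-q z)))) := by
      unfold CS; exact (by fun_prop : ContinuousOn (fun z : ℂ => z ^ (k+1)) _).mul (c1'.mul c2)
    rw [cf_congr hD', cf_add (f := fun z => (∑ j ∈ range (k + 1), cf C j * (z ^ j * e j z) +
      z ^ (k + 1) * (e (k + 1) z * R (z * Complex.exp (-q z))))) (g := fun z => h - q z) (a1.add a2) (by unfold CS; fun_prop),
      cf_add a1 a2, cf_sub (f := fun _ => (h:ℂ)) (by unfold CS; fun_prop) c3, cf_const, if_neg (by omega),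
      cf_shift_zero (g := fun z => e (k + 1) z * R (z * Complex.exp (-q z))) ((heh _).mul hRc) _ _ (by omega),
      cf_sum _ _ (fun i _ => by have := c1 i; unfold CS; fun_prop)]
    rw [add_zero, zero_sub, ← sub_eq_add_neg]
    congr 1
    refine sum_congr rfl fun j hj => ?_
    rw [cf_mul_left, cf_shift _ _ _ (by have := mem_range.1 hj; omega)]
  have hE : ∀ j ∈ range (k + 1), ‖cf (e j) (k - j) - ((if k - j = 0 then 1 else 0) - j * cf q (k - j))‖ ≤ 2 ^ n * (9 * n ^ 2) * h ^ 2 := by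
    intro j hj
    have hj' := mem_range.1 hj
    have c1j := c1 j
    rw [← cf_one, ← cf_mul_left, ← cf_sub (by unfold CS; fun_prop) (by unfold CS; fun_prop), ← cf_sub c1j (by unfold CS; fun_prop)]
    have hjn : (j:ℝ) ≤ n := by exact_mod_cast (by omega)
    refine (cf_bound (M := 9 * n ^ 2 * h ^ 2) (fun z hz => ?_) (k - j)).trans ?_
    · have hb := q_half hq hre hh hq0 hz
      have hb2 : ‖-((j:ℂ) * q z)‖ ≤ n * (3 * h) := by
        rw [norm_neg, norm_mul, Complex.norm_natCast]; gcongr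
      have := Complex.norm_exp_sub_one_sub_id_le (x := -((j:ℂ) * q z)) (hb2.trans (by linarith))
      calc _ = _ := by congr 1; simp only [he]; ring
        _ ≤ _ := this
        _ ≤ (n * (3 * h)) ^ 2 := by gcongr
        _ = _ := by ring
    · have : (2:ℝ) ^ (k - j) ≤ 2 ^ n := pow_le_pow_right₀ (by norm_num) (by omega)
      calc (2:ℝ) ^ (k - j) * (9 * n ^ 2 * h ^ 2) ≤ 2 ^ n * (9 * n ^ 2 * h ^ 2) := mul_le_mul_of_nonneg_right this (by positivity)
        _ = _ := by ring
  have hid : cf D k - (cf C k - vv (cf C) (cf q) k) = ∑ j ∈ range (k + 1), cf C j * (cf (e j) (k - j) - ((if k - j = 0 then 1 else 0) - j * cf q (k - j))) := by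
    have s1 : ∑ j ∈ range (k + 1), cf C j * (if k - j = 0 then (1:ℂ) else 0) = cf C k := by
      rw [sum_eq_single k]
      · simp
      · intro j hj hjk
        have := mem_range.1 hj
        rw [if_neg (by omega), mul_zero]
      · intro h; simp at h
    have s2 : ∑ j ∈ range (k + 1), cf C j * (j * cf q (k - j)) = ∑ j ∈ range k, ((j:ℂ) + 1) * cf C (j + 1) * cf q (k - (j + 1)) := by
      rw [sum_range_succ']
      simp only [Nat.cast_zero, zero_mul, mul_zero, add_zero]
      refine sum_congr rfl fun j _ => ?_
      push_cast; ring
    rw [hcfD, vv, ← s2]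
    simp only [mul_sub, sum_sub_distrib]
    rw [s1]; ring
  rw [hid]
  calc _ ≤ ∑ j ∈ range (k + 1), (2 * B) * (2 ^ n * (9 * n ^ 2) * h ^ 2) := by
        refine norm_sum_le_of_le _ fun j hj => ?_
        rw [norm_mul]
        have := hE j hj
        have := hcb j
        gcongr
    _ ≤ _ := by
        rw [sum_const, card_range, nsmul_eq_mul]
        have : ((k + 1 : ℕ) : ℝ) ≤ n + 1 := by exact_mod_cast (by omega)
        calc _ ≤ ((n:ℝ) + 1) * ((2 * B) * (2 ^ n * (9 * n ^ 2) * h ^ 2)) := by gcongr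
          _ = _ := by ring

lemma cf_le_of_re_le {C : ℂ → ℂ} (hC : Hol C) (hC0 : C 0 = 0) {B : ℝ} (hB : ∀ z ∈ ball (0:ℂ) 1, (C z).re ≤ B) (k : ℕ) :
    ‖cf C k‖ ≤ 2 * B := by
  have hB0 : 0 ≤ B := by have := hB 0 (by simp); rwa [hC0] at this
  rcases Nat.eq_zero_or_pos k with rfl | hk
  · rw [cf_zero hC, hC0, norm_zero]; linarith
  have := cf_le_of_re (q := fun z => B - C z) (by unfold Hol; fun_prop) (by simp [hC0])
    (fun z hz => by have := hB z hz; simp; linarith) k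
  have hc := hC.cs
  rw [cf_sub (f := fun _ => (B:ℂ)) (by unfold CS; fun_prop) hC.cs, cf_const, if_neg (by omega), zero_sub, norm_neg] at this
  simpa [hC0] using this

lemma step (n : ℕ) (B : ℝ) (hB : 0 ≤ B) : ∃ K : ℝ, 0 ≤ K ∧ ∀ (t h : ℝ) (C D q : ℂ → ℂ), 0 ≤ t → 0 ≤ h → h ≤ 1 →
    3 * n * h ≤ 1 → Hol C → Hol q → C 0 = 0 → (∀ z ∈ ball (0:ℂ) 1, 0 ≤ (q z).re) → q 0 = h →
    (∀ z ∈ ball (0:ℂ) 1, D z = C (z * Complex.exp (-q z)) + h - q z) → (∀ z ∈ ball (0:ℂ) 1, (C z).re ≤ B) →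
    Psi n (cf D) t ≤ Psi n (cf C) (t + h) + K * h ^ 2 := by
  obtain ⟨K, hK0, hK⟩ := step_alg n B ((n + 1) * (2 * B * (2 ^ n * (9 * n ^ 2)))) hB (by positivity)
  refine ⟨K, hK0, fun t h C D q ht hh hh1 hnh hC hq hC0 hre hq0 hD hCB => ?_⟩
  have hcb := cf_le_of_re_le hC hC0 hCB
  have hi : (q 0).im = 0 := by rw [hq0]; simp
  refine hK t h (cf C) (cf D) (cf q) ht hh hh1 (by rw [cf_zero hq, hq0]; simp)
    (caratheodory (W_rep n t _) (fun κ hκ => static n t ht _ κ hκ) hq hi hre) hcb (fun k => ?_)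
    (fun k h1 h2 => step_coef n B hB hC hq hC0 hre hq0 hh hnh hD hcb k h1 h2)
  have := cf_le_of_re hq hi hre k
  rwa [hq0, Complex.ofReal_re] at this

end DB

namespace DB
open Finset ComplexConjugate Metric Real

/-- every holomorphic function on the set has a primitive -/
def HP (Ω : Set ℂ) : Prop := ∀ G : ℂ → ℂ, DifferentiableOn ℂ G Ω → Complex.IsExactOn G Ω

lemma HP_ball (c : ℂ) (r : ℝ) : HP (ball c r) := fun _ hG => hG.isExactOn_ball

lemma exists_log {Ω : Set ℂ} (ho : IsOpen Ω) (hc : IsPreconnected Ω) (hp : HP Ω) {z0 : ℂ} (hz0 : z0 ∈ Ω)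
    {G : ℂ → ℂ} (hG : DifferentiableOn ℂ G Ω) (hG0 : ∀ z ∈ Ω, G z ≠ 0) :
    ∃ L : ℂ → ℂ, DifferentiableOn ℂ L Ω ∧ L z0 = Complex.log (G z0) ∧ ∀ z ∈ Ω, G z = Complex.exp (L z) := by
  obtain ⟨L, hL0, hL⟩ := (hp (fun z => deriv G z / G z) ((hG.deriv ho).div hG hG0)).with_val_at z0 (Complex.log (G z0))
  have hLd : DifferentiableOn ℂ L Ω := fun z hz => (hL z hz).differentiableAt.differentiableWithinAt
  refine ⟨L, hLd, hL0, fun z hz => ?_⟩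
  have key : G z * Complex.exp (-L z) = G z0 * Complex.exp (-L z0) := by
    refine ho.is_const_of_deriv_eq_zero (f := fun z => G z * Complex.exp (-L z)) hc (hG.mul (hLd.neg.cexp)) (fun w hw => ?_) hz hz0
    have h1 := (hG.differentiableAt (ho.mem_nhds hw)).hasDerivAt
    have h2 := h1.mul (hL w hw).neg.cexp
    have := h2.deriv
    have e := hG0 w hw
    simp only [Pi.zero_apply]
    refine Eq.trans this ?_
    field_simp; ring
  rw [hL0, Complex.exp_neg (Complex.log _), Complex.exp_log (hG0 _ hz0), mul_inv_cancel₀ (hG0 _ hz0), Complex.exp_neg] at key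
  have := Complex.exp_ne_zero (L z)
  field_simp at key
  exact key

structure Nice (F : ℂ → ℂ) (m M : ℝ) : Prop where
  hol : Hol F
  zero : F 0 = 0
  nz : ∀ z ∈ ball (0:ℂ) 1, F z = 0 → z = 0
  der : deriv F 0 = (m:ℂ)
  one_le : 1 ≤ m
  bd : ∀ z ∈ ball (0:ℂ) 1, ‖F z‖ ≤ M

lemma Nice.log {F : ℂ → ℂ} {m M : ℝ} (h : Nice F m M) :
    ∃ C : ℂ → ℂ, Hol C ∧ C 0 = 0 ∧ ∀ z ∈ ball (0:ℂ) 1, F z = m * z * Complex.exp (C z) := by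
  have hm : (m:ℂ) ≠ 0 := by have := h.one_le; exact_mod_cast (by linarith : m ≠ 0)
  have hd : Hol (dslope F 0) := (Complex.differentiableOn_dslope (isOpen_ball.mem_nhds (by simp))).2 h.hol
  have hF : ∀ z, F z = z * dslope F 0 z := fun z => by
    have := sub_smul_dslope F 0 z
    simpa [h.zero] using this.symm
  have hd0 : dslope F 0 0 = m := by rw [dslope_same, h.der]
  obtain ⟨L, hL, hL0, hLe⟩ := exists_log (G := fun z => dslope F 0 z / m) isOpen_ball (convex_ball (0:ℂ) 1).isPreconnected (HP_ball 0 1)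
    (z0 := 0) (by simp) (hd.div_const _) (fun z hz => div_ne_zero (fun hz' => by
      by_cases h0 : z = 0
      · rw [h0, hd0] at hz'; exact hm hz'
      · exact h0 (h.nz z hz (by rw [hF, hz', mul_zero]))) hm)
  refine ⟨L, hL, by rw [hL0, hd0, div_self hm, Complex.log_one], fun z hz => ?_⟩
  rw [← hLe z hz, hF z]; field_simp

lemma re_le_of {F C : ℂ → ℂ} {m M B : ℝ} (h : Nice F m M) (hC0 : C 0 = 0)
    (hFC : ∀ z ∈ ball (0:ℂ) 1, F z = m * z * Complex.exp (C z)) (hB : 0 ≤ B)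
    (hb : ∀ z ∈ ball (0:ℂ) 1, ‖F z‖ ≤ Real.exp B * m) : ∀ z ∈ ball (0:ℂ) 1, (C z).re ≤ B := by
  intro z hz
  by_cases hz0 : z = 0
  · rw [hz0, hC0]; simpa using hB
  have := Complex.dist_le_div_mul_dist_of_mapsTo_ball (R₂ := Real.exp B * m) h.hol (fun w hw => by
    rw [h.zero, mem_closedBall_zero_iff]; exact hb w hw) hz
  rw [h.zero, dist_zero_right, dist_zero_right, div_one, hFC z hz, norm_mul, norm_mul, Complex.norm_exp, Complex.norm_real,
    norm_of_nonneg (by linarith [h.one_le])] at this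
  have hm := h.one_le
  have hzp : 0 < ‖z‖ := norm_pos_iff.2 hz0
  rw [← Real.exp_le_exp]
  have h2 : 0 < m * ‖z‖ := by positivity
  nlinarith

lemma m_le {F : ℂ → ℂ} {m M : ℝ} (h : Nice F m M) : m ≤ M := by
  have := Complex.norm_deriv_le_div_of_mapsTo_ball (R₂ := M) h.hol (fun w hw => by
    rw [h.zero, mem_closedBall_zero_iff]; exact h.bd w hw) one_pos
  rw [h.der, Complex.norm_real, norm_of_nonneg (by linarith [h.one_le]), div_one] at this
  exact this

lemma link {n : ℕ} {M K h : ℝ} {F G φ C D : ℂ → ℂ} {m m' : ℝ} (hF : Nice F m M) (hG : Nice G m' M)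
    (hK : ∀ (t h : ℝ) (C D q : ℂ → ℂ), 0 ≤ t → 0 ≤ h → h ≤ 1 →
    3 * n * h ≤ 1 → Hol C → Hol q → C 0 = 0 → (∀ z ∈ ball (0:ℂ) 1, 0 ≤ (q z).re) → q 0 = h →
    (∀ z ∈ ball (0:ℂ) 1, D z = C (z * Complex.exp (-q z)) + h - q z) → (∀ z ∈ ball (0:ℂ) 1, (C z).re ≤ Real.log M) →
    Psi n (cf D) t ≤ Psi n (cf C) (t + h) + K * h ^ 2)
    (hφ : Hol φ) (hmap : ∀ z ∈ ball (0:ℂ) 1, φ z ∈ ball (0:ℂ) 1) (hFG : ∀ z ∈ ball (0:ℂ) 1, F z = G (φ z))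
    (hC : Hol C) (hC0 : C 0 = 0) (hCe : ∀ z ∈ ball (0:ℂ) 1, G z = m' * z * Complex.exp (C z))
    (hD : Hol D) (hD0 : D 0 = 0) (hDe : ∀ z ∈ ball (0:ℂ) 1, F z = m * z * Complex.exp (D z))
    (hm' : m' = m * Real.exp h) (h0 : 0 ≤ h) (h1 : h ≤ 1) (hn : 3 * n * h ≤ 1) :
    Psi n (cf D) (Real.log m) ≤ Psi n (cf C) (Real.log m + h) + K * h ^ 2 := by
  have hm0 : 0 < m := by linarith [hF.one_le]
  have hM1 : 1 ≤ M := hF.one_le.trans (m_le hF)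
  have hφ0 : φ 0 = 0 := hG.nz _ (hmap 0 (by simp)) (by rw [← hFG 0 (by simp), hF.zero])
  set q : ℂ → ℂ := fun z => h + C (φ z) - D z with hq
  have hqh : Hol q := by
    unfold Hol
    exact ((hC.comp hφ hmap).const_add _).sub hD
  have hmc : (m:ℂ) ≠ 0 := by exact_mod_cast hm0.ne'
  have hqe : ∀ z ∈ ball (0:ℂ) 1, z * Complex.exp (-q z) = φ z := by
    intro z hz
    have h1 := hFG z hz
    rw [hDe z hz, hCe _ (hmap z hz), hm'] at h1
    push_cast at h1
    have e : -q z = D z - (h + C (φ z)) := by simp only [hq]; ring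
    rw [e, Complex.exp_sub, Complex.exp_add]
    have e1 := Complex.exp_ne_zero (C (φ z))
    have e2 := Complex.exp_ne_zero (h:ℂ)
    field_simp
    have : (m:ℂ) * (z * Complex.exp (D z)) = m * (Complex.exp h * Complex.exp (C (φ z)) * φ z) := by linear_combination h1
    have := mul_left_cancel₀ hmc this
    linear_combination this
  have hq0 : q 0 = h := by simp only [hq, hφ0, hC0, hD0]; ring
  refine hK _ h C D q (Real.log_nonneg hF.one_le) h0 h1 hn hC hqh hC0 ?_ hq0 ?_ (re_le_of hG hC0 hCe (Real.log_nonneg hM1) ?_)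
  · intro z hz
    by_cases hz0 : z = 0
    · rw [hz0, hq0]; simpa using h0
    have := Complex.norm_le_norm_of_mapsTo_ball hφ (fun w hw => ball_subset_closedBall (hmap w hw)) hφ0 (mem_ball_zero_iff.1 hz)
    rw [← hqe z hz, norm_mul, Complex.norm_exp, Complex.neg_re] at this
    have hzp : 0 < ‖z‖ := norm_pos_iff.2 hz0
    have : Real.exp (-(q z).re) ≤ 1 := by
      by_contra hcon
      push Not at hcon
      nlinarith
    rw [Real.exp_le_one_iff] at this
    linarith
  · intro z hz
    rw [hqe z hz]; simp only [hq]; ring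
  · intro z hz
    rw [Real.exp_log (by linarith)]
    have := hG.bd z hz
    have := hG.one_le
    nlinarith

structure ChainOf (f : ℂ → ℂ) (δ ε M : ℝ) (N : ℕ) (F φ : ℕ → ℂ → ℂ) (m : ℕ → ℝ) : Prop where
  nice : ∀ i ≤ N, Nice (F i) (m i) M
  hol : ∀ i < N, Hol (φ i)
  maps : ∀ i < N, ∀ z ∈ ball (0:ℂ) 1, φ i z ∈ ball (0:ℂ) 1
  comp : ∀ i < N, ∀ z ∈ ball (0:ℂ) 1, F i z = F (i + 1) (φ i z)
  mono : ∀ i < N, m i ≤ m (i + 1)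
  small : ∀ i < N, m (i + 1) ≤ m i * Real.exp ε
  m0 : m 0 = 1
  F0 : ∀ z ∈ ball (0:ℂ) 1, F 0 z = f z
  last : ∀ z ∈ ball (0:ℂ) 1, ‖F N z‖ ≤ Real.exp δ * m N

lemma Psi_small (n : ℕ) {c : ℕ → ℂ} {t δ : ℝ} (ht : 0 ≤ t) (hc : ∀ k, ‖c k‖ ≤ 2 * δ) :
    Psi n c t ≤ n * ((n + 1) * (n * (2 * δ) ^ 2)) := by
  rw [Psi]
  calc _ ≤ ∑ i ∈ range n, ((n:ℝ) + 1) * (n * (2 * δ) ^ 2) := by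
        refine sum_le_sum fun i hi => ?_
        have hi' := mem_range.1 hi
        have h1 := tau_nonneg n (i + 1) ht
        have h2 := tau_le n (i + 1) (by omega) ht
        have h3 : ((i:ℝ) + 1) ≤ n := by exact_mod_cast hi'
        have h4 := hc (i + 1)
        have h5 : 0 ≤ 4 / ((i:ℝ) + 1) := by positivity
        calc _ ≤ tau n (i + 1) t * (((i:ℝ) + 1) * ‖c (i + 1)‖ ^ 2) := by
              refine mul_le_mul_of_nonneg_left (by linarith) h1
          _ ≤ _ := by gcongr
    _ = _ := by simp

lemma milin_of_chain (n : ℕ) {f C : ℂ → ℂ} (hC : Hol C) (hC0 : C 0 = 0)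
    (hf : ∀ z ∈ ball (0:ℂ) 1, f z = z * Complex.exp (C z))
    (H : ∀ δ > 0, ∃ M : ℝ, ∀ ε > 0, ∃ N F φ m, ChainOf f δ ε M N F φ m) : Psi n (cf C) 0 ≤ 0 := by
  have main : ∀ δ : ℝ, δ > 0 → Psi n (cf C) 0 ≤ n * ((n + 1) * (n * (2 * δ) ^ 2)) := by
    intro δ hδ
    obtain ⟨M, hM⟩ := H δ hδ
    have hM1 : 1 ≤ M := by
      obtain ⟨N, F, φ, m, hch⟩ := hM 1 one_pos
      exact (hch.nice 0 (by omega)).one_le.trans (m_le (hch.nice 0 (by omega)))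
    obtain ⟨K, hK0, hK⟩ := step n (Real.log M) (Real.log_nonneg hM1)
    have h2 : ∀ ε : ℝ, ε > 0 → ε ≤ 1 / (3 * n + 1) → Psi n (cf C) 0 ≤ n * ((n + 1) * (n * (2 * δ) ^ 2)) + (K * Real.log M) * ε := by
      intro ε hε hε2
      obtain ⟨N, F, φ, m, hch⟩ := hM ε hε
      have hε3 : (3 * n + 1) * ε ≤ 1 := by
        rw [le_div_iff₀ (by positivity)] at hε2; linarith
      have claim : ∀ j ≤ N, ∀ D : ℂ → ℂ, Hol D → D 0 = 0 → (∀ z ∈ ball (0:ℂ) 1, F (N - j) z = m (N - j) * z * Complex.exp (D z)) →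
          Psi n (cf D) (Real.log (m (N - j))) ≤ n * ((n + 1) * (n * (2 * δ) ^ 2)) + K * ε * (Real.log (m N) - Real.log (m (N - j))) := by
        intro j
        induction j with
        | zero =>
          intro _ D hD hD0 hDe
          have hN := hch.nice N le_rfl
          simp only [Nat.sub_zero] at *
          rw [sub_self, mul_zero, add_zero]
          exact Psi_small n (Real.log_nonneg hN.one_le) (cf_le_of_re_le hD hD0 (re_le_of hN hD0 hDe hδ.le hch.last))
        | succ j ih =>
          intro hj D hD hD0 hDe
          set i := N - (j + 1) with hi
          have hij : N - j = i + 1 := by omega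
          have hiN : i < N := by omega
          have hF := hch.nice i hiN.le
          have hG := hch.nice (i + 1) hiN
          obtain ⟨E, hE, hE0, hEe⟩ := hG.log
          have ih' := ih (by omega) E hE hE0 (by rw [hij]; exact hEe)
          rw [hij] at ih'
          have hmi : 0 < m i := by linarith [hF.one_le]
          have hmi' : 0 < m (i + 1) := by linarith [hG.one_le]
          set h := Real.log (m (i + 1)) - Real.log (m i) with hh
          have h0 : 0 ≤ h := sub_nonneg.2 (Real.log_le_log hmi (hch.mono i hiN))
          have hhε : h ≤ ε := by
            have := Real.log_le_log hmi' (hch.small i hiN)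
            rw [Real.log_mul hmi.ne' (Real.exp_ne_zero _), Real.log_exp] at this
            linarith
          have hnn : (0:ℝ) ≤ n := by positivity
          have := link (h := h) hF hG hK (hch.hol i hiN) (hch.maps i hiN) (hch.comp i hiN) hE hE0 hEe hD hD0 hDe
            (by rw [hh, Real.exp_sub, Real.exp_log hmi, Real.exp_log hmi']; field_simp) h0 (by nlinarith) (by nlinarith)
          have e : Real.log (m i) + h = Real.log (m (i + 1)) := by rw [hh]; ring
          rw [e] at this
          have : K * h ^ 2 ≤ K * ε * h := by
            rw [pow_two, ← mul_assoc]; gcongr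
          rw [hh] at this
          nlinarith
      have := claim N le_rfl C hC hC0
      rw [Nat.sub_self] at this
      have h3 := this (fun z hz => by rw [hch.F0 z hz, hf z hz, hch.m0]; simp)
      rw [hch.m0, Real.log_one, sub_zero] at h3
      refine h3.trans ?_
      have hN := hch.nice N le_rfl
      have : Real.log (m N) ≤ Real.log M := Real.log_le_log (by linarith [hN.one_le]) (m_le hN)
      have : K * ε * Real.log (m N) ≤ K * ε * Real.log M := by gcongr
      linarith
    have hL : 0 ≤ K * Real.log M := mul_nonneg hK0 (Real.log_nonneg hM1)
    refine le_of_forall_pos_le_add fun η hη => ?_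
    set ε := min (1 / (3 * n + 1) : ℝ) (η / (K * Real.log M + 1)) with hε
    have hεp : 0 < ε := by rw [hε]; positivity
    have := h2 ε hεp (min_le_left _ _)
    have h4 : ε ≤ η / (K * Real.log M + 1) := min_le_right _ _
    rw [le_div_iff₀ (by positivity)] at h4
    nlinarith
  refine le_of_forall_pos_le_add fun η hη => ?_
  set A : ℝ := n * ((n + 1) * (n * 4)) with hA
  have hA0 : 0 ≤ A := by positivity
  set δ := min 1 (η / (A + 1)) with hδ
  have hδp : 0 < δ := by rw [hδ]; positivity
  have h1 := main δ hδp
  have h2 : δ ≤ 1 := min_le_left _ _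
  have h3 : δ ≤ η / (A + 1) := min_le_right _ _
  rw [le_div_iff₀ (by positivity)] at h3
  have : (n:ℝ) * ((n + 1) * (n * (2 * δ) ^ 2)) = A * δ ^ 2 := by rw [hA]; ring
  rw [this] at h1
  have : A * δ ^ 2 ≤ A * δ := by
    refine mul_le_mul_of_nonneg_left ?_ hA0; nlinarith
  nlinarith
end DB

namespace DB
open Metric Filter Topology Set

lemma inj_nhds {U : Set ℂ} {f : ℂ → ℂ} (ho : IsOpen U) (hf : DifferentiableOn ℂ f U) (hi : InjOn f U) {z : ℂ} (hz : z ∈ U) :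
    𝓝 (f z) ≤ map f (𝓝 z) := by
  refine ((hf.analyticOnNhd ho) z hz).eventually_constant_or_nhds_le_map_nhds.resolve_left fun h => ?_
  obtain ⟨r, hr, hs⟩ := Metric.eventually_nhds_iff_ball.1 (h.and (ho.mem_nhds hz))
  have hw : z + (r/2:ℝ) ∈ ball z r := by
    rw [mem_ball, dist_eq_norm]; simp; rw [abs_of_pos hr]; linarith
  have h1 := hs _ hw
  have := hi h1.2 hz h1.1
  have : ((r/2:ℝ):ℂ) = 0 := by linear_combination this
  rw [Complex.ofReal_eq_zero] at this
  linarith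

lemma inj_open {U : Set ℂ} {f : ℂ → ℂ} (ho : IsOpen U) (hf : DifferentiableOn ℂ f U) (hi : InjOn f U) : IsOpen (f '' U) := by
  rw [isOpen_iff_mem_nhds]
  rintro _ ⟨z, hz, rfl⟩
  exact inj_nhds ho hf hi hz (image_mem_map (ho.mem_nhds hz))

lemma inv_aux {U : Set ℂ} {f e : ℂ → ℂ} (ho : IsOpen U) (hf : DifferentiableOn ℂ f U) (hi : InjOn f U)
    (he : ∀ z ∈ U, e (f z) = z) {z : ℂ} (hz : z ∈ U) : DifferentiableAt ℂ e (f z) ∧ deriv f z ≠ 0 := by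
  have hcont : ∀ w ∈ U, ContinuousAt e (f w) := by
    intro w hw
    unfold ContinuousAt
    rw [he w hw]
    have h1 : Tendsto (e ∘ f) (𝓝 w) (𝓝 w) := by
      refine (tendsto_id (x := 𝓝 w)).congr' ?_
      filter_upwards [ho.mem_nhds hw] with y hy
      simp [he y hy]
    rw [← tendsto_map'_iff] at h1
    exact h1.mono_left (inj_nhds ho hf hi hw)
  have hd : DifferentiableAt ℂ f z := hf.differentiableAt (ho.mem_nhds hz)
  have hdiff : ∀ w ∈ U, deriv f w ≠ 0 → DifferentiableAt ℂ e (f w) := by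
    intro w hw h0
    refine (HasDerivAt.of_local_left_inverse (f := f) (g := e) (a := f w) (f' := deriv f w) (hcont w hw) ?_ h0 ?_).differentiableAt
    · rw [he w hw]; exact (hf.differentiableAt (ho.mem_nhds hw)).hasDerivAt
    · have : f '' U ∈ 𝓝 (f w) := (inj_open ho hf hi).mem_nhds ⟨w, hw, rfl⟩
      filter_upwards [this]
      rintro _ ⟨y, hy, rfl⟩
      rw [he y hy]
  have hda : DifferentiableAt ℂ e (f z) := by
    rcases ((hf.deriv ho).analyticOnNhd ho z hz).eventually_eq_zero_or_eventually_ne_zero with h | h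
    · exfalso
      obtain ⟨r, hr, hs⟩ := Metric.eventually_nhds_iff_ball.1 (h.and (ho.mem_nhds hz))
      have hw : z + (r/2:ℝ) ∈ ball z r := by
        rw [mem_ball, dist_eq_norm]; simp; rw [abs_of_pos hr]; linarith
      have h1 : f (z + (r/2:ℝ)) = f z := isOpen_ball.is_const_of_deriv_eq_zero (convex_ball z r).isPreconnected
        (hf.mono fun w hw => (hs w hw).2) (fun w hw => (hs w hw).1) hw (mem_ball_self hr)
      have := hi (hs _ hw).2 hz h1
      have : ((r/2:ℝ):ℂ) = 0 := by linear_combination this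
      rw [Complex.ofReal_eq_zero] at this
      linarith
    · rw [eventually_nhdsWithin_iff] at h
      obtain ⟨r, hr, hs⟩ := Metric.eventually_nhds_iff_ball.1 (h.and (ho.mem_nhds hz))
      have hsub : ball z r ⊆ U := fun w hw => (hs w hw).2
      have hn : f '' ball z r ∈ 𝓝 (f z) := (inj_open isOpen_ball (hf.mono hsub) (hi.mono hsub)).mem_nhds ⟨z, mem_ball_self hr, rfl⟩
      refine ((Complex.differentiableOn_compl_singleton_and_continuousAt_iff hn).1 ⟨?_, hcont z hz⟩).differentiableAt hn
      rintro _ ⟨⟨y, hy, rfl⟩, hy2⟩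
      refine (hdiff y (hsub hy) ((hs y hy).1 fun h => hy2 ?_)).differentiableWithinAt
      rw [mem_singleton_iff] at *
      rw [h]
  refine ⟨hda, fun h0 => ?_⟩
  have h1 := (HasDerivAt.comp z hda.hasDerivAt hd.hasDerivAt)
  rw [h0, mul_zero] at h1
  have h2 : HasDerivAt (e ∘ f) 1 z := by
    refine (hasDerivAt_id z).congr_of_eventuallyEq ?_
    filter_upwards [ho.mem_nhds hz] with y hy
    simp [he y hy]
  exact zero_ne_one (h1.unique h2)

lemma exists_inv {U : Set ℂ} {f : ℂ → ℂ} (ho : IsOpen U) (hf : DifferentiableOn ℂ f U) (hi : InjOn f U) :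
    ∃ e : ℂ → ℂ, (∀ z ∈ U, e (f z) = z) ∧ DifferentiableOn ℂ e (f '' U) := by
  have hl := Function.invFunOn (f := f) (s := U)
  refine ⟨Function.invFunOn f U, fun z hz => hi.leftInvOn_invFunOn hz, ?_⟩
  rintro _ ⟨z, hz, rfl⟩
  exact (inv_aux ho hf hi (fun z hz => hi.leftInvOn_invFunOn hz) hz).1.differentiableWithinAt

lemma inj_deriv_ne {U : Set ℂ} {f : ℂ → ℂ} (ho : IsOpen U) (hf : DifferentiableOn ℂ f U) (hi : InjOn f U) {z : ℂ} (hz : z ∈ U) :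
    deriv f z ≠ 0 := (inv_aux ho hf hi (fun z hz => hi.leftInvOn_invFunOn hz) hz).2

/-- Montel for self-maps into the closed unit disc, along an ultrafilter -/
lemma montel {Ω : Set ℂ} (ho : IsOpen Ω) (g : ℕ → ℂ → ℂ) (hg : ∀ n, DifferentiableOn ℂ (g n) Ω)
    (hm : ∀ n, ∀ z ∈ Ω, ‖g n z‖ ≤ 1) (U : Ultrafilter ℕ) : ∃ G : ℂ → ℂ, TendstoLocallyUniformlyOn g G U Ω := by
  have h1 : ∀ z, ∃ w, z ∈ Ω → Tendsto (fun n => g n z) U (𝓝 w) := by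
    intro z
    by_cases hz : z ∈ Ω
    · obtain ⟨w, -, hw⟩ := (isCompact_closedBall (0:ℂ) 1).ultrafilter_le_nhds' (U.map (fun n => g n z)) (by
        refine Ultrafilter.mem_map.2 (Filter.Eventually.of_forall fun n => ?_)
        simpa using hm n z hz)
      exact ⟨w, fun _ => hw⟩
    · exact ⟨0, fun h => absurd h hz⟩
  choose G hG using h1
  refine ⟨G, ?_⟩
  rw [Metric.tendstoLocallyUniformlyOn_iff]
  intro ε hε z hz
  obtain ⟨r, hr, hs⟩ := Metric.isOpen_iff.1 ho z hz
  have hlip : ∀ n, ∀ y ∈ ball z r, dist (g n y) (g n z) ≤ 2 / r * dist y z := fun n y hy =>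
    Complex.dist_le_div_mul_dist_of_mapsTo_ball ((hg n).mono hs) (fun w hw => by
      rw [mem_closedBall, dist_eq_norm]
      have := hm n w (hs hw)
      have := hm n z hz
      refine (norm_sub_le _ _).trans (by linarith)) hy
  have hlipG : ∀ y ∈ ball z r, dist (G y) (G z) ≤ 2 / r * dist y z := fun y hy =>
    le_of_tendsto ((hG y (hs hy)).dist (hG z hz)) (Eventually.of_forall fun n => hlip n y hy)
  refine ⟨ball z (min r (ε * r / 8)), mem_nhdsWithin_of_mem_nhds (ball_mem_nhds _ (by positivity)), ?_⟩
  filter_upwards [Metric.tendsto_nhds.1 (hG z hz) (ε / 4) (by positivity)] with n hn y hy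
  rw [mem_ball, lt_min_iff] at hy
  have e1 := hlip n y hy.1
  have e2 := hlipG y hy.1
  have e3 : 2 / r * dist y z ≤ ε / 4 := by
    calc 2 / r * dist y z ≤ 2 / r * (ε * r / 8) := by gcongr; exact hy.2.le
      _ = ε / 4 := by field_simp; ring
  calc dist (G y) (g n y) ≤ dist (G y) (G z) + dist (G z) (g n z) + dist (g n z) (g n y) := dist_triangle4 _ _ _ _
    _ < ε := by rw [dist_comm (G z), dist_comm (g n z) (g n y)]; linarith

lemma hurwitz {Ω : Set ℂ} (ho : IsOpen Ω) (hc : IsPreconnected Ω) {g : ℕ → ℂ → ℂ} {G : ℂ → ℂ} (hg : ∀ n, DifferentiableOn ℂ (g n) Ω)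
    (hi : ∀ n, InjOn (g n) Ω) {U : Ultrafilter ℕ} (hl : TendstoLocallyUniformlyOn g G U Ω)
    {z0 : ℂ} (hz0 : z0 ∈ Ω) (hd : deriv G z0 ≠ 0) : InjOn G Ω := by
  have hGd : DifferentiableOn ℂ G Ω := hl.differentiableOn (Eventually.of_forall hg) ho
  intro a ha b hb hab
  by_contra hne
  have hGa := hGd.analyticOnNhd ho
  have hiso : ∀ᶠ z in 𝓝[≠] b, G z ≠ G b := by
    rcases ((hGa b hb).sub (analyticAt_const (v := G b))).eventually_eq_zero_or_eventually_ne_zero with h | h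
    · exfalso
      have : EqOn G (fun _ => G b) Ω := hGa.eqOn_of_preconnected_of_eventuallyEq analyticOnNhd_const hc hb
        (by filter_upwards [h] with z hz using sub_eq_zero.1 hz)
      apply hd
      have h2 : G =ᶠ[𝓝 z0] fun _ => G b := by filter_upwards [ho.mem_nhds hz0] with z hz using this hz
      rw [h2.deriv_eq]; simp
    · filter_upwards [h] with z hz using sub_ne_zero.1 hz
  rw [eventually_nhdsWithin_iff] at hiso
  obtain ⟨r, hr, hs⟩ := Metric.eventually_nhds_iff_ball.1 (hiso.and ((ho.mem_nhds hb)))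
  set ρ := min (r / 2) (dist a b / 2) with hρ
  have hdab : 0 < dist a b := dist_pos.2 hne
  have hρ0 : 0 < ρ := by rw [hρ]; positivity
  have hρr : ρ < r := (min_le_left _ _).trans_lt (by linarith)
  have hcb : closedBall b ρ ⊆ Ω := fun z hz => (hs z (closedBall_subset_ball hρr hz)).2
  have hna : a ∉ closedBall b ρ := by
    rw [mem_closedBall, not_le]; exact (min_le_right _ _).trans_lt (by linarith)
  obtain ⟨w, hw, hmin⟩ := (isCompact_sphere b ρ).exists_isMinOn (NormedSpace.sphere_nonempty.2 hρ0.le)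
    (f := fun z => ‖G z - G b‖) ((hGd.continuousOn.mono (sphere_subset_closedBall.trans hcb)).sub continuousOn_const).norm
  set μ := ‖G w - G b‖ with hμ
  have hμ0 : 0 < μ := by
    rw [hμ, norm_pos_iff, sub_ne_zero]
    refine (hs w (closedBall_subset_ball hρr (sphere_subset_closedBall hw))).1 ?_
    rintro rfl
    rw [mem_sphere, dist_self] at hw; exact hρ0.ne hw
  have hun := (tendstoLocallyUniformlyOn_iff_forall_isCompact ho).1 hl (closedBall b ρ) hcb (isCompact_closedBall b ρ)
  rw [Metric.tendstoUniformlyOn_iff] at hun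
  have hta := Metric.tendsto_nhds.1 (hl.tendsto_at ha) (μ / 8) (by positivity)
  obtain ⟨n, hn1, hn2⟩ := ((hun (μ / 8) (by positivity)).and hta).exists
  have hbb : b ∈ closedBall b ρ := mem_closedBall_self hρ0.le
  have key := DiffContOnCl.ball_subset_image_closedBall (f := g n) (z₀ := b) (r := ρ) (ε := μ / 2)
    (((hg n).mono (hcb)).diffContOnCl_ball subset_rfl) hρ0 (fun z hz => ?_) ?_
  · have : g n a ∈ ball (g n b) (μ / 2 / 2) := by
      have h1 := hn1 b hbb
      rw [mem_ball]
      calc dist (g n a) (g n b) ≤ dist (g n a) (G a) + dist (G a) (g n b) := dist_triangle _ _ _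
        _ < μ / 2 / 2 := by rw [hab] at hn2 ⊢; linarith
    obtain ⟨z, hz, hze⟩ := key this
    exact hna (hi n (hcb hz) ha hze ▸ hz)
  · have h1 := hn1 b hbb
    have h2 := hn1 z (sphere_subset_closedBall hz)
    have h3 : μ ≤ ‖G z - G b‖ := hmin hz
    rw [dist_eq_norm] at h1 h2
    have : G z - G b = (G z - g n z) + (g n z - g n b) - (G b - g n b) := by ring
    rw [this] at h3
    have := norm_sub_le ((G z - g n z) + (g n z - g n b)) (G b - g n b)
    have := norm_add_le (G z - g n z) (g n z - g n b)
    linarith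
  · refine Eventually.frequently (f := 𝓝[≠] b) ?_ |>.filter_mono nhdsWithin_le_nhds
    filter_upwards [mem_nhdsWithin_of_mem_nhds (ho.mem_nhds hb), self_mem_nhdsWithin] with z hz hz2 h
    exact hz2 (hi n hz hb h)
end DB

namespace DB
open Metric Filter Topology Set ComplexConjugate

noncomputable def mob (w z : ℂ) : ℂ := (z - w) / (1 - conj w * z)

lemma mob_den {w z : ℂ} (hw : ‖w‖ < 1) (hz : ‖z‖ < 1) : 1 - conj w * z ≠ 0 := by
  intro h
  have : ‖conj w * z‖ = 1 := by rw [← sub_eq_zero.1 h]; simp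
  rw [norm_mul, RCLike.norm_conj] at this
  nlinarith [norm_nonneg w, norm_nonneg z]

lemma mob_lt {w z : ℂ} (hw : ‖w‖ < 1) (hz : ‖z‖ < 1) : ‖mob w z‖ < 1 := by
  rw [mob, norm_div, div_lt_one (norm_pos_iff.2 (mob_den hw hz))]
  rw [← sq_lt_sq₀ (norm_nonneg _) (norm_nonneg _)]
  have h1 : ‖w‖ ^ 2 < 1 := by nlinarith [norm_nonneg w]
  have h2 : ‖z‖ ^ 2 < 1 := by nlinarith [norm_nonneg z]
  rw [Complex.sq_norm, Complex.normSq_apply] at *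
  rw [Complex.sq_norm, Complex.normSq_apply]
  simp only [Complex.sub_re, Complex.sub_im, Complex.mul_re, Complex.mul_im, Complex.conj_re, Complex.conj_im, Complex.one_re, Complex.one_im]
  nlinarith [mul_pos (sub_pos.2 h1) (sub_pos.2 h2)]

lemma mob_inj {w a b : ℂ} (hw : ‖w‖ < 1) (ha : ‖a‖ < 1) (hb : ‖b‖ < 1) (h : mob w a = mob w b) : a = b := by
  rw [mob, mob, div_eq_div_iff (mob_den hw ha) (mob_den hw hb)] at h
  have h1 : (a - b) * (1 - conj w * w) = 0 := by linear_combination h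
  rcases mul_eq_zero.1 h1 with h2 | h2
  · exact sub_eq_zero.1 h2
  · exact absurd h2 (mob_den hw hw)

lemma mob_deriv {w z : ℂ} (hw : ‖w‖ < 1) (hz : ‖z‖ < 1) :
    HasDerivAt (mob w) ((1 - conj w * w) / (1 - conj w * z) ^ 2) z := by
  have h1 : HasDerivAt (fun z : ℂ => z - w) 1 z := (hasDerivAt_id z).sub_const w
  have h2 : HasDerivAt (fun z : ℂ => 1 - conj w * z) (-(conj w * 1)) z := ((hasDerivAt_id z).const_mul (conj w)).const_sub 1
  refine (h1.div h2 (mob_den hw hz)).congr_deriv ?_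
  congr 1; ring

structure Fam (Ω : Set ℂ) (g : ℂ → ℂ) : Prop where
  dif : DifferentiableOn ℂ g Ω
  lt : ∀ z ∈ Ω, ‖g z‖ < 1
  inj : InjOn g Ω
  zero : g 0 = 0

lemma koebe {Ω : Set ℂ} (ho : IsOpen Ω) (hc : IsPreconnected Ω) (hp : HP Ω) (h0 : 0 ∈ Ω) {g : ℂ → ℂ} (hg : Fam Ω g)
    {w : ℂ} (hw : ‖w‖ < 1) (hn : ∀ z ∈ Ω, g z ≠ w) : ∃ G, Fam Ω G ∧ ‖deriv g 0‖ < ‖deriv G 0‖ := by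
  have hw0 : w ≠ 0 := fun h => hn 0 h0 (by rw [hg.zero, h])
  set ψ : ℂ → ℂ := fun z => mob w (g z) with hψ
  have hgd : ∀ z ∈ Ω, HasDerivAt g (deriv g z) z := fun z hz => (hg.dif.differentiableAt (ho.mem_nhds hz)).hasDerivAt
  have hψd : ∀ z ∈ Ω, HasDerivAt ψ ((1 - conj w * w) / (1 - conj w * g z) ^ 2 * deriv g z) z := fun z hz =>
    (mob_deriv hw (hg.lt z hz)).comp z (hgd z hz)
  have hψ1 : DifferentiableOn ℂ ψ Ω := fun z hz => (hψd z hz).differentiableAt.differentiableWithinAt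
  have hψn : ∀ z ∈ Ω, ψ z ≠ 0 := fun z hz => div_ne_zero (sub_ne_zero.2 (hn z hz)) (mob_den hw (hg.lt z hz))
  obtain ⟨L, hL, -, hLe⟩ := exists_log ho hc hp h0 hψ1 hψn
  set s : ℂ → ℂ := fun z => Complex.exp (L z / 2) with hs
  have hsq : ∀ z ∈ Ω, s z ^ 2 = ψ z := fun z hz => by
    rw [hLe z hz, hs, ← Complex.exp_nat_mul]; congr 1; push_cast; ring
  have hsd : DifferentiableOn ℂ s Ω := (hL.div_const 2).cexp
  have hslt : ∀ z ∈ Ω, ‖s z‖ < 1 := fun z hz => by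
    have := mob_lt hw (hg.lt z hz)
    have h2 := congrArg norm (hsq z hz)
    rw [norm_pow] at h2
    rw [← hψ] at *
    have h3 : ‖s z‖ ^ 2 < 1 := by rw [h2]; exact this
    nlinarith [norm_nonneg (s z)]
  have hsn : ∀ z, s z ≠ 0 := fun z => Complex.exp_ne_zero _
  have hs0 := hslt 0 h0
  refine ⟨fun z => mob (s 0) (s z), ⟨?_, fun z hz => mob_lt hs0 (hslt z hz), ?_, by simp [mob]⟩, ?_⟩
  · intro z hz
    exact ((mob_deriv hs0 (hslt z hz)).differentiableAt.comp z (hsd.differentiableAt (ho.mem_nhds hz))).differentiableWithinAt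
  · intro a ha b hb hab
    have := mob_inj hs0 (hslt a ha) (hslt b hb) hab
    have h2 : ψ a = ψ b := by rw [← hsq a ha, ← hsq b hb, this]
    exact hg.inj ha hb (mob_inj hw (hg.lt a ha) (hg.lt b hb) h2)
  · have hsd0 := (hsd.differentiableAt (ho.mem_nhds h0)).hasDerivAt
    have e1 : HasDerivAt ψ (2 * s 0 * deriv s 0) 0 := by
      have h2 := hsd0.pow 2
      refine (h2.congr_of_eventuallyEq ?_).congr_deriv (by simp)
      filter_upwards [ho.mem_nhds h0] with z hz using (hsq z hz).symm
    have e2 := e1.unique (hψd 0 h0)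
    rw [hg.zero, mul_zero, sub_zero, one_pow, div_one] at e2
    have e3 := ((mob_deriv hs0 hs0).comp (0:ℂ) hsd0).deriv
    have e4 : deriv (fun z => mob (s 0) (s z)) 0 = (1 - conj (s 0) * s 0) / (1 - conj (s 0) * s 0) ^ 2 * deriv s 0 := e3
    have hconj : ∀ u : ℂ, 1 - conj u * u = ((1 - ‖u‖ ^ 2 : ℝ) : ℂ) := fun u => by
      rw [mul_comm, Complex.mul_conj, Complex.normSq_eq_norm_sq]; push_cast; ring
    have hsw : ‖s 0‖ ^ 2 = ‖w‖ := by
      rw [← norm_pow, hsq 0 h0, hψ]; simp [mob, hg.zero]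
    rw [hconj, hsw] at e4
    rw [hconj] at e2
    set σ := ‖s 0‖ with hσ
    have hσ0 : 0 < σ := norm_pos_iff.2 (hsn 0)
    have hwn : ‖w‖ = σ ^ 2 := hsw.symm
    have hσ2 : 0 < 1 - σ ^ 2 := by nlinarith
    have n2 := congrArg norm e2
    rw [norm_mul, norm_mul, norm_mul, Complex.norm_real, Complex.norm_ofNat, ← hσ, hwn, Real.norm_of_nonneg (by nlinarith)] at n2
    rw [e4, hwn, norm_mul, norm_div, norm_pow, Complex.norm_real, Real.norm_of_nonneg hσ2.le]
    have hg0 : 0 < ‖deriv g 0‖ := norm_pos_iff.2 (inj_deriv_ne ho hg.dif hg.inj h0)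
    rw [pow_two (1 - σ ^ 2), ← div_div, div_self hσ2.ne', div_mul_eq_mul_div, one_mul, lt_div_iff₀ hσ2]
    have : (2 * σ) * (‖deriv g 0‖ * (1 - σ ^ 2)) < (2 * σ) * ‖deriv s 0‖ := by
      rw [n2]
      have e5 : 2 * σ < 1 + σ ^ 2 := by nlinarith [sq_pos_of_pos (sub_pos.2 hs0)]
      have : (1 - (σ ^ 2) ^ 2) * ‖deriv g 0‖ = (1 + σ ^ 2) * (‖deriv g 0‖ * (1 - σ ^ 2)) := by ring
      rw [this]
      exact mul_lt_mul_of_pos_right e5 (by positivity)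
    exact lt_of_mul_lt_mul_left this (by positivity)

structure RM (Ω : Set ℂ) (h e : ℂ → ℂ) (ρ : ℝ) : Prop where
  hd : DifferentiableOn ℂ h Ω
  hmap : ∀ z ∈ Ω, ‖h z‖ < 1
  ed : Hol e
  emap : ∀ z, ‖z‖ < 1 → e z ∈ Ω
  eh : ∀ z ∈ Ω, e (h z) = z
  he : ∀ z, ‖z‖ < 1 → h (e z) = z
  h0 : h 0 = 0
  e0 : e 0 = 0
  der : deriv e 0 = (ρ : ℂ)
  pos : 0 < ρ

lemma riemann {Ω : Set ℂ} (ho : IsOpen Ω) (hc : IsPreconnected Ω) (hp : HP Ω) (h0 : 0 ∈ Ω) {R : ℝ} (hR : Ω ⊆ ball 0 R) :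
    ∃ h e ρ, RM Ω h e ρ := by
  have hRp : 0 < R := by have := hR h0; rwa [mem_ball, dist_self] at this
  obtain ⟨r, hr, hs⟩ := Metric.isOpen_iff.1 ho 0 h0
  set S : Set ℝ := {x | ∃ g, Fam Ω g ∧ x = ‖deriv g 0‖} with hS
  have hRc : (R:ℂ) ≠ 0 := by exact_mod_cast hRp.ne'
  have hbase : Fam Ω (fun z => z / R) := by
    refine ⟨by fun_prop, fun z hz => ?_, fun a _ b _ hab => ?_, by simp⟩
    · have := hR hz
      rw [mem_ball_zero_iff] at this
      rw [norm_div, Complex.norm_real, Real.norm_of_nonneg hRp.le, div_lt_one hRp]; exact this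
    · simpa [hRc] using hab
  have hbdd : BddAbove S := by
    refine ⟨1 / r, ?_⟩
    rintro _ ⟨g, hg, rfl⟩
    refine Complex.norm_deriv_le_div_of_mapsTo_ball (hg.dif.mono hs) (fun z hz => ?_) hr
    rw [hg.zero, mem_closedBall_zero_iff]; exact (hg.lt z (hs hz)).le
  have hne : S.Nonempty := ⟨_, _, hbase, rfl⟩
  obtain ⟨u, -, hu, huS⟩ := exists_seq_tendsto_sSup hne hbdd
  have huS' : ∀ n, ∃ g, Fam Ω g ∧ u n = ‖deriv g 0‖ := huS
  choose g hg hug using huS'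
  set U : Ultrafilter ℕ := hyperfilter ℕ
  have hU : (U : Filter ℕ) ≤ atTop := Nat.hyperfilter_le_atTop
  obtain ⟨G, hG⟩ := montel ho g (fun n => (hg n).dif) (fun n z hz => ((hg n).lt z hz).le) U
  have hGd : DifferentiableOn ℂ G Ω := hG.differentiableOn (Eventually.of_forall fun n => (hg n).dif) ho
  have hder := (hG.deriv (Eventually.of_forall fun n => (hg n).dif) ho).tendsto_at h0
  have hGS : ‖deriv G 0‖ = sSup S := by
    refine tendsto_nhds_unique (hder.norm) ?_
    refine (hu.mono_left hU).congr fun n => ?_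
    rw [hug]; rfl
  have hSpos : 0 < sSup S := by
    refine lt_of_lt_of_le ?_ (le_csSup hbdd ⟨_, hbase, rfl⟩)
    exact norm_pos_iff.2 (inj_deriv_ne ho hbase.dif hbase.inj h0)
  have hGd0 : deriv G 0 ≠ 0 := by rw [← norm_pos_iff, hGS]; exact hSpos
  have hGinj := hurwitz ho hc (fun n => (hg n).dif) (fun n => (hg n).inj) hG h0 hGd0
  have hopen := inj_open ho hGd hGinj
  have hGle : ∀ z ∈ Ω, ‖G z‖ ≤ 1 := fun z hz =>
    le_of_tendsto (hG.tendsto_at hz).norm (Eventually.of_forall fun n => ((hg n).lt z hz).le)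
  have hGlt : ∀ z ∈ Ω, ‖G z‖ < 1 := by
    have : G '' Ω ⊆ interior (closedBall (0:ℂ) 1) := interior_maximal (by
      rintro _ ⟨z, hz, rfl⟩; simpa using hGle z hz) hopen
    rw [interior_closedBall _ one_ne_zero] at this
    intro z hz
    simpa using this ⟨z, hz, rfl⟩
  have hG0 : G 0 = 0 := tendsto_nhds_unique (hG.tendsto_at h0) (by simp [(hg _).zero])
  have hGF : Fam Ω G := ⟨hGd, hGlt, hGinj, hG0⟩
  have hsurj : ∀ w : ℂ, ‖w‖ < 1 → ∃ z ∈ Ω, G z = w := by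
    intro w hw
    by_contra hcon
    push Not at hcon
    obtain ⟨H, hH, hlt⟩ := koebe ho hc hp h0 hGF hw hcon
    rw [hGS] at hlt
    exact absurd (le_csSup hbdd ⟨H, hH, rfl⟩) (not_le.2 hlt)
  -- rotation
  set c : ℂ := ‖deriv G 0‖ / deriv G 0 with hcdef
  have hcn : ‖c‖ = 1 := by
    rw [hcdef, norm_div, Complex.norm_real, norm_norm, div_self (norm_ne_zero_iff.2 hGd0)]
  have hc0 : c ≠ 0 := by rw [← norm_ne_zero_iff, hcn]; exact one_ne_zero
  set h : ℂ → ℂ := fun z => c * G z with hh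
  have hhd : DifferentiableOn ℂ h Ω := hGd.const_mul c
  have hhinj : InjOn h Ω := fun a ha b hb hab => hGinj ha hb (mul_left_cancel₀ hc0 hab)
  obtain ⟨e, he1, he2⟩ := exists_inv ho hhd hhinj
  have himg : ∀ w : ℂ, ‖w‖ < 1 → ∃ z ∈ Ω, h z = w := by
    intro w hw
    obtain ⟨z, hz, hzw⟩ := hsurj (w / c) (by rw [norm_div, hcn, div_one]; exact hw)
    exact ⟨z, hz, by simp only [hh]; rw [hzw]; field_simp⟩
  have hh0 : h 0 = 0 := by simp [hh, hG0]
  have he0 : e 0 = 0 := by have := he1 0 h0; rwa [hh0] at this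
  refine ⟨h, e, ‖deriv G 0‖⁻¹, hhd, fun z hz => ?_, he2.mono fun w hw => ?_, fun w hw => ?_, he1, fun w hw => ?_, hh0, he0, ?_, ?_⟩
  · simp only [hh]; rw [norm_mul, hcn, one_mul]; exact hGlt z hz
  · obtain ⟨z, hz, hzw⟩ := himg w (by simpa using hw)
    exact ⟨z, hz, hzw⟩
  · obtain ⟨z, hz, rfl⟩ := himg w hw
    rwa [he1 z hz]
  · obtain ⟨z, hz, rfl⟩ := himg w hw
    rw [he1 z hz]
  · have d1 : HasDerivAt h (c * deriv G 0) 0 := (hGd.differentiableAt (ho.mem_nhds h0)).hasDerivAt.const_mul c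
    have d2 : HasDerivAt e (deriv e 0) (h 0) := by
      rw [hh0]
      refine (he2.differentiableAt ?_).hasDerivAt
      exact (inj_open ho hhd hhinj).mem_nhds ⟨0, h0, hh0⟩
    have d3 := d2.comp 0 d1
    have d4 : HasDerivAt (e ∘ h) 1 0 := by
      refine (hasDerivAt_id (0:ℂ)).congr_of_eventuallyEq ?_
      filter_upwards [ho.mem_nhds h0] with y hy
      simp [he1 y hy]
    have := d3.unique d4
    rw [hcdef, div_mul_cancel₀ _ hGd0] at this
    push_cast
    exact eq_inv_of_mul_eq_one_left this
  · exact inv_pos.2 (norm_pos_iff.2 hGd0)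
end DB

namespace DB
open Metric Filter Topology Set MeasureTheory

lemma par_deriv {a b : ℝ → ℂ} (ha : Continuous a) (hb : Continuous b) {v0 : ℂ} (h : ∀ θ, v0 * b θ ≠ 1) :
    HasDerivAt (fun v => ∫ θ in (0:ℝ)..(2 * Real.pi), a θ / (1 - v * b θ))
      (∫ θ in (0:ℝ)..(2 * Real.pi), a θ * b θ / (1 - v0 * b θ) ^ 2) v0 := by
  have h' : ∀ θ, 1 - v0 * b θ ≠ 0 := fun θ => sub_ne_zero.2 (h θ).symm
  have hcomp : IsCompact (Icc (0:ℝ) (2 * Real.pi)) := isCompact_Icc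
  have hne : (Icc (0:ℝ) (2 * Real.pi)).Nonempty := ⟨0, by simp; positivity⟩
  obtain ⟨A, hA⟩ := hcomp.exists_bound_of_continuousOn ha.continuousOn
  obtain ⟨B, hB⟩ := hcomp.exists_bound_of_continuousOn hb.continuousOn
  obtain ⟨θ0, -, hmin⟩ := hcomp.exists_isMinOn hne (f := fun θ => ‖1 - v0 * b θ‖) (by fun_prop)
  set μ := ‖1 - v0 * b θ0‖ with hμ
  have hμ0 : 0 < μ := norm_pos_iff.2 (h' θ0)
  have hA0 : 0 ≤ A := (norm_nonneg _).trans (hA _ hne.some_mem)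
  have hB0 : 0 ≤ B := (norm_nonneg _).trans (hB _ hne.some_mem)
  set s := ball v0 (μ / (2 * (B + 1))) with hs
  have hlow : ∀ θ ∈ Icc (0:ℝ) (2 * Real.pi), ∀ v ∈ s, μ / 2 ≤ ‖1 - v * b θ‖ := by
    intro θ hθ v hv
    have h1 : μ ≤ ‖1 - v0 * b θ‖ := hmin hθ
    have h2 : ‖(v - v0) * b θ‖ ≤ μ / 2 := by
      rw [norm_mul]
      rw [hs, mem_ball, dist_eq_norm] at hv
      calc _ ≤ μ / (2 * (B + 1)) * (B + 1) := by
            have := hB θ hθ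
            gcongr; linarith
        _ = μ / 2 := by field_simp
    have h3 : 1 - v0 * b θ = (1 - v * b θ) + (v - v0) * b θ := by ring
    rw [h3] at h1
    have := norm_add_le (1 - v * b θ) ((v - v0) * b θ)
    linarith
  have huI : ∀ θ ∈ uIoc (0:ℝ) (2 * Real.pi), θ ∈ Icc (0:ℝ) (2 * Real.pi) := by
    intro θ hθ
    rw [uIoc_of_le (by positivity)] at hθ
    exact Ioc_subset_Icc_self hθ
  have hmeas : ∀ (F : ℝ → ℂ), ContinuousOn F (Icc (0:ℝ) (2 * Real.pi)) → AEStronglyMeasurable F (volume.restrict (uIoc (0:ℝ) (2 * Real.pi))) := by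
    intro F hF
    exact (hF.mono huI).aestronglyMeasurable measurableSet_uIoc
  have hv0s : s ∈ 𝓝 v0 := ball_mem_nhds _ (by positivity)
  have hcF : ∀ v ∈ s, ContinuousOn (fun θ => a θ / (1 - v * b θ)) (Icc (0:ℝ) (2 * Real.pi)) := by
    intro v hv
    refine ContinuousOn.div ha.continuousOn (by fun_prop) fun θ hθ h0 => ?_
    have := hlow θ hθ v hv
    rw [h0, norm_zero] at this; linarith
  refine (intervalIntegral.hasDerivAt_integral_of_dominated_loc_of_deriv_le (s := s) (bound := fun _ => A * B / (μ / 2) ^ 2)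
    (F' := fun v θ => a θ * b θ / (1 - v * b θ) ^ 2) hv0s ?_ ?_ ?_ ?_ ?_ ?_).2
  · filter_upwards [hv0s] with v hv
    exact hmeas _ (hcF v hv)
  · refine ContinuousOn.intervalIntegrable ?_
    rw [uIcc_of_le (by positivity)]
    exact hcF v0 (mem_of_mem_nhds hv0s)
  · refine hmeas _ (Continuous.continuousOn ?_)
    exact (ha.mul hb).div (by fun_prop) fun θ => pow_ne_zero _ (h' θ)
  · refine ae_of_all _ fun θ hθ v hv => ?_
    have hθ' := huI θ hθ
    rw [norm_div, norm_mul, norm_pow]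
    have h1 := hlow θ hθ' v hv
    have h2 := hA θ hθ'
    have h3 := hB θ hθ'
    gcongr
  · exact intervalIntegrable_const
  · refine ae_of_all _ fun θ hθ v hv => ?_
    have hne0 : 1 - v * b θ ≠ 0 := fun h0 => by
      have := hlow θ (huI θ hθ) v hv
      rw [h0, norm_zero] at this; linarith
    have h1 : HasDerivAt (fun v : ℂ => 1 - v * b θ) (-(1 * b θ)) v := ((hasDerivAt_id v).mul_const (b θ)).const_sub 1
    refine ((hasDerivAt_const v (a θ)).div h1 hne0).congr_deriv ?_
    congr 1; ring

lemma par_tendsto {a b : ℝ → ℂ} (ha : Continuous a) (hb : Continuous b) (h : ∀ θ, b θ ≠ 0) :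
    Tendsto (fun v => ∫ θ in (0:ℝ)..(2 * Real.pi), a θ / (1 - v * b θ)) (cocompact ℂ) (𝓝 0) := by
  have hcomp : IsCompact (Icc (0:ℝ) (2 * Real.pi)) := isCompact_Icc
  have hne : (Icc (0:ℝ) (2 * Real.pi)).Nonempty := ⟨0, by simp; positivity⟩
  obtain ⟨A, hA⟩ := hcomp.exists_bound_of_continuousOn ha.continuousOn
  obtain ⟨θ0, -, hmin⟩ := hcomp.exists_isMinOn hne (f := fun θ => ‖b θ‖) (by fun_prop)
  set μ := ‖b θ0‖ with hμ
  have hμ0 : 0 < μ := norm_pos_iff.2 (h θ0)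
  have hA0 : 0 ≤ A := (norm_nonneg _).trans (hA _ hne.some_mem)
  rw [← Metric.cobounded_eq_cocompact]
  have t1 : Tendsto (fun v : ℂ => ‖v‖ * μ - 1) (Bornology.cobounded ℂ) atTop :=
    tendsto_atTop_add_const_right _ (-1) ((tendsto_norm_cobounded_atTop).atTop_mul_const hμ0)
  have t2 : Tendsto (fun v : ℂ => A / (‖v‖ * μ - 1) * |2 * Real.pi - 0|) (Bornology.cobounded ℂ) (𝓝 (0 * |2 * Real.pi - 0|)) :=
    (t1.const_div_atTop A).mul_const _
  rw [zero_mul] at t2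
  refine squeeze_zero_norm' ?_ t2
  filter_upwards [t1.eventually_gt_atTop 0] with v hv
  refine intervalIntegral.norm_integral_le_of_norm_le_const fun θ hθ => ?_
  rw [uIoc_of_le (by positivity)] at hθ
  have hθ' := Ioc_subset_Icc_self hθ
  rw [norm_div]
  have h1 : μ ≤ ‖b θ‖ := hmin hθ'
  have h2 := hA θ hθ'
  have h3 : ‖v‖ * μ - 1 ≤ ‖1 - v * b θ‖ := by
    have := norm_sub_norm_le (v * b θ) 1
    rw [norm_mul, norm_one, norm_sub_rev] at this
    have : ‖v‖ * μ ≤ ‖v‖ * ‖b θ‖ := by gcongr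
    linarith
  gcongr
end DB

namespace DB
open Metric Filter Topology Set MeasureTheory

structure Uni (f : ℂ → ℂ) (R : ℝ) : Prop where
  dif : DifferentiableOn ℂ f (ball 0 R)
  inj : InjOn f (ball 0 R)
  zero : f 0 = 0

def Dual (f : ℂ → ℂ) (r : ℝ) : Set ℂ := {v | ∀ z : ℂ, ‖z‖ ≤ r → v * f z ≠ 1}

def Ann (r R : ℝ) : Set ℂ := {z | r < ‖z‖ ∧ ‖z‖ < R}

lemma Ann_open (r R : ℝ) : IsOpen (Ann r R) :=
  (isOpen_lt continuous_const continuous_norm).inter (isOpen_lt continuous_norm continuous_const)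

variable {f G : ℂ → ℂ} {R r : ℝ}

lemma Uni.nz (hf : Uni f R) {z : ℂ} (hz : ‖z‖ < R) (h0 : z ≠ 0) : f z ≠ 0 := fun h =>
  h0 (hf.inj (by simpa using hz) (by simpa using (norm_nonneg z).trans_lt hz) (by rw [h, hf.zero]))

lemma Uni.at (hf : Uni f R) {z : ℂ} (hz : ‖z‖ < R) : DifferentiableAt ℂ f z :=
  hf.dif.differentiableAt (isOpen_ball.mem_nhds (by simpa using hz))

lemma Uni.eq (hf : Uni f R) {z w : ℂ} (hz : ‖z‖ < R) (hw : ‖w‖ < R) (h : f z = f w) : z = w :=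
  hf.inj (by simpa using hz) (by simpa using hw) h

lemma dual_zero : (0:ℂ) ∈ Dual f r := fun z _ => by simp

lemma dual_anti {r' : ℝ} (h : r ≤ r') : Dual f r' ⊆ Dual f r := fun _ hv z hz => hv z (hz.trans h)

lemma dual_open (hf : Uni f R) (hr : r < R) : IsOpen (Dual f r) := by
  have hK : IsCompact (closedBall (0:ℂ) r) := isCompact_closedBall 0 r
  have hfc : ContinuousOn f (closedBall (0:ℂ) r) := hf.dif.continuousOn.mono (closedBall_subset_ball hr)
  rw [isOpen_iff_mem_nhds]
  intro v hv
  have := hK.image_of_continuousOn hfc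
  -- work with the compact image
  have hsub : ∀ w ∈ f '' closedBall (0:ℂ) r, ∀ᶠ p : ℂ × ℂ in 𝓝 v ×ˢ 𝓝 w, p.1 * p.2 ≠ 1 := by
    rintro _ ⟨z, hz, rfl⟩
    have h1 : v * f z ≠ 1 := hv z (by simpa using hz)
    have h2 : ContinuousAt (fun p : ℂ × ℂ => p.1 * p.2) (v, f z) := by fun_prop
    have := h2.eventually_ne h1
    rwa [nhds_prod_eq] at this
  have h3 := this.eventually_forall_of_forall_eventually (P := fun (v w : ℂ) => v * w ≠ 1) (x₀ := v) (fun w hw => by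
    have := hsub w hw
    rwa [nhds_prod_eq])
  filter_upwards [h3] with u hu z hz
  exact hu _ ⟨z, by simpa using hz, rfl⟩

lemma dual_bdd (hf : Uni f R) (hr0 : 0 < r) (hr : r < R) : ∃ B, 0 < B ∧ Dual f r ⊆ ball 0 B := by
  have hsub : ball (0:ℂ) r ⊆ ball 0 R := ball_subset_ball hr.le
  have ho := inj_open isOpen_ball (hf.dif.mono hsub) (hf.inj.mono hsub)
  obtain ⟨δ, hδ, hs⟩ := Metric.isOpen_iff.1 ho 0 ⟨0, by simpa using hr0, hf.zero⟩
  refine ⟨2 / δ, by positivity, fun v hv => ?_⟩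
  rw [mem_ball_zero_iff]
  by_contra hcon
  push Not at hcon
  have hv0 : v ≠ 0 := by rintro rfl; rw [norm_zero] at hcon; have : 0 < 2 / δ := by positivity
                         linarith
  obtain ⟨z, hz, hzv⟩ := hs (show v⁻¹ ∈ ball (0:ℂ) δ by
    rw [mem_ball_zero_iff, norm_inv]
    have : 0 < 2 / δ := by positivity
    calc ‖v‖⁻¹ ≤ (2 / δ)⁻¹ := by gcongr
      _ = δ / 2 := by field_simp
      _ < δ := by linarith)
  exact hv z (by simpa using (mem_ball_zero_iff.1 hz).le) (by rw [hzv, mul_inv_cancel₀ hv0])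

lemma Ann_ne {z : ℂ} (hr0 : 0 < r) (hz : z ∈ Ann r R) : z ≠ 0 := by
  rintro rfl; have := hz.1; rw [norm_zero] at this; linarith

lemma collar (hf : Uni f R) (hr0 : 0 < r) {z : ℂ} (hz : z ∈ Ann r R) : (f z)⁻¹ ∈ Dual f r := by
  intro w hw h
  have h0 := hf.nz hz.2 (Ann_ne hr0 hz)
  have h1 : f w = f z := by field_simp at h; exact h
  have := hf.eq (hw.trans_lt (hz.1.trans hz.2)) hz.2 h1
  have h2 := hz.1
  rw [this] at hw; linarith

noncomputable def aG (f G : ℂ → ℂ) (z : ℂ) : ℂ := G (f z)⁻¹ * deriv f z / f z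

lemma aG_dif (hf : Uni f R) (hr0 : 0 < r) (hr : r < R) (hG : DifferentiableOn ℂ G (Dual f r)) {z : ℂ} (hz : z ∈ Ann r R) :
    DifferentiableAt ℂ (aG f G) z := by
  have h1 := hf.at hz.2
  have h0 := hf.nz hz.2 (Ann_ne hr0 hz)
  have h2 : DifferentiableAt ℂ (fun z => G (f z)⁻¹) z :=
    (hG.differentiableAt ((dual_open hf hr).mem_nhds (collar hf hr0 hz))).comp z (h1.inv h0)
  have h3 : DifferentiableAt ℂ (deriv f) z := (hf.dif.deriv isOpen_ball).differentiableAt (isOpen_ball.mem_nhds (by simpa using hz.2))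
  exact (h2.mul h3).div h1 h0

noncomputable def JJ (a f : ℂ → ℂ) (ρ : ℝ) (v : ℂ) : ℂ := (2 * Real.pi * Complex.I)⁻¹ * ∮ z in C(0, ρ), a z / (1 - v * f z)

lemma circ_norm {ρ : ℝ} (h : 0 < ρ) (θ : ℝ) : ‖circleMap 0 ρ θ‖ = ρ := by simp [abs_of_pos h]

lemma JJ_eq (a f : ℂ → ℂ) (ρ : ℝ) : JJ a f ρ = fun v => (2 * Real.pi * Complex.I)⁻¹ * ∫ θ in (0:ℝ)..(2 * Real.pi),
    (deriv (circleMap 0 ρ) θ * a (circleMap 0 ρ θ)) / (1 - v * f (circleMap 0 ρ θ)) := by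
  ext v
  simp only [JJ, circleIntegral, smul_eq_mul, mul_div_assoc]

lemma comp_circ {a : ℂ → ℂ} {ρ : ℝ} (hρ : 0 < ρ) (ha : ContinuousOn a (sphere 0 ρ)) : Continuous (fun θ => a (circleMap 0 ρ θ)) :=
  ha.comp_continuous (continuous_circleMap 0 ρ) fun θ => circleMap_mem_sphere 0 hρ.le θ

lemma dcirc (ρ : ℝ) : Continuous (deriv (circleMap 0 ρ)) := by
  have : deriv (circleMap 0 ρ) = fun θ => circleMap 0 ρ θ * Complex.I := by ext θ; simp
  rw [this]; exact (continuous_circleMap 0 ρ).mul continuous_const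

lemma JJ_dif {a : ℂ → ℂ} {ρ : ℝ} (hρ : 0 < ρ) (ha : ContinuousOn a (sphere 0 ρ)) (hb : ContinuousOn f (sphere 0 ρ))
    {v : ℂ} (h : ∀ z, ‖z‖ = ρ → v * f z ≠ 1) : DifferentiableAt ℂ (JJ a f ρ) v := by
  rw [JJ_eq]
  exact (par_deriv ((dcirc ρ).mul (comp_circ hρ ha)) (comp_circ hρ hb) fun θ => h _ (circ_norm hρ θ)).differentiableAt.const_mul _

lemma JJ_tendsto {a : ℂ → ℂ} {ρ : ℝ} (hρ : 0 < ρ) (ha : ContinuousOn a (sphere 0 ρ)) (hb : ContinuousOn f (sphere 0 ρ))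
    (h : ∀ z, ‖z‖ = ρ → f z ≠ 0) : Tendsto (JJ a f ρ) (cocompact ℂ) (𝓝 0) := by
  rw [JJ_eq]
  have := (par_tendsto ((dcirc ρ).mul (comp_circ hρ ha)) (comp_circ hρ hb) fun θ => h _ (circ_norm hρ θ)).const_mul
    (2 * Real.pi * Complex.I)⁻¹
  rwa [mul_zero] at this

lemma JJ_diff (hf : Uni f R) (hr0 : 0 < r) (hG : DifferentiableOn ℂ G (Dual f r)) {ρ1 ρ2 : ℝ} (h1 : r < ρ1)
    (h2 : ρ2 < R) {z0 : ℂ} (hz1 : ρ1 < ‖z0‖) (hz2 : ‖z0‖ < ρ2) :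
    JJ (aG f G) f ρ1 (f z0)⁻¹ - JJ (aG f G) f ρ2 (f z0)⁻¹ = G (f z0)⁻¹ := by
  have hrR : r < R := by linarith
  have hz0R : ‖z0‖ < R := hz2.trans h2
  have hz00 : z0 ≠ 0 := by rintro rfl; rw [norm_zero] at hz1; linarith
  have hz0A : z0 ∈ Ann r R := ⟨by linarith, hz0R⟩
  have hfz0 := hf.nz hz0R hz00
  set s := dslope f z0 with hs
  have hsd : DifferentiableOn ℂ s (ball 0 R) := (Complex.differentiableOn_dslope (isOpen_ball.mem_nhds (by simpa using hz0R))).2 hf.dif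
  have hs0 : ∀ z, ‖z‖ < R → s z ≠ 0 := by
    intro z hz h
    by_cases hzz : z = z0
    · rw [hs, hzz, dslope_same] at h
      exact inj_deriv_ne isOpen_ball hf.dif hf.inj (by simpa using hz0R) h
    · have := sub_smul_dslope f z0 z
      rw [← hs, h, smul_zero] at this
      exact hzz (hf.eq hz hz0R (sub_eq_zero.1 this.symm))
  set k : ℂ → ℂ := fun z => aG f G z * f z0 / s z with hk
  have hkd : DifferentiableOn ℂ k (Ann r R) := fun z hz =>
    (((aG_dif hf hr0 hrR hG hz).mul_const _).div (hsd.differentiableAt (isOpen_ball.mem_nhds (by simpa using hz.2))) (hs0 z hz.2)).differentiableWithinAt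
  have hkz0 : k z0 = G (f z0)⁻¹ := by
    have : deriv f z0 ≠ 0 := inj_deriv_ne isOpen_ball hf.dif hf.inj (by simpa using hz0R)
    simp only [hk, hs, dslope_same, aG]
    field_simp
  have hDd : DifferentiableOn ℂ (dslope k z0) (Ann r R) := (Complex.differentiableOn_dslope ((Ann_open r R).mem_nhds hz0A)).2 hkd
  have hint : ∀ z ∈ Ann r R, z ≠ z0 → aG f G z / (1 - (f z0)⁻¹ * f z) = -(dslope k z0 z + k z0 * (z - z0)⁻¹) := by
    intro z hz hne
    have e0 : z - z0 ≠ 0 := sub_ne_zero.2 hne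
    have e1 : (z - z0) * s z = f z - f z0 := by have := sub_smul_dslope f z0 z; rwa [smul_eq_mul] at this
    have e2 : (z - z0) * dslope k z0 z = k z - k z0 := by have := sub_smul_dslope k z0 z; rwa [smul_eq_mul] at this
    have e3 : dslope k z0 z + k z0 * (z - z0)⁻¹ = k z / (z - z0) := by field_simp; linear_combination e2
    have e4 : 1 - (f z0)⁻¹ * f z = -((z - z0) * s z) / f z0 := by rw [e1]; field_simp; ring
    have e5 := hs0 z hz.2
    rw [e3, e4]; simp only [hk]; field_simp
  have hcirc : ∀ ρ, r < ρ → ρ < R → ρ ≠ ‖z0‖ → JJ (aG f G) f ρ (f z0)⁻¹ =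
      -(2 * Real.pi * Complex.I)⁻¹ * ((∮ z in C(0, ρ), dslope k z0 z) + k z0 * ∮ z in C(0, ρ), (z - z0)⁻¹) := by
    intro ρ hρ1 hρ2 hρ3
    have hρ0 : 0 < ρ := by linarith
    have hA : ∀ z ∈ sphere (0:ℂ) ρ, z ∈ Ann r R := fun z hz => by rw [mem_sphere_zero_iff_norm] at hz; exact ⟨by linarith, by linarith⟩
    have hn : ∀ z ∈ sphere (0:ℂ) ρ, z ≠ z0 := fun z hz h => by rw [mem_sphere_zero_iff_norm, h] at hz; exact hρ3 hz.symm
    rw [JJ, circleIntegral.integral_congr hρ0.le (fun z hz => hint z (hA z hz) (hn z hz))]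
    have e1 : (∮ z in C(0, ρ), -(dslope k z0 z + k z0 * (z - z0)⁻¹)) = -∮ z in C(0, ρ), (dslope k z0 z + k z0 * (z - z0)⁻¹) := by
      have := circleIntegral.integral_smul (-1:ℂ) (fun z => dslope k z0 z + k z0 * (z - z0)⁻¹) 0 ρ
      simpa using this
    rw [e1, circleIntegral.integral_add (f := dslope k z0) (g := fun z => k z0 * (z - z0)⁻¹), circleIntegral.integral_const_mul]
    · ring
    · exact (hDd.continuousOn.mono hA).circleIntegrable hρ0.le
    · refine ContinuousOn.circleIntegrable hρ0.le ?_
      exact continuousOn_const.mul ((continuousOn_id.sub continuousOn_const).inv₀ fun z hz => sub_ne_zero.2 (hn z hz))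
  have hAA : closedBall (0:ℂ) ρ2 \ ball 0 ρ1 ⊆ Ann r R := by
    rintro z ⟨hz, hz'⟩
    rw [mem_closedBall_zero_iff] at hz
    rw [mem_ball_zero_iff, not_lt] at hz'
    exact ⟨by linarith, by linarith⟩
  have heq : (∮ z in C(0, ρ2), dslope k z0 z) = ∮ z in C(0, ρ1), dslope k z0 z :=
    Complex.circleIntegral_eq_of_differentiable_on_annulus_off_countable (by linarith) (by linarith) countable_empty
      (hDd.continuousOn.mono hAA) (fun z hz => hDd.differentiableAt ((Ann_open r R).mem_nhds
        (hAA ⟨ball_subset_closedBall hz.1.1, fun h => hz.1.2 (ball_subset_closedBall h)⟩)))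
  have hin : (∮ z in C(0, ρ1), (z - z0)⁻¹) = 0 := by
    have hn : ∀ z ∈ closedBall (0:ℂ) ρ1, z - z0 ≠ 0 := fun z hz h => by
      rw [mem_closedBall_zero_iff, sub_eq_zero.1 h] at hz; linarith
    refine Complex.circleIntegral_eq_zero_of_differentiable_on_off_countable (by linarith) countable_empty ?_ ?_
    · exact (continuousOn_id.sub continuousOn_const).inv₀ hn
    · intro z hz
      exact (differentiableAt_id.sub_const z0).inv (hn z (ball_subset_closedBall hz.1))
  have hout : (∮ z in C(0, ρ2), (z - z0)⁻¹) = 2 * Real.pi * Complex.I := circleIntegral.integral_sub_inv_of_mem_ball (by simpa using hz2)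
  rw [hcirc ρ1 h1 (by linarith) hz1.ne, hcirc ρ2 (by linarith) h2 hz2.ne', heq, hin, hout, hkz0]
  have hpi : (2 * Real.pi * Complex.I : ℂ) ≠ 0 := Complex.two_pi_I_ne_zero
  field_simp; ring

lemma claimA (hf : Uni f R) (hr0 : 0 < r) (hG : DifferentiableOn ℂ G (Dual f r)) {ρ : ℝ} (h1 : r < ρ) (h2 : ρ < R)
    {v : ℂ} (hv : v ∈ Dual f ρ) : JJ (aG f G) f ρ v = G v := by
  classical
  have hrR : r < R := by linarith
  obtain ⟨ρ2, h3, h4⟩ := exists_between h2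
  have hA : ∀ ρ', r < ρ' → ρ' < R → ∀ z ∈ sphere (0:ℂ) ρ', z ∈ Ann r R := fun ρ' ha hb z hz => by
    rw [mem_sphere_zero_iff_norm] at hz; exact ⟨by linarith, by linarith⟩
  have ca : ∀ ρ', r < ρ' → ρ' < R → ContinuousOn (aG f G) (sphere 0 ρ') := fun ρ' ha hb z hz =>
    (aG_dif hf hr0 hrR hG (hA ρ' ha hb z hz)).continuousAt.continuousWithinAt
  have cf' : ∀ ρ', r < ρ' → ρ' < R → ContinuousOn f (sphere 0 ρ') := fun ρ' ha hb z hz =>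
    (hf.at (hA ρ' ha hb z hz).2).continuousAt.continuousWithinAt
  set J1 := JJ (aG f G) f ρ with hJ1
  set J2 := JJ (aG f G) f ρ2 with hJ2
  set H : ℂ → ℂ := fun v => if v ∈ Dual f ρ then G v - J1 v else -J2 v with hH
  set N : Set ℂ := {v | v ≠ 0 ∧ v⁻¹ ∈ f '' ball 0 ρ2} with hN
  have hNo : IsOpen N := by
    have ho : IsOpen (f '' ball 0 ρ2) := inj_open isOpen_ball (hf.dif.mono (ball_subset_ball h4.le)) (hf.inj.mono (ball_subset_ball h4.le))
    exact (continuousOn_inv₀ (G₀ := ℂ)).isOpen_inter_preimage isOpen_compl_singleton ho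
  have hHN : ∀ v ∈ N, H v = -J2 v := by
    rintro v ⟨hv0, z0, hz0, hzv⟩
    rw [mem_ball_zero_iff] at hz0
    simp only [hH]
    split_ifs with hd
    · have hlt : ρ < ‖z0‖ := by
        by_contra hcon
        exact hd z0 (not_lt.1 hcon) (by rw [hzv, mul_inv_cancel₀ hv0])
      have := JJ_diff hf hr0 hG h1 h4 hlt hz0
      rw [hzv, inv_inv] at this
      rw [← this, hJ1, hJ2]; ring
    · rfl
  have hND : ∀ v, v ∉ Dual f ρ → v ∈ N := by
    intro v hv
    simp only [Dual, mem_ofPred_eq, not_forall, not_not] at hv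
    obtain ⟨z, hz, hvz⟩ := hv
    refine ⟨left_ne_zero_of_mul_eq_one hvz, z, by rw [mem_ball_zero_iff]; linarith, ?_⟩
    exact eq_inv_of_mul_eq_one_right hvz
  have hHd : Differentiable ℂ H := by
    intro v
    by_cases hv : v ∈ Dual f ρ
    · have e : H =ᶠ[𝓝 v] fun v => G v - J1 v := by
        filter_upwards [(dual_open hf h2).mem_nhds hv] with u hu
        simp only [hH, if_pos hu]
      rw [e.differentiableAt_iff]
      exact (hG.differentiableAt ((dual_open hf hrR).mem_nhds (dual_anti h1.le hv))).sub
        (JJ_dif (by linarith) (ca ρ h1 h2) (cf' ρ h1 h2) fun z hz => hv z hz.le)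
    · have e : H =ᶠ[𝓝 v] fun v => -J2 v := by
        filter_upwards [hNo.mem_nhds (hND v hv)] with u hu
        exact hHN u hu
      rw [e.differentiableAt_iff]
      refine (JJ_dif (by linarith) (ca ρ2 (by linarith) h4) (cf' ρ2 (by linarith) h4) fun z hz hvz => ?_).neg
      obtain ⟨hv0, z0, hz0, hzv⟩ := hND v hv
      rw [mem_ball_zero_iff] at hz0
      have : f z = f z0 := by rw [hzv]; exact eq_inv_of_mul_eq_one_right hvz
      have := hf.eq (by linarith) (by linarith) this
      rw [this] at hz; linarith
  obtain ⟨B, hB0, hB⟩ := dual_bdd hf (by linarith : 0 < ρ) h2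
  have hH0 : Tendsto H (cocompact ℂ) (𝓝 0) := by
    have t := (JJ_tendsto (a := aG f G) (f := f) (by linarith : 0 < ρ2) (ca ρ2 (by linarith) h4) (cf' ρ2 (by linarith) h4)
      (fun z hz => hf.nz (by linarith) (by rintro rfl; rw [norm_zero] at hz; linarith))).neg
    rw [neg_zero] at t
    refine t.congr' ?_
    filter_upwards [(isCompact_closedBall (0:ℂ) B).compl_mem_cocompact] with u hu
    simp only [hH]
    rw [if_neg (fun h => hu (ball_subset_closedBall (hB h)))]
  have := hHd.apply_eq_of_tendsto_cocompact v hH0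
  simp only [hH, if_pos hv] at this
  exact (sub_eq_zero.1 this).symm
end DB

namespace DB
open Metric Filter Topology Set MeasureTheory
variable {f G : ℂ → ℂ} {R r : ℝ}

lemma dual_union (hf : Uni f R) (hr0 : 0 < r) (hr : r < R) {v : ℂ} (hv : v ∈ Dual f r) : ∃ ρ, r < ρ ∧ ρ < R ∧ v ∈ Dual f ρ := by
  by_cases h : ∃ z, ‖z‖ < R ∧ v * f z = 1
  · obtain ⟨z, hz, hvz⟩ := h
    have hrz : r < ‖z‖ := by
      by_contra hc
      exact hv z (not_lt.1 hc) hvz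
    obtain ⟨ρ, h1, h2⟩ := exists_between hrz
    refine ⟨ρ, h1, h2.trans hz, fun w hw hvw => ?_⟩
    have hv0 := left_ne_zero_of_mul_eq_one hvz
    have : f w = f z := mul_left_cancel₀ hv0 (hvw.trans hvz.symm)
    have := hf.eq (by linarith) hz this
    rw [this] at hw; linarith
  · push Not at h
    obtain ⟨ρ, h1, h2⟩ := exists_between hr
    exact ⟨ρ, h1, h2, fun w hw => h w (by linarith)⟩

lemma Ann_conn (hr0 : 0 < r) : IsPreconnected (Ann r R) := by
  by_cases hR : 0 < R
  · have hc : Convex ℝ {w : ℂ | Real.log r < w.re ∧ w.re < Real.log R} :=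
      (convex_halfSpace_re_gt _).inter (convex_halfSpace_re_lt _)
    have := hc.isPreconnected.image Complex.exp Complex.continuous_exp.continuousOn
    convert this using 1
    ext z
    constructor
    · intro hz
      refine ⟨Complex.log z, ?_, Complex.exp_log (Ann_ne hr0 hz)⟩
      simp only [mem_ofPred_eq, Complex.log_re]
      exact ⟨Real.log_lt_log hr0 hz.1, Real.log_lt_log (hr0.trans hz.1) hz.2⟩
    · rintro ⟨w, ⟨h1, h2⟩, rfl⟩
      simp only [Ann, mem_ofPred_eq, Complex.norm_exp]
      exact ⟨(Real.log_lt_iff_lt_exp hr0).1 h1, (Real.lt_log_iff_exp_lt hR).1 h2⟩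
  · have : Ann r R = ∅ := by
      ext z; simp only [Ann, mem_ofPred_eq, mem_empty_iff_false, iff_false]; intro h; linarith [h.1, h.2]
    rw [this]; exact isPreconnected_empty

lemma JJ_congr {a b : ℂ → ℂ} {ρ : ℝ} (hρ : 0 < ρ) (h : ∀ z, ‖z‖ = ρ → a z = b z) (v : ℂ) : JJ a f ρ v = JJ b f ρ v := by
  rw [JJ, JJ, circleIntegral.integral_congr hρ.le]
  intro z hz
  simp only [h z (by simpa using hz)]

lemma dual_conn (hf : Uni f R) (hr0 : 0 < r) (hr : r < R) : IsPreconnected (Dual f r) := by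
  classical
  apply isPreconnected_of_forall_constant
  intro χ hχ
  obtain ⟨ρ0, h1, h2⟩ := exists_between hr
  set z0 : ℂ := (ρ0 : ℂ) with hz0
  have hn0 : ‖z0‖ = ρ0 := by simp [hz0, abs_of_pos (hr0.trans h1)]
  have hz0A : z0 ∈ Ann r R := ⟨by rw [hn0]; exact h1, by rw [hn0]; exact h2⟩
  have hinv : ContinuousOn (fun z => (f z)⁻¹) (Ann r R) := fun z hz =>
    ((hf.at hz.2).continuousAt.inv₀ (hf.nz hz.2 (Ann_ne hr0 hz))).continuousWithinAt
  have hcol : ∀ z ∈ Ann r R, χ (f z)⁻¹ = χ (f z0)⁻¹ := by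
    intro z hz
    have hco : ContinuousOn (fun z => χ (f z)⁻¹) (Ann r R) := hχ.comp hinv fun z hz => collar hf hr0 hz
    exact (Ann_conn hr0).constant hco hz hz0A
  set G : ℂ → ℂ := fun v => if χ v = true then 1 else 0 with hG
  set c : ℂ := if χ (f z0)⁻¹ = true then 1 else 0 with hc
  have hGd : DifferentiableOn ℂ G (Dual f r) := by
    intro v hv
    have hca : ContinuousAt χ v := hχ.continuousAt ((dual_open hf hr).mem_nhds hv)
    have he : ∀ᶠ u in 𝓝 v, χ u = χ v := by
      have := hca.eventually (p := fun b => b = χ v) (by rw [nhds_discrete]; simp)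
      exact this
    have : G =ᶠ[𝓝 v] fun _ => G v := by
      filter_upwards [he] with u hu
      simp only [hG, hu]
    exact (this.differentiableAt_iff.2 (differentiableAt_const _)).differentiableWithinAt
  have key : ∀ v ∈ Dual f r, χ v = χ (f z0)⁻¹ := by
    intro v hv
    obtain ⟨ρ, ha, hb, hvρ⟩ := dual_union hf hr0 hr hv
    have e1 := claimA hf hr0 hGd ha hb hvρ
    have e2 := claimA (G := fun _ => c) hf hr0 (differentiableOn_const c) ha hb hvρ
    have e3 : JJ (aG f G) f ρ v = JJ (aG f (fun _ => c)) f ρ v := by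
      apply JJ_congr (hr0.trans ha)
      intro z hz
      simp only [aG, hG, hc, hcol z ⟨by linarith, by linarith⟩]
    rw [e1, e2] at e3
    simp only [hG, hc] at e3
    cases h1 : χ v <;> cases h2 : χ (f z0)⁻¹ <;> simp_all
  intro x hx y hy
  rw [key x hx, key y hy]

lemma prim (hf : Uni f R) (hr0 : 0 < r) (hG : DifferentiableOn ℂ G (Dual f r)) {ρ : ℝ} (h1 : r < ρ) (h2 : ρ < R) :
    ∃ P : ℂ → ℂ, P 0 = 0 ∧ ∀ v ∈ Dual f ρ, HasDerivAt P (G v) v := by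
  have hrR : r < R := by linarith
  have hρ0 : 0 < ρ := by linarith
  have hA : ∀ z ∈ sphere (0:ℂ) ρ, z ∈ Ann r R := fun z hz => by
    rw [mem_sphere_zero_iff_norm] at hz; exact ⟨by linarith, by linarith⟩
  have ca : ContinuousOn (aG f G) (sphere 0 ρ) := fun z hz =>
    (aG_dif hf hr0 hrR hG (hA z hz)).continuousAt.continuousWithinAt
  have cf' : ContinuousOn f (sphere 0 ρ) := fun z hz => (hf.at (hA z hz).2).continuousAt.continuousWithinAt
  have cdf : ContinuousOn (deriv f) (sphere 0 ρ) := fun z hz =>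
    ((hf.dif.deriv isOpen_ball).differentiableAt (isOpen_ball.mem_nhds (by simpa using (hA z hz).2))).continuousAt.continuousWithinAt
  set γ := circleMap 0 ρ with hγ
  have hγn : ∀ θ, ‖γ θ‖ = ρ := circ_norm hρ0
  have hγA : ∀ θ, γ θ ∈ Ann r R := fun θ => hA _ (by simpa using hγn θ)
  set F : ℝ → ℂ := fun θ => f (γ θ) with hF
  set F' : ℝ → ℂ := fun θ => deriv f (γ θ) * deriv γ θ with hF'
  have hFc : Continuous F := comp_circ hρ0 cf'
  have hF'c : Continuous F' := (comp_circ hρ0 cdf).mul (dcirc ρ)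
  have hF0 : ∀ θ, F θ ≠ 0 := fun θ => hf.nz (hγA θ).2 (Ann_ne hr0 (hγA θ))
  have hFd : ∀ θ, HasDerivAt F (F' θ) θ := by
    intro θ
    have a1 := (hf.at (hγA θ).2).hasDerivAt
    have a2 : HasDerivAt γ (deriv γ θ) θ := (differentiable_circleMap 0 ρ θ).hasDerivAt
    exact a1.comp θ a2
  set w : ℝ → ℂ := fun θ => deriv γ θ * aG f G (γ θ) / F θ with hw
  have hwc : Continuous w := ((dcirc ρ).mul (comp_circ hρ0 ca)).div₀ hFc hF0
  set W : ℝ → ℂ := fun θ => ∫ t in (0:ℝ)..θ, w t with hW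
  have hWd : ∀ θ, HasDerivAt W (w θ) θ := fun θ => hwc.integral_hasStrictDerivAt 0 θ |>.hasDerivAt
  have hWc : Continuous W := continuous_iff_continuousAt.2 fun θ => (hWd θ).continuousAt
  have hW0 : W 0 = 0 := by simp [hW]
  have hpi : (2 * Real.pi * Complex.I : ℂ) ≠ 0 := Complex.two_pi_I_ne_zero
  have hW1 : W (2 * Real.pi) = 0 := by
    have e := claimA (G := fun v => v * G v) hf hr0 (differentiableOn_id.mul hG) h1 h2 (v := 0) dual_zero
    rw [JJ_eq, zero_mul] at e
    have e2 := (mul_eq_zero.1 e).resolve_left (inv_ne_zero hpi)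
    rw [← e2]
    simp only [hW]
    apply intervalIntegral.integral_congr
    intro θ _
    rw [← hγ]
    simp only [hw, aG, hF, zero_mul, sub_zero, div_one]
    have := hF0 θ; simp only [hF] at this
    field_simp
  refine ⟨fun v => -(2 * Real.pi * Complex.I)⁻¹ * (v * ∫ θ in (0:ℝ)..(2 * Real.pi), W θ * F' θ / (1 - v * F θ)), by simp, ?_⟩
  intro v hv
  have hv' : ∀ θ, v * F θ ≠ 1 := fun θ => hv _ (hγn θ).le
  have hv1 : ∀ θ, 1 - v * F θ ≠ 0 := fun θ => sub_ne_zero.2 (hv' θ).symm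
  have d1 := par_deriv (a := fun θ => W θ * F' θ) (hWc.mul hF'c) hFc hv'
  have d2 := ((hasDerivAt_id v).mul d1).const_mul (-(2 * Real.pi * Complex.I)⁻¹)
  refine d2.congr_deriv ?_
  have hdc : Continuous fun θ => 1 - v * F θ := continuous_const.sub (continuous_const.mul hFc)
  have i1 : Continuous fun θ => W θ * F' θ / (1 - v * F θ) := (hWc.mul hF'c).div₀ hdc hv1
  have i2 : Continuous fun θ => v * (W θ * F' θ * F θ / (1 - v * F θ)^2) :=
    continuous_const.mul (((hWc.mul hF'c).mul hFc).div₀ (hdc.pow 2) fun θ => pow_ne_zero 2 (hv1 θ))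
  have e1 : (∫ θ in (0:ℝ)..(2 * Real.pi), W θ * F' θ / (1 - v * F θ)) + v * (∫ θ in (0:ℝ)..(2 * Real.pi), W θ * F' θ * F θ / (1 - v * F θ)^2)
      = ∫ θ in (0:ℝ)..(2 * Real.pi), W θ * (F' θ / (1 - v * F θ)^2) := by
    rw [← intervalIntegral.integral_const_mul, ← intervalIntegral.integral_add (i1.intervalIntegrable _ _) (i2.intervalIntegrable _ _)]
    apply intervalIntegral.integral_congr
    intro θ _
    have := hv1 θ
    simp only
    field_simp; ring
  have hq : ∀ θ, HasDerivAt (fun θ => F θ / (1 - v * F θ)) (F' θ / (1 - v * F θ)^2) θ := by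
    intro θ
    have := (hFd θ).div (((hFd θ).const_mul v).const_sub 1) (hv1 θ)
    refine this.congr_deriv ?_
    congr 1; ring
  have e2 := intervalIntegral.integral_mul_deriv_eq_deriv_mul (a := 0) (b := 2 * Real.pi) (fun θ _ => hWd θ) (fun θ _ => hq θ) (hwc.intervalIntegrable _ _)
    ((hF'c.div₀ (hdc.pow 2) fun θ => pow_ne_zero 2 (hv1 θ)).intervalIntegrable _ _)
  have e3 := claimA hf hr0 hG h1 h2 hv
  have e4 : (∫ θ in (0:ℝ)..(2 * Real.pi), w θ * (F θ / (1 - v * F θ))) = ∫ θ in (0:ℝ)..(2 * Real.pi),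
      (deriv (circleMap 0 ρ) θ * aG f G (circleMap 0 ρ θ)) / (1 - v * f (circleMap 0 ρ θ)) := by
    apply intervalIntegral.integral_congr
    intro θ _
    have a1 := hv1 θ
    have a2 := hF0 θ
    simp only [hw]
    change _ = deriv γ θ * aG f G (γ θ) / (1 - v * F θ)
    field_simp
  rw [JJ_eq] at e3
  simp only at e3
  rw [← e4] at e3
  rw [hW0, hW1] at e2
  simp only [id, one_mul]
  rw [e1, e2, ← e3]
  ring

lemma dual_HP (hf : Uni f R) (hr0 : 0 < r) (hr : r < R) : HP (Dual f r) := by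
  classical
  intro G hG
  have hP : ∀ ρ, ∃ P : ℂ → ℂ, r < ρ → ρ < R → P 0 = 0 ∧ ∀ v ∈ Dual f ρ, HasDerivAt P (G v) v := by
    intro ρ
    by_cases h : r < ρ ∧ ρ < R
    · obtain ⟨P, hP⟩ := prim hf hr0 hG h.1 h.2
      exact ⟨P, fun _ _ => hP⟩
    · exact ⟨0, fun a b => absurd ⟨a, b⟩ h⟩
  choose P hP using hP
  have hρ : ∀ v, ∃ ρ, v ∈ Dual f r → r < ρ ∧ ρ < R ∧ v ∈ Dual f ρ := by
    intro v
    by_cases h : v ∈ Dual f r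
    · obtain ⟨ρ, h⟩ := dual_union hf hr0 hr h
      exact ⟨ρ, fun _ => h⟩
    · exact ⟨0, fun a => absurd a h⟩
  choose ρ hρ using hρ
  have heq : ∀ a b, r < a → a ≤ b → b < R → ∀ v ∈ Dual f b, P a v = P b v := by
    intro a b ha hab hb v hv
    have hsub : Dual f b ⊆ Dual f a := dual_anti hab
    have pa := hP a ha (by linarith)
    have pb := hP b (by linarith) hb
    refine (dual_open hf hb).eqOn_of_deriv_eq (dual_conn hf (by linarith) hb) ?_ ?_ ?_ dual_zero (by rw [pa.1, pb.1]) hv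
    · exact fun u hu => (pa.2 u (hsub hu)).differentiableAt.differentiableWithinAt
    · exact fun u hu => (pb.2 u hu).differentiableAt.differentiableWithinAt
    · intro u hu
      rw [(pa.2 u (hsub hu)).deriv, (pb.2 u hu).deriv]
  refine ⟨fun v => P (ρ v) v, fun v hv => ?_⟩
  obtain ⟨h1, h2, h3⟩ := hρ v hv
  refine ((hP _ h1 h2).2 v h3).congr_of_eventuallyEq ?_
  filter_upwards [(dual_open hf h2).mem_nhds h3] with u hu
  obtain ⟨k1, k2, k3⟩ := hρ u (dual_anti h1.le hu)
  rcases le_total (ρ u) (ρ v) with h | h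
  · exact heq _ _ k1 h h2 u hu
  · exact (heq _ _ h1 h k2 u k3).symm

lemma dual_riemann (hf : Uni f R) (hr0 : 0 < r) (hr : r < R) : ∃ h e ρ, RM (Dual f r) h e ρ := by
  obtain ⟨B, _, hB⟩ := dual_bdd hf hr0 hr
  exact riemann (dual_open hf hr) (dual_conn hf hr0 hr) (dual_HP hf hr0 hr) dual_zero hB
end DB

namespace DB
open Metric Filter Topology Set MeasureTheory

lemma RM.lift {Ω : Set ℂ} {h e F : ℂ → ℂ} {ρ m : ℝ} (H : RM Ω h e ρ) (hF : Hol F) (hm : ∀ z, ‖z‖ < 1 → F z ∈ Ω)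
    (hF0 : F 0 = 0) (hd : deriv F 0 = (m:ℂ)) :
    Hol (fun z => h (F z)) ∧ (∀ z ∈ ball (0:ℂ) 1, h (F z) ∈ ball (0:ℂ) 1) ∧ (∀ z ∈ ball (0:ℂ) 1, F z = e (h (F z))) ∧ m ≤ ρ := by
  have h1 : Hol (fun z => h (F z)) := H.hd.comp hF fun z hz => hm z (by simpa using hz)
  have h2 : ∀ z ∈ ball (0:ℂ) 1, h (F z) ∈ ball (0:ℂ) 1 := fun z hz => by
    rw [mem_ball_zero_iff]; exact H.hmap _ (hm z (by simpa using hz))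
  have h3 : ∀ z ∈ ball (0:ℂ) 1, F z = e (h (F z)) := fun z hz => (H.eh _ (hm z (by simpa using hz))).symm
  refine ⟨h1, h2, h3, ?_⟩
  have hb : ball (0:ℂ) 1 ∈ 𝓝 (0:ℂ) := ball_mem_nhds 0 one_pos
  have e0 : h (F 0) = 0 := by rw [hF0, H.h0]
  have d1 : DifferentiableAt ℂ (fun z => h (F z)) 0 := h1.differentiableAt hb
  have d2 : DifferentiableAt ℂ e (h (F 0)) := by rw [e0]; exact H.ed.differentiableAt hb
  have hD : deriv F 0 = deriv e 0 * deriv (fun z => h (F z)) 0 := by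
    have e1 : F =ᶠ[𝓝 0] e ∘ (fun z => h (F z)) := by filter_upwards [hb] with z hz; exact h3 z hz
    rw [e1.deriv_eq, deriv_comp 0 d2 d1, e0]
  have hs : ‖deriv (fun z => h (F z)) 0‖ ≤ 1 := Complex.norm_deriv_le_one_of_mapsTo_ball h1 (by
    intro z hz
    simp only [e0]
    exact ball_subset_closedBall (h2 z hz)) one_pos
  rw [hd, H.der] at hD
  have hn : |m| = ρ * ‖deriv (fun z => h (F z)) 0‖ := by
    have := congrArg norm hD
    rwa [norm_mul, Complex.norm_real, Complex.norm_real, Real.norm_eq_abs, Real.norm_eq_abs, abs_of_pos H.pos] at this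
  have := H.pos
  calc m ≤ |m| := le_abs_self m
    _ ≤ ρ * 1 := by rw [hn]; gcongr
    _ = ρ := mul_one ρ

lemma RM.uni {Ω : Set ℂ} {h e : ℂ → ℂ} {ρ : ℝ} (H : RM Ω h e ρ) : Uni e 1 where
  dif := H.ed
  inj := by
    intro x hx y hy hxy
    rw [← H.he x (by simpa using hx), ← H.he y (by simpa using hy), hxy]
  zero := H.e0

lemma RM_ball {s : ℝ} (hs : 0 < s) : RM (ball 0 s) (fun z => z / s) (fun z => s * z) s := by
  have h0 : (s:ℂ) ≠ 0 := by exact_mod_cast hs.ne'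
  refine ⟨by fun_prop, ?_, by unfold Hol; fun_prop, ?_, ?_, ?_, by simp, by simp, ?_, hs⟩
  · intro z hz
    rw [mem_ball_zero_iff] at hz
    rw [norm_div, Complex.norm_real, Real.norm_eq_abs, abs_of_pos hs, div_lt_one hs]; exact hz
  · intro z hz
    rw [mem_ball_zero_iff, norm_mul, Complex.norm_real, Real.norm_eq_abs, abs_of_pos hs]
    nlinarith
  · intro z _; field_simp
  · intro z _; field_simp
  · rw [deriv_const_mul _ differentiableAt_id]; simp

lemma RM_image {f : ℂ → ℂ} {R s : ℝ} (hf : Uni f R) (hd : deriv f 0 = 1) (hs : 0 < s) (hsR : s < R) :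
    ∃ h e, RM (f '' ball 0 s) h e s := by
  have h0 : (s:ℂ) ≠ 0 := by exact_mod_cast hs.ne'
  obtain ⟨g, hg, hgd⟩ := exists_inv isOpen_ball (hf.dif.mono (ball_subset_ball hsR.le)) (hf.inj.mono (ball_subset_ball hsR.le))
  have hsz : ∀ z : ℂ, ‖z‖ < 1 → ‖(s:ℂ) * z‖ < s := fun z hz => by
    rw [norm_mul, Complex.norm_real, Real.norm_eq_abs, abs_of_pos hs]; nlinarith
  refine ⟨fun v => g v / s, fun z => f (s * z), by fun_prop, ?_, ?_, ?_, ?_, ?_, ?_, ?_, ?_, hs⟩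
  · rintro _ ⟨z, hz, rfl⟩
    rw [hg z hz]
    rw [mem_ball_zero_iff] at hz
    rw [norm_div, Complex.norm_real, Real.norm_eq_abs, abs_of_pos hs, div_lt_one hs]; exact hz
  · intro z hz
    have := hsz z (by simpa using hz)
    exact ((hf.at (this.trans hsR)).comp z (differentiableAt_id.const_mul (s:ℂ))).differentiableWithinAt
  · intro z hz
    exact ⟨s * z, by simpa using hsz z hz, rfl⟩
  · rintro _ ⟨z, hz, rfl⟩
    rw [hg z hz]; congr 1; field_simp
  · intro z hz
    rw [hg _ (by simpa using hsz z hz)]; field_simp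
  · have := hg 0 (by simpa using hs)
    rw [hf.zero] at this
    rw [this, zero_div]
  · rw [mul_zero, hf.zero]
  · have h1 : DifferentiableAt ℂ f ((s:ℂ) * 0) := by rw [mul_zero]; exact hf.at (by rw [norm_zero]; linarith)
    have h2 := h1.hasDerivAt.comp (0:ℂ) ((hasDerivAt_id (0:ℂ)).const_mul (s:ℂ))
    have h3 := h2.deriv
    rw [mul_zero, hd] at h3
    simpa [Function.comp_def] using h3

/-- first step -/
lemma first_step {f h e : ℂ → ℂ} {R b s : ℝ} (hf : Uni f R) (hd : deriv f 0 = 1) (hs : 1 < s) (hsR : s < R)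
    (hE : RM (Dual f 1) h e b) : ∃ r1 < 1, ∀ r, r1 ≤ r → ∀ h' e' ρ, RM (Dual e r) h' e' ρ → ρ ≤ s := by
  set K : Set ℂ := {v | ∀ z : ℂ, ‖z‖ < s → v * f z ≠ 1} with hK
  have hKE : K ⊆ Dual f 1 := fun v hv z hz => hv z (by linarith)
  have hKc : IsClosed K := by
    have : Kᶜ = {v | v ≠ 0 ∧ v⁻¹ ∈ f '' ball 0 s} := by
      ext v
      simp only [hK, mem_compl_iff, mem_ofPred_eq, not_forall, not_not]
      constructor
      · rintro ⟨z, hz, hv⟩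
        exact ⟨left_ne_zero_of_mul_eq_one hv, z, by simpa using hz, eq_inv_of_mul_eq_one_right hv⟩
      · rintro ⟨hv, z, hz, hzv⟩
        exact ⟨z, by simpa using hz, by rw [hzv, mul_inv_cancel₀ hv]⟩
    rw [← isOpen_compl_iff, this]
    have ho : IsOpen (f '' ball 0 s) := inj_open isOpen_ball (hf.dif.mono (ball_subset_ball hsR.le)) (hf.inj.mono (ball_subset_ball hsR.le))
    exact (continuousOn_inv₀ (G₀ := ℂ)).isOpen_inter_preimage isOpen_compl_singleton ho
  obtain ⟨B, _, hB⟩ := dual_bdd hf one_pos (hs.trans hsR)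
  have hKcomp : IsCompact K := Metric.isCompact_of_isClosed_isBounded hKc (isBounded_ball.subset (hKE.trans hB))
  obtain ⟨v0, hv0, hmax⟩ := hKcomp.exists_isMaxOn ⟨0, fun z _ => by simp⟩ (hE.hd.continuousOn.mono hKE).norm
  refine ⟨‖h v0‖, hE.hmap _ (hKE hv0), fun r hr h' e' ρ hRM => ?_⟩
  have hsub : Dual e r ⊆ f '' ball 0 s := by
    intro v hv
    by_contra hc
    have hvK : v⁻¹ ∈ K := by
      intro z hz hvz
      have hv0 : v ≠ 0 := by rintro rfl; simp at hvz
      exact hc ⟨z, by simpa using hz, by field_simp at hvz; exact hvz⟩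
    have h1 : ‖h v⁻¹‖ ≤ ‖h v0‖ := hmax hvK
    have hv0 : v ≠ 0 := by rintro rfl; exact hc ⟨0, by simp; linarith, hf.zero⟩
    refine hv (h v⁻¹) (h1.trans hr) ?_
    rw [hE.eh _ (hKE hvK), mul_inv_cancel₀ hv0]
  obtain ⟨h2, e2, hI⟩ := RM_image hf hd (by linarith) hsR
  exact (hI.lift hRM.ed (fun z hz => hsub (hRM.emap z hz)) hRM.e0 hRM.der).2.2.2

lemma near_zero {e : ℂ → ℂ} {b c : ℝ} (he : DifferentiableAt ℂ e 0) (h0 : e 0 = 0) (hd : deriv e 0 = (b:ℂ)) (hb : 0 < b) (hc : 1 < c) :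
    ∀ᶠ z in 𝓝 (0:ℂ), ‖e z‖ ≤ c * b * ‖z‖ ∧ b * ‖z‖ ≤ c * ‖e z‖ := by
  have h1 := he.hasDerivAt
  rw [hd, hasDerivAt_iff_isLittleO] at h1
  have hk : 0 < b * (1 - c⁻¹) := by
    have : c⁻¹ < 1 := inv_lt_one_of_one_lt₀ hc
    exact mul_pos hb (by linarith)
  filter_upwards [h1.def hk] with z hz
  simp only [h0, sub_zero, smul_eq_mul] at hz
  have hzb : ‖z * b‖ = b * ‖z‖ := by rw [norm_mul, Complex.norm_real, Real.norm_eq_abs, abs_of_pos hb, mul_comm]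
  have t1 : ‖e z‖ ≤ ‖e z - z * b‖ + ‖z * b‖ := by have := norm_add_le (e z - z * b) (z * b); rwa [sub_add_cancel] at this
  have t2 : ‖z * b‖ ≤ ‖e z‖ + ‖e z - z * b‖ := by
    have := norm_sub_le (e z) (e z - z * b); rwa [sub_sub_cancel] at this
  rw [hzb] at t1 t2
  have hci : c * c⁻¹ = 1 := mul_inv_cancel₀ (by linarith)
  have hb1 : 0 ≤ b * ‖z‖ := by positivity
  constructor
  · have : 1 + (1 - c⁻¹) ≤ c := by nlinarith [inv_pos.2 (by linarith : 0 < c)]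
    calc ‖e z‖ ≤ (1 + (1 - c⁻¹)) * (b * ‖z‖) := by linarith
      _ ≤ c * (b * ‖z‖) := by gcongr
      _ = _ := by ring
  · have : c⁻¹ * (b * ‖z‖) ≤ ‖e z‖ := by linarith
    calc b * ‖z‖ = c * (c⁻¹ * (b * ‖z‖)) := by rw [← mul_assoc, hci, one_mul]
      _ ≤ c * ‖e z‖ := by gcongr

lemma end_step {f h e : ℂ → ℂ} {R b δ : ℝ} (hf : Uni f R) (hR : 1 < R) (hE : RM (Dual f 1) h e b) (hδ : 0 < δ) :
    ∃ r, 0 < r ∧ r < 1/2 ∧ ∀ h' e' ρ, RM (Dual e r) h' e' ρ → ∀ z ∈ ball (0:ℂ) 1, ‖e' z‖ ≤ Real.exp δ * ρ := by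
  set c := Real.exp (δ/2) with hc
  have hc1 : 1 < c := Real.one_lt_exp_iff.2 (by linarith)
  have hb := hE.pos
  have hn := near_zero (hE.ed.differentiableAt (ball_mem_nhds 0 one_pos)) hE.e0 hE.der hb hc1
  have hEo : Dual f 1 ∈ 𝓝 (0:ℂ) := (dual_open hf hR).mem_nhds dual_zero
  have hh : Tendsto h (𝓝 0) (𝓝 0) := by
    have := (hE.hd.differentiableAt hEo).continuousAt.tendsto
    rwa [hE.h0] at this
  obtain ⟨s1, hs1, H1⟩ := Metric.eventually_nhds_iff_ball.1 hn
  obtain ⟨s2, hs2, H2⟩ := Metric.eventually_nhds_iff_ball.1 ((hh.eventually hn).and hEo)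
  obtain ⟨r, hr0, hr⟩ := exists_between (show 0 < min (min s1 (1/2)) (s2 * c / b) by positivity)
  have hr1 : r < s1 := hr.trans_le ((min_le_left _ _).trans (min_le_left _ _))
  have hr2 : r < 1/2 := hr.trans_le ((min_le_left _ _).trans (min_le_right _ _))
  have hr3 : r < s2 * c / b := hr.trans_le (min_le_right _ _)
  refine ⟨r, hr0, hr2, fun h' e' ρ hRM z hz => ?_⟩
  have hlow : 1 / (c * b * r) ≤ ρ := by
    have hp : 0 < 1 / (c * b * r) := by positivity
    have hBR := RM_ball hp
    refine (hRM.lift hBR.ed (fun z hz => ?_) hBR.e0 hBR.der).2.2.2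
    intro ξ hξ hv
    have h1 := hBR.emap z hz
    rw [mem_ball_zero_iff] at h1
    have h2 := (H1 ξ (by rw [mem_ball_zero_iff]; linarith)).1
    have h3 : ‖((1 / (c * b * r) : ℝ) : ℂ) * z‖ * ‖e ξ‖ = 1 := by rw [← norm_mul, hv, norm_one]
    have h4 : ‖e ξ‖ ≤ c * b * r := h2.trans (by gcongr)
    have h5 : ‖((1 / (c * b * r) : ℝ) : ℂ) * z‖ * ‖e ξ‖ < 1 := by
      calc _ ≤ ‖((1 / (c * b * r) : ℝ) : ℂ) * z‖ * (c * b * r) := by gcongr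
        _ < 1 / (c * b * r) * (c * b * r) := by gcongr
        _ = 1 := by field_simp
    linarith
  have hup : ‖e' z‖ ≤ c / (b * r) := by
    by_contra hcon
    push Not at hcon
    set v := e' z with hv
    have hvD : v ∈ Dual e r := hRM.emap z (by simpa using hz)
    have hp : 0 < c / (b * r) := by positivity
    have hvn : 0 < ‖v‖ := hp.trans hcon
    have hv0 : v ≠ 0 := norm_pos_iff.1 hvn
    have h1 : ‖v⁻¹‖ < b * r / c := by
      rw [norm_inv, ← inv_div]
      exact inv_strictAnti₀ hp hcon
    have h2 : b * r / c < s2 := by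
      rw [lt_div_iff₀ hb] at hr3
      rw [div_lt_iff₀ (by linarith)]; linarith
    obtain ⟨⟨_, h3⟩, h4⟩ := H2 v⁻¹ (by rw [mem_ball_zero_iff]; linarith)
    rw [hE.eh _ h4] at h3
    refine hvD (h v⁻¹) ?_ (by rw [hE.eh _ h4, mul_inv_cancel₀ hv0])
    have h5 : c * ‖v⁻¹‖ < b * r := by
      rw [lt_div_iff₀ (by linarith)] at h1; linarith
    exact le_of_mul_le_mul_left (h3.trans h5.le) hb
  have hcc : Real.exp δ = c * c := by rw [hc, ← Real.exp_add]; congr 1; ring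
  calc ‖e' z‖ ≤ c / (b * r) := hup
    _ = Real.exp δ * (1 / (c * b * r)) := by rw [hcc]; field_simp
    _ ≤ Real.exp δ * ρ := by gcongr

end DB

namespace DB
open Metric Filter Topology Set MeasureTheory

lemma inner_compact {e : ℂ → ℂ} {r : ℝ} (he : Uni e 1) (hr0 : 0 < r) (hr : r < 1) {K : Set ℂ} (hK : IsCompact K) (hKD : K ⊆ Dual e r) :
    ∃ s, r < s ∧ s < 1 ∧ K ⊆ Dual e s := by
  have : Nonempty (Ioo r 1) := by obtain ⟨s, h⟩ := exists_between hr; exact ⟨⟨s, h⟩⟩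
  obtain ⟨s, hs⟩ := hK.elim_directed_cover (fun s : Ioo r 1 => Dual e s) (fun s => dual_open he s.2.2) (fun v hv => by
      obtain ⟨s, h1, h2, h3⟩ := dual_union he hr0 hr (hKD hv)
      exact mem_iUnion.2 ⟨⟨s, h1, h2⟩, h3⟩)
    (fun s t => by
      rcases le_total s t with h | h
      · exact ⟨s, Subset.rfl, dual_anti h⟩
      · exact ⟨t, dual_anti h, Subset.rfl⟩)
  exact ⟨s, s.2.1, s.2.2, hs⟩

lemma mid_kappa {e h' e' : ℂ → ℂ} {r ρ M B t lam : ℝ} {p : ℕ} (he : Uni e 1) (hr0 : 0 < r) (hrt : r < t) (ht : t < 1)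
    (hB : ∀ z, ‖z‖ < 1 → ‖e z‖ ≤ B) (hRM : RM (Dual e r) h' e' ρ) (hM : ∀ z ∈ Dual e r, ‖z‖ ≤ M)
    (hp : M * B * r ^ p ≤ t ^ p) (hl : 1 < lam) {ξ : ℂ} (h1 : r < ‖ξ‖) (h2 : ‖ξ‖ < t) :
    r ^ p ≤ lam * ‖ξ‖ ^ p * ‖h' (e ξ)⁻¹‖ := by
  have hr1 : r < 1 := by linarith
  have hA : ∀ z ∈ Ann r 1, h' (e z)⁻¹ ≠ 0 ∧ DifferentiableAt ℂ (fun z => h' (e z)⁻¹) z := by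
    intro z hz
    have hz0 := he.nz hz.2 (Ann_ne hr0 hz)
    have hc := collar he hr0 hz
    refine ⟨fun h => ?_, ?_⟩
    · have := hRM.eh _ hc
      rw [h, hRM.e0] at this
      exact inv_ne_zero hz0 this.symm
    · exact (hRM.hd.differentiableAt ((dual_open he hr1).mem_nhds hc)).comp z ((he.at hz.2).inv hz0)
  have hM0 : 0 ≤ M := by have := hM 0 dual_zero; rwa [norm_zero] at this
  have hlow : ∀ z ∈ Ann r 1, 1 ≤ M * B * ‖h' (e z)⁻¹‖ := by
    intro z hz
    have hz0 := he.nz hz.2 (Ann_ne hr0 hz)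
    have hc := collar he hr0 hz
    have hs := Complex.dist_le_div_mul_dist_of_mapsTo_ball (f := e') (c := 0) (R₁ := 1) (R₂ := M) hRM.ed (by
      intro w hw
      rw [hRM.e0, mem_closedBall_zero_iff]
      exact hM _ (hRM.emap w (by simpa using hw))) (z := h' (e z)⁻¹) (by rw [mem_ball_zero_iff]; exact hRM.hmap _ hc)
    rw [hRM.e0, dist_zero_right, dist_zero_right, hRM.eh _ hc, div_one, norm_inv] at hs
    have hn : 0 < ‖e z‖ := norm_pos_iff.2 hz0
    calc (1:ℝ) = ‖e z‖ * ‖e z‖⁻¹ := (mul_inv_cancel₀ hn.ne').symm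
      _ ≤ B * (M * ‖h' (e z)⁻¹‖) := by
          have := hB z hz.2
          have : 0 ≤ B := hn.le.trans this
          gcongr
      _ = _ := by ring
  -- inner circle
  obtain ⟨s, hs1, hs2, hsK⟩ := inner_compact he hr0 hr1 (K := e' '' closedBall 0 lam⁻¹)
    ((isCompact_closedBall 0 _).image_of_continuousOn (hRM.ed.continuousOn.mono (closedBall_subset_ball (inv_lt_one_of_one_lt₀ hl))))
    (by
      rintro _ ⟨w, hw, rfl⟩
      rw [mem_closedBall_zero_iff] at hw
      exact hRM.emap w (hw.trans_lt (inv_lt_one_of_one_lt₀ hl)))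
  have hin : ∀ z ∈ Ann r 1, ‖z‖ ≤ s → 1 ≤ lam * ‖h' (e z)⁻¹‖ := by
    intro z hz hzs
    by_contra hcon
    push Not at hcon
    have hz0 := he.nz hz.2 (Ann_ne hr0 hz)
    have hc := collar he hr0 hz
    refine hsK (a := (e z)⁻¹) ⟨h' (e z)⁻¹, ?_, hRM.eh _ hc⟩ z hzs (inv_mul_cancel₀ hz0)
    rw [mem_closedBall_zero_iff, ← one_div lam, le_div_iff₀ (by linarith)]; linarith
  obtain ⟨s', hs'1, hs'⟩ := exists_between (show r < min s ‖ξ‖ from lt_min hs1 h1)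
  have hs's : s' < s := hs'.trans_le (min_le_left _ _)
  have hs'ξ : s' < ‖ξ‖ := hs'.trans_le (min_le_right _ _)
  set u : ℂ → ℂ := fun z => (z ^ p * h' (e z)⁻¹)⁻¹ with hu
  have hcl : closure (Ann s' t) ⊆ {z | s' ≤ ‖z‖ ∧ ‖z‖ ≤ t} := closure_minimal (fun z hz => ⟨hz.1.le, hz.2.le⟩)
    ((isClosed_le continuous_const continuous_norm).inter (isClosed_le continuous_norm continuous_const))
  have hclA : closure (Ann s' t) ⊆ Ann r 1 := fun z hz => ⟨hs'1.trans_le (hcl hz).1, (hcl hz).2.trans_lt ht⟩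
  have hud : DiffContOnCl ℂ u (Ann s' t) := by
    apply DifferentiableOn.diffContOnCl
    intro z hz
    have hz := hclA hz
    exact ((differentiableAt_id.pow p).mul (hA z hz).2).inv (mul_ne_zero (pow_ne_zero _ (Ann_ne hr0 hz)) (hA z hz).1) |>.differentiableWithinAt
  have hbd : ∀ z ∈ frontier (Ann s' t), ‖u z‖ ≤ lam * (r ^ p)⁻¹ := by
    intro z hz
    have hzc := hcl hz.1
    have hzA := hclA hz.1
    have hpos : 0 < ‖h' (e z)⁻¹‖ := norm_pos_iff.2 (hA z hzA).1
    have hzp : 0 < ‖z‖ := norm_pos_iff.2 (Ann_ne hr0 hzA)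
    have hni : ¬ (s' < ‖z‖ ∧ ‖z‖ < t) := by
      have := hz.2
      rw [(Ann_open s' t).interior_eq] at this
      exact this
    simp only [hu, norm_inv, norm_mul, norm_pow]
    have hrp : 0 < r ^ p := by positivity
    rw [← div_eq_mul_inv, le_div_iff₀ hrp, inv_mul_le_iff₀ (by positivity)]
    by_cases hcase : s' < ‖z‖
    · have hzt : ‖z‖ = t := le_antisymm hzc.2 (not_lt.1 fun h => hni ⟨hcase, h⟩)
      have := hlow z hzA
      rw [hzt]
      have htp : 0 < t ^ p := by have : 0 < t := by linarith
                                 positivity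
      calc r ^ p ≤ r ^ p * (M * B * ‖h' (e z)⁻¹‖) := le_mul_of_one_le_right hrp.le this
        _ = M * B * r ^ p * ‖h' (e z)⁻¹‖ := by ring
        _ ≤ t ^ p * ‖h' (e z)⁻¹‖ := by gcongr
        _ ≤ t ^ p * ‖h' (e z)⁻¹‖ * lam := le_mul_of_one_le_right (by positivity) hl.le
    · have := hin z hzA (by linarith [not_lt.1 hcase])
      calc r ^ p ≤ ‖z‖ ^ p := by gcongr; linarith [hzA.1]
        _ ≤ ‖z‖ ^ p * (lam * ‖h' (e z)⁻¹‖) := le_mul_of_one_le_right (by positivity) this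
        _ = _ := by ring
  have hbdd : Bornology.IsBounded (Ann s' t) := isBounded_ball.subset (fun z hz => show z ∈ ball (0:ℂ) t by simpa using hz.2)
  have hfin := Complex.norm_le_of_forall_mem_frontier_norm_le hbdd hud hbd (subset_closure (show ξ ∈ Ann s' t from ⟨hs'ξ, h2⟩))
  have hξA : ξ ∈ Ann r 1 := ⟨h1, by linarith⟩
  have hpos : 0 < ‖h' (e ξ)⁻¹‖ := norm_pos_iff.2 (hA ξ hξA).1
  have hzp : 0 < ‖ξ‖ := norm_pos_iff.2 (Ann_ne hr0 hξA)
  simp only [hu, norm_inv, norm_mul, norm_pow] at hfin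
  rw [← div_eq_mul_inv, le_div_iff₀ (by positivity), inv_mul_le_iff₀ (by positivity)] at hfin
  linarith

lemma mid_step {e h' e' h2 e2 : ℂ → ℂ} {r r2 ρ ρ2 M B t lam : ℝ} {p : ℕ} (he : Uni e 1) (hr0 : 0 < r) (hrr : r ≤ r2) (hrt : r2 < t) (ht : t < 1)
    (hB : ∀ z, ‖z‖ < 1 → ‖e z‖ ≤ B) (hRM : RM (Dual e r) h' e' ρ) (hRM2 : RM (Dual e r2) h2 e2 ρ2) (hM : ∀ z ∈ Dual e r, ‖z‖ ≤ M)
    (hp : M * B * r ^ p ≤ t ^ p) (hl : 1 < lam) : ρ ≤ ρ2 * (lam * (r2 / r) ^ p) := by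
  have hr2 : 0 < r2 := by linarith
  set q : ℝ := (lam * (r2 / r) ^ p)⁻¹ with hq
  have hbig : 1 < lam * (r2 / r) ^ p := by
    have : 1 ≤ (r2 / r) ^ p := one_le_pow₀ ((one_le_div hr0).2 hrr)
    nlinarith
  have hq0 : 0 < q := inv_pos.2 (by linarith)
  have hq1 : q < 1 := inv_lt_one_of_one_lt₀ hbig
  have hqz : ∀ z : ℂ, ‖z‖ < 1 → ‖(q:ℂ) * z‖ < q := fun z hz => by
    rw [norm_mul, Complex.norm_real, Real.norm_eq_abs, abs_of_pos hq0]; nlinarith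
  have hqz1 : ∀ z : ℂ, ‖z‖ < 1 → ‖(q:ℂ) * z‖ < 1 := fun z hz => (hqz z hz).trans hq1
  have hder : deriv (fun z => e' (q * z)) 0 = ((q * ρ : ℝ) : ℂ) := by
    have h1 : DifferentiableAt ℂ e' ((q:ℂ) * 0) := by rw [mul_zero]; exact hRM.ed.differentiableAt (ball_mem_nhds 0 one_pos)
    have h2 := h1.hasDerivAt.comp (0:ℂ) ((hasDerivAt_id (0:ℂ)).const_mul (q:ℂ))
    have h3 := h2.deriv
    rw [mul_zero, hRM.der] at h3
    refine h3.trans ?_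
    push_cast; ring
  have key := (hRM2.lift (F := fun z => e' (q * z)) (m := q * ρ) ?_ ?_ ?_ hder).2.2.2
  · rw [hq, inv_mul_le_iff₀ (by linarith)] at key
    linarith
  · exact hRM.ed.comp (by fun_prop) fun z hz => by
      have := hqz1 z (by simpa using hz)
      simpa using this
  · intro z hz ξ hξ hv
    have hzD : e' (q * z) ∈ Dual e r := hRM.emap _ (hqz1 z hz)
    have h1 : r < ‖ξ‖ := by
      by_contra hc
      exact hzD ξ (not_lt.1 hc) hv
    have h3 := mid_kappa he hr0 (by linarith) ht hB hRM hM hp hl h1 (hξ.trans_lt hrt)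
    have h4 : (e ξ)⁻¹ = e' (q * z) := (eq_inv_of_mul_eq_one_left hv).symm
    rw [h4, hRM.he _ (hqz1 z hz)] at h3
    have h5 : lam * ‖ξ‖ ^ p * ‖(q:ℂ) * z‖ < r ^ p := by
      have hξ0 : 0 < ‖ξ‖ := by linarith
      calc lam * ‖ξ‖ ^ p * ‖(q:ℂ) * z‖ < lam * ‖ξ‖ ^ p * q := by
            have := hqz z hz
            have : 0 < lam := by linarith
            gcongr
        _ ≤ lam * r2 ^ p * q := by
            have : 0 < lam := by linarith
            gcongr
        _ = r ^ p := by
            have : lam ≠ 0 := by linarith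
            rw [hq, div_pow]; field_simp
    linarith
  · simp [hRM.e0]

lemma chain_exists {f : ℂ → ℂ} {R : ℝ} (hf : Uni f R) (hR : 1 < R) (hd : deriv f 0 = 1) :
    ∀ δ > 0, ∃ M, ∀ ε > 0, ∃ N F φ m, ChainOf f δ ε M N F φ m := by
  intro δ hδ
  obtain ⟨h, e, b, hE⟩ := dual_riemann hf one_pos hR
  have he : Uni e 1 := hE.uni
  have hRM : ∀ r : ℝ, ∃ (h' e' : ℂ → ℂ) (ρ : ℝ), 0 < r → r < 1 → RM (Dual e r) h' e' ρ := by
    intro r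
    by_cases hr : 0 < r ∧ r < 1
    · obtain ⟨h', e', ρ, H⟩ := dual_riemann he hr.1 hr.2
      exact ⟨h', e', ρ, fun _ _ => H⟩
    · exact ⟨0, 0, 0, fun h1 h2 => absurd ⟨h1, h2⟩ hr⟩
  choose H E ρ hRM using hRM
  obtain ⟨r0, hr0, hr0', hend⟩ := end_step hf hR hE hδ
  obtain ⟨M, hM0, hMb⟩ := dual_bdd he hr0 (by linarith)
  obtain ⟨B, hB0, hBb⟩ := dual_bdd hf one_pos hR
  have hB : ∀ z, ‖z‖ < 1 → ‖e z‖ ≤ B := fun z hz => by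
    have := hBb (hE.emap z hz); rw [mem_ball_zero_iff] at this; exact this.le
  have hM : ∀ r, r0 ≤ r → ∀ z ∈ Dual e r, ‖z‖ ≤ M := fun r hr z hz => by
    have := hMb (dual_anti hr hz); rw [mem_ball_zero_iff] at this; exact this.le
  have hfD : ∀ r, r < 1 → ∀ z, ‖z‖ < 1 → f z ∈ Dual e r := by
    intro r hr z hz ξ hξ hv
    rw [mul_comm] at hv
    exact hE.emap ξ (by linarith) z hz.le hv
  have hfH : Hol f := hf.dif.mono (ball_subset_ball hR.le)
  have hone : ∀ r, 0 < r → r < 1 → 1 ≤ ρ r := fun r h1 h2 =>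
    ((hRM r h1 h2).lift (m := 1) hfH (hfD r h2) hf.zero (by simpa using hd)).2.2.2
  have hnice : ∀ r, r0 ≤ r → r < 1 → Nice (E r) (ρ r) M := by
    intro r h1 h2
    have hr : 0 < r := by linarith
    have X := hRM r hr h2
    refine ⟨X.ed, X.e0, fun z hz hz0 => ?_, X.der, hone r hr h2, fun z hz => hM r h1 _ (X.emap z (by simpa using hz))⟩
    have := X.he z (by simpa using hz)
    rw [hz0, X.h0] at this; exact this.symm
  have hnicef : Nice f 1 M := ⟨hfH, hf.zero, fun z hz hz0 => by
      by_contra hne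
      exact hf.nz (by have := mem_ball_zero_iff.1 hz; linarith) hne hz0, by simpa using hd, le_rfl,
    fun z hz => hM r0 le_rfl _ (hfD r0 (by linarith) z (by simpa using hz))⟩
  refine ⟨M, fun ε hε => ?_⟩
  obtain ⟨s, hs1, hs2⟩ := exists_between (show 1 < min R (Real.exp ε) from lt_min hR (Real.one_lt_exp_iff.2 hε))
  obtain ⟨r1', hr1', hfirst⟩ := first_step hf hd hs1 (hs2.trans_le (min_le_left _ _)) hE
  set r1 := max r1' (1/2) with hr1
  have hr1lt : r1 < 1 := max_lt hr1' (by norm_num)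
  have hr1ge : 1/2 ≤ r1 := le_max_right _ _
  have hr1pos : 0 < r1 := by linarith
  set t := (1 + r1) / 2 with ht
  have ht1 : t < 1 := by rw [ht]; linarith
  have hrt : r1 < t := by rw [ht]; linarith
  obtain ⟨p, hp⟩ := pow_unbounded_of_one_lt (M * B) (show 1 < t / r1 by rw [one_lt_div hr1pos]; exact hrt)
  have hp' : ∀ r, 0 < r → r ≤ r1 → M * B * r ^ p ≤ t ^ p := by
    intro r hr hrr
    rw [div_pow, lt_div_iff₀ (by positivity)] at hp
    refine le_trans ?_ hp.le
    gcongr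
  set L := Real.log (r1 / r0) with hL
  have hL0 : 0 ≤ L := Real.log_nonneg (by rw [one_le_div hr0]; linarith)
  obtain ⟨N, hN⟩ := exists_nat_gt (max 1 (2 * L * p / ε))
  have hN1 : (1:ℝ) < N := (le_max_left _ _).trans_lt hN
  have hN2 : 2 * L * p / ε < N := (le_max_right _ _).trans_lt hN
  set rr : ℕ → ℝ := fun i => r1 * Real.exp (-(i * (L / N))) with hrr
  have hrr0 : rr 0 = r1 := by simp [hrr]
  have hrrpos : ∀ i, 0 < rr i := fun i => by simp only [hrr]; positivity
  have hrrN : rr N = r0 := by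
    simp only [hrr]
    rw [mul_div_cancel₀ _ (by linarith : (N:ℝ) ≠ 0), hL, ← Real.log_inv, Real.exp_log (by positivity)]
    field_simp
  have hanti : ∀ i j, i ≤ j → rr j ≤ rr i := by
    intro i j hij
    simp only [hrr]
    have : (i:ℝ) ≤ j := by exact_mod_cast hij
    have : 0 ≤ L / N := by positivity
    gcongr
  have hrrle : ∀ i, rr i ≤ r1 := fun i => by rw [← hrr0]; exact hanti 0 i (Nat.zero_le _)
  have hrrlt : ∀ i, rr i < 1 := fun i => (hrrle i).trans_lt hr1lt
  have hrrge : ∀ i, i ≤ N → r0 ≤ rr i := fun i hi => by rw [← hrrN]; exact hanti i N hi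
  have hratio : ∀ i, rr i / rr (i+1) = Real.exp (L / N) := by
    intro i
    simp only [hrr]
    rw [mul_div_mul_left _ _ hr1pos.ne', ← Real.exp_sub]
    congr 1; push_cast; ring
  have hRMi : ∀ i, RM (Dual e (rr i)) (H (rr i)) (E (rr i)) (ρ (rr i)) := fun i => hRM _ (hrrpos i) (hrrlt i)
  have hlift0 := (hRMi 0).lift (m := 1) hfH (hfD _ (hrrlt 0)) hf.zero (by simpa using hd)
  have hlift : ∀ i, _ := fun i => (hRMi (i+1)).lift (hRMi i).ed (fun z hz => dual_anti (hanti i (i+1) (Nat.le_succ i)) ((hRMi i).emap z hz)) (hRMi i).e0 (hRMi i).der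
  refine ⟨N + 1, fun i => Nat.casesOn i f fun i => E (rr i), fun i => Nat.casesOn i (fun z => H (rr 0) (f z)) fun i z => H (rr (i+1)) (E (rr i) z),
    fun i => Nat.casesOn i 1 fun i => ρ (rr i), ?_, ?_, ?_, ?_, ?_, ?_, rfl, fun _ _ => rfl, ?_⟩
  · rintro (_ | i) hi
    · exact hnicef
    · exact hnice _ (hrrge i (by omega)) (hrrlt i)
  · rintro (_ | i) hi
    · exact hlift0.1
    · exact (hlift i).1
  · rintro (_ | i) hi
    · exact hlift0.2.1
    · exact (hlift i).2.1
  · rintro (_ | i) hi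
    · exact hlift0.2.2.1
    · exact (hlift i).2.2.1
  · rintro (_ | i) hi
    · exact hlift0.2.2.2
    · exact (hlift i).2.2.2
  · rintro (_ | i) hi
    · have := hfirst (rr 0) (by rw [hrr0]; exact le_max_left _ _) _ _ _ (hRMi 0)
      have h2 : s < Real.exp ε := hs2.trans_le (min_le_right _ _)
      change ρ (rr 0) ≤ 1 * Real.exp ε
      linarith
    · have hlam : 1 < Real.exp (ε/2) := Real.one_lt_exp_iff.2 (by linarith)
      have := mid_step he (hrrpos (i+1)) (hanti i (i+1) (Nat.le_succ i)) ((hrrle i).trans_lt hrt) ht1 hB (hRMi (i+1)) (hRMi i)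
        (hM _ (hrrge (i+1) (by omega))) (hp' _ (hrrpos (i+1)) (hrrle (i+1))) hlam
      rw [hratio i, ← Real.exp_nat_mul, ← Real.exp_add] at this
      change ρ (rr (i+1)) ≤ ρ (rr i) * Real.exp ε
      refine this.trans ?_
      have hpos := (hRMi i).pos
      have : ε/2 + p * (L / N) ≤ ε := by
        have h3 : p * (L / N) ≤ ε / 2 := by
          rw [div_lt_iff₀ hε] at hN2
          rw [← mul_div_assoc, div_le_iff₀ (by linarith)]
          linarith
        linarith
      gcongr
  · change ∀ z ∈ ball (0:ℂ) 1, ‖E (rr N) z‖ ≤ Real.exp δ * ρ (rr N)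
    rw [hrrN]
    exact hend _ _ _ (hRM r0 hr0 (by linarith))
end DB

namespace DB
open Metric Filter Topology Set MeasureTheory

lemma ps_hol {a : ℕ → ℂ} (hs : ∀ z ∈ ball (0:ℂ) 1, Summable fun k => a k * z ^ k) : Hol (fun z => ∑' k, a k * z ^ k) := by
  intro z hz
  rw [mem_ball_zero_iff] at hz
  obtain ⟨s, h1, h2⟩ := exists_between hz
  have hs0 : 0 < s := (norm_nonneg z).trans_lt h1
  have hsum : Summable fun k => ‖a k * (s:ℂ) ^ k‖ := (hs s (by simp [abs_of_pos hs0, h2])).norm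
  have := Complex.differentiableOn_tsum_of_summable_norm (F := fun k z => a k * z ^ k) hsum (U := ball 0 s) (fun k => by fun_prop) isOpen_ball (by
    intro k w hw
    rw [mem_ball_zero_iff] at hw
    rw [norm_mul, norm_mul, norm_pow, norm_pow, Complex.norm_real, Real.norm_eq_abs, abs_of_pos hs0]
    gcongr)
  exact (this.differentiableAt (isOpen_ball.mem_nhds (by simpa using h1))).differentiableWithinAt

lemma ps_cf (k : ℕ) : ∀ (a : ℕ → ℂ), (∀ z ∈ ball (0:ℂ) 1, Summable fun k => a k * z ^ k) → cf (fun z => ∑' k, a k * z ^ k) k = a k := by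
  induction k with
  | zero =>
    intro a hs
    rw [cf_zero (ps_hol hs)]
    rw [tsum_eq_single 0]
    · simp
    · intro b hb; simp [hb]
  | succ k ih =>
    intro a hs
    have hs' : ∀ z ∈ ball (0:ℂ) 1, Summable fun k => a (k+1) * z ^ k := by
      intro z hz
      by_cases h0 : z = 0
      · subst h0
        refine summable_of_ne_finset_zero (s := {0}) ?_
        intro b hb
        simp only [Finset.mem_singleton] at hb
        simp [hb]
      · have := ((summable_nat_add_iff 1).2 (hs z hz)).mul_left z⁻¹
        refine this.congr fun k => ?_
        rw [pow_succ]; field_simp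
    have e : ∀ z ∈ sphere (0:ℂ) (1/2), (∑' k, a k * z ^ k) = a 0 + z ^ 1 * ∑' k, a (k+1) * z ^ k := by
      intro z hz
      rw [(hs z (sph_sub (by norm_num) hz)).tsum_eq_zero_add, ← tsum_mul_left]
      simp only [pow_zero, mul_one]
      congr 2
      ext k; ring
    rw [cf_congr e, cf_add (by unfold CS; fun_prop), cf_const, cf_shift _ 1 (k+1) (by omega)]
    · simp only [Nat.add_eq_zero_iff, one_ne_zero, and_false, if_false, zero_add, Nat.add_sub_cancel]
      exact ih (fun k => a (k+1)) hs'
    · have : Hol (fun z : ℂ => z ^ 1 * ∑' k, a (k+1) * z ^ k) := DifferentiableOn.mul (by fun_prop) (ps_hol hs')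
      exact this.cs

lemma rec_of_exp {g Γ : ℂ → ℂ} (hg : Hol g) (hΓ : Hol Γ) (he : ∀ z ∈ ball (0:ℂ) 1, g z = Complex.exp (Γ z)) (k : ℕ) :
    ((k:ℂ)+1) * cf g (k+1) = ∑ j ∈ Finset.range (k+1), ((j:ℂ)+1) * cf Γ (j+1) * cf g (k-j) := by
  have h1 := cf_deriv hg (k+1)
  have hΓ' : Hol (fun z => z * deriv Γ z) := DifferentiableOn.mul (by fun_prop) (hΓ.deriv isOpen_ball)
  have e : ∀ z ∈ sphere (0:ℂ) (1/2), z * deriv g z = (z * deriv Γ z) * g z := by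
    intro z hz
    have hzb := sph_sub (by norm_num) hz
    have hev : g =ᶠ[𝓝 z] fun z => Complex.exp (Γ z) := by
      filter_upwards [isOpen_ball.mem_nhds hzb] with w hw using he w hw
    rw [hev.deriv_eq, ((hΓ.differentiableAt (isOpen_ball.mem_nhds hzb)).hasDerivAt.cexp).deriv, he z hzb]
    ring
  rw [cf_congr e, cf_mul hΓ' hg, Finset.sum_range_succ'] at h1
  simp only [cf_deriv hΓ] at h1
  push_cast at h1
  rw [← h1]
  simp

lemma robertson_core {a : ℕ → ℂ} {g : ℂ → ℂ} {R : ℝ} (hR : 1 < R) (hs : ∀ z ∈ ball (0:ℂ) 1, Summable fun k => a k * z ^ k)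
    (hg : ∀ z ∈ ball (0:ℂ) 1, g z = ∑' k, a k * z ^ k) (ha : a 0 = 1)
    (hU : Uni (fun z => z * g z ^ 2) R) (n : ℕ) : ∑ k ∈ Finset.range (n+1), ‖a k‖ ^ 2 ≤ (n:ℝ) + 1 := by
  have hgH : Hol g := (ps_hol hs).congr hg
  have hg0 : g 0 = 1 := by
    rw [← cf_zero hgH, cf_congr (fun z hz => hg z (sph_sub (by norm_num) hz)), ps_cf 0 a hs, ha]
  have hcf : ∀ k, cf g k = a k := fun k => by
    rw [cf_congr (fun z hz => hg z (sph_sub (by norm_num) hz)), ps_cf k a hs]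
  have hgn : ∀ z ∈ ball (0:ℂ) 1, g z ≠ 0 := by
    intro z hz h
    have hz1 : ‖z‖ < 1 := by simpa using hz
    by_cases h0 : z = 0
    · rw [h0, hg0] at h; exact one_ne_zero h
    · exact hU.nz (by linarith) h0 (by simp [h])
  obtain ⟨Γ, hΓ, hΓ0, hΓe⟩ := exists_log isOpen_ball (convex_ball (0:ℂ) 1).isPreconnected (HP_ball 0 1) (z0 := 0) (by simp) hgH hgn
  rw [hg0, Complex.log_one] at hΓ0
  have hC : Hol (fun z => 2 * Γ z) := hΓ.const_mul 2
  have hd : deriv (fun z => z * g z ^ 2) 0 = 1 := by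
    have h1 : HasDerivAt g (deriv g 0) 0 := (hgH.differentiableAt (ball_mem_nhds 0 one_pos)).hasDerivAt
    have h2 := ((hasDerivAt_id (0:ℂ)).mul (h1.pow 2)).deriv
    refine Eq.trans ?_ (h2.trans ?_)
    · rfl
    · simp [hg0]
  have hM := milin_of_chain (f := fun z => z * g z ^ 2) n hC (by simp [hΓ0]) (fun z hz => by
    rw [hΓe z hz, ← Complex.exp_nat_mul]; norm_num) (chain_exists hU hR hd)
  have hL := lebedev_milin n (cf g) (cf Γ) (by rw [hcf, ha]) (rec_of_exp hgH hΓ hΓe) (by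
    have e : Psi n (cf fun z => 2 * Γ z) 0 = 4 * ∑ k ∈ Finset.range n, ((n:ℝ)-k)*(((k:ℝ)+1)*‖cf Γ (k+1)‖^2 - 1/((k:ℝ)+1)) := by
      rw [Psi, Finset.mul_sum]
      refine Finset.sum_congr rfl fun k hk => ?_
      rw [Finset.mem_range] at hk
      rw [tau_zero n (k+1) (by omega), cf_mul_left, norm_mul]
      push_cast
      rw [Complex.norm_ofNat]
      ring
    linarith)
  simpa only [hcf] using hL

theorem final (f : ℂ → ℂ) (a : ℕ → ℂ)
    (hf : ∀ z ∈ Metric.ball (0 : ℂ) 1, HasSum (fun k : ℕ => a k * z ^ (2 * k + 1)) (f z))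
    (ha1 : a 0 = 1)
    (huniv : Set.InjOn f (Metric.ball (0 : ℂ) 1)) (n : ℕ) :
    ∑ k ∈ Finset.range (n+1), ‖a k‖ ^ 2 ≤ (n:ℝ) + 1 := by
  set g : ℂ → ℂ := fun w => ∑' k, a k * w ^ k with hg
  have hsq : ∀ w : ℂ, ‖w‖ < 1 → ∃ z : ℂ, ‖z‖ < 1 ∧ z ^ 2 = w := by
    intro w hw
    obtain ⟨z, hz⟩ := IsAlgClosed.exists_pow_nat_eq w (n := 2) (by norm_num)
    refine ⟨z, ?_, hz⟩
    rw [← hz, norm_pow] at hw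
    by_contra hc
    nlinarith [not_lt.1 hc]
  have hsum : ∀ w ∈ ball (0:ℂ) 1, Summable fun k => a k * w ^ k := by
    intro w hw
    by_cases h0 : w = 0
    · subst h0
      refine summable_of_ne_finset_zero (s := {0}) ?_
      intro b hb
      simp only [Finset.mem_singleton] at hb
      simp [hb]
    · obtain ⟨z, hz, rfl⟩ := hsq w (by simpa using hw)
      have hz0 : z ≠ 0 := by rintro rfl; simp at h0
      refine ((hf z (by simpa using hz)).summable.mul_left z⁻¹).congr fun k => ?_
      rw [pow_succ, pow_mul]; field_simp
  have hfg : ∀ z : ℂ, ‖z‖ < 1 → f z = z * g (z ^ 2) := by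
    intro z hz
    have h2 : z ^ 2 ∈ ball (0:ℂ) 1 := by
      rw [mem_ball_zero_iff, norm_pow]; exact pow_lt_one₀ (norm_nonneg z) hz (by norm_num)
    have := (hsum _ h2).hasSum.mul_left z
    refine (hf z (by simpa using hz)).unique (this.congr_fun ?_)
    intro k
    ring
  have hF : Uni (fun w => w * g w ^ 2) 1 := by
    refine ⟨DifferentiableOn.mul (by fun_prop) ((ps_hol hsum).pow 2), ?_, by simp⟩
    intro w1 h1 w2 h2 h
    obtain ⟨z1, hz1, rfl⟩ := hsq w1 (by simpa using h1)
    obtain ⟨z2, hz2, rfl⟩ := hsq w2 (by simpa using h2)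
    have e : f z1 ^ 2 = f z2 ^ 2 := by
      rw [hfg z1 hz1, hfg z2 hz2, mul_pow, mul_pow]; exact h
    rcases sq_eq_sq_iff_eq_or_eq_neg.1 e with e | e
    · rw [huniv (by simpa using hz1) (by simpa using hz2) e]
    · have : f (-z2) = - f z2 := by
        rw [hfg z2 hz2, hfg (-z2) (by simpa using hz2)]; simp
      rw [← this] at e
      rw [huniv (by simpa using hz1) (by simpa using hz2) e]; ring
  have hr : ∀ r : ℝ, 0 < r → r < 1 → ∑ k ∈ Finset.range (n+1), (‖a k‖ * r ^ k) ^ 2 ≤ (n:ℝ) + 1 := by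
    intro r hr0 hr1
    have hrc : (r:ℂ) ≠ 0 := by exact_mod_cast hr0.ne'
    have hrn : ∀ z : ℂ, ‖(r:ℂ) * z‖ = r * ‖z‖ := fun z => by
      rw [norm_mul, Complex.norm_real, Real.norm_eq_abs, abs_of_pos hr0]
    have hrb : ∀ z ∈ ball (0:ℂ) r⁻¹, (r:ℂ) * z ∈ ball (0:ℂ) 1 := fun z hz => by
      rw [mem_ball_zero_iff] at hz ⊢
      rw [hrn]
      calc r * ‖z‖ < r * r⁻¹ := by gcongr
        _ = 1 := mul_inv_cancel₀ hr0.ne'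
    have hR : 1 < r⁻¹ := (one_lt_inv₀ hr0).2 hr1
    have hb1 : ∀ z ∈ ball (0:ℂ) 1, (r:ℂ) * z ∈ ball (0:ℂ) 1 := fun z hz => hrb z (ball_subset_ball hR.le hz)
    have hU : Uni (fun z => z * g (r * z) ^ 2) r⁻¹ := by
      have e : ∀ z : ℂ, z * g (r * z) ^ 2 = (r:ℂ)⁻¹ * ((r * z) * g (r * z) ^ 2) := fun z => by field_simp
      refine ⟨?_, ?_, by simp⟩
      · have : DifferentiableOn ℂ (fun z : ℂ => (fun w => w * g w ^ 2) (r * z)) (ball 0 r⁻¹) := hF.dif.comp (by fun_prop) hrb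
        exact (this.const_mul (r:ℂ)⁻¹).congr fun z _ => e z
      · intro z1 h1 z2 h2 h
        simp only [e] at h
        have := hF.inj (hrb z1 h1) (hrb z2 h2) (mul_left_cancel₀ (inv_ne_zero hrc) h)
        exact mul_left_cancel₀ hrc this
    have hpw : ∀ z : ℂ, ∀ k, a k * (r * z) ^ k = a k * r ^ k * z ^ k := fun z k => by rw [mul_pow]; ring
    have := robertson_core (a := fun k => a k * (r:ℂ) ^ k) hR (fun z hz => (hsum _ (hb1 z hz)).congr (hpw z)) (fun z hz => tsum_congr (hpw z)) (by simp [ha1]) hU n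
    simpa [norm_mul, norm_pow, abs_of_pos hr0] using this
  have hlim : Tendsto (fun r : ℝ => ∑ k ∈ Finset.range (n+1), (‖a k‖ * r ^ k) ^ 2) (𝓝[<] 1) (𝓝 (∑ k ∈ Finset.range (n+1), (‖a k‖ * 1 ^ k) ^ 2)) := by
    have : Continuous (fun r : ℝ => ∑ k ∈ Finset.range (n+1), (‖a k‖ * r ^ k) ^ 2) := by fun_prop
    exact (this.tendsto 1).mono_left nhdsWithin_le_nhds
  simp only [one_pow, mul_one] at hlim
  refine le_of_tendsto hlim ?_
  have : Ioo (0:ℝ) 1 ∈ 𝓝[<] (1:ℝ) := Ioo_mem_nhdsLT one_pos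
  filter_upwards [this] with r hr' using hr r hr'.1 hr'.2
end DB

theorem odd_univalent_partial_sum_bound (f : ℂ → ℂ) (a : ℕ → ℂ)
    (hf : ∀ z ∈ Metric.ball (0 : ℂ) 1, HasSum (fun k : ℕ => a k * z ^ (2 * k + 1)) (f z))
    (ha1 : a 0 = 1)
    (huniv : Set.InjOn f (Metric.ball (0 : ℂ) 1)) :
    ∀ n : ℕ, 0 < n → ∑ k ∈ Finset.range n, ‖a k‖ ≤ (n : ℝ) := by
  intro n hn
  obtain ⟨m, rfl⟩ : ∃ m, n = m + 1 := ⟨n - 1, by omega⟩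
  have h1 := DB.final f a hf ha1 huniv m
  have h2 : ∑ k ∈ Finset.range (m+1), ‖a k‖ ≤ ∑ k ∈ Finset.range (m+1), (‖a k‖ ^ 2 + 1) / 2 :=
    Finset.sum_le_sum fun k _ => by nlinarith [sq_nonneg (‖a k‖ - 1)]
  rw [← Finset.sum_div, Finset.sum_add_distrib, Finset.sum_const, Finset.card_range, nsmul_eq_mul, mul_one] at h2
  push_cast at h2 ⊢
  linarith
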